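/- arXiv:1208.0913 — 5 statements merged into one kernel-verified Lean document; each statement's English description precedes it below -/
import Mathlib

section
/- Let v_0, …, v_k be positive integers, set d_i = gcd(v_0, …, v_i) for 0 ≤ i ≤ k and n_i = d_{i-1}/d_i for 1 ≤ i ≤ k. Then every integer a divisible by d_k can be written as a = a_0 v_0 + a_1 v_1 + ⋯ + a_k v_k with a_0 ∈ ℤ and 0 ≤ a_i < n_i for i ∈ {1, …, k}, and the sequence (a_0, …, a_k) with these constraints is unique. -/
/-- A congruence `w * x ≡ a [MOD m]` with `gcd m w ∣ a` has exactly one solution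
with `0 ≤ x < m / gcd m w`. -/
theorem existsUnique_dvd_sub_mul {m w : ℕ} (hm : 0 < m) {a : ℤ} (ha : (m.gcd w : ℤ) ∣ a) :
    ∃! x : ℤ, (0 ≤ x ∧ x < ((m / m.gcd w : ℕ) : ℤ)) ∧ (m : ℤ) ∣ a - x * w := by
  obtain ⟨g, N, w', hg, hcop, rfl, rfl⟩ := Nat.exists_coprime' (Nat.gcd_pos_of_pos_left w hm)
  have hN : 0 < N := Nat.pos_of_mul_pos_right hm
  have hgcd : (N * g).gcd (w' * g) = g := by
    rw [Nat.gcd_mul_right, hcop.gcd_eq_one, one_mul]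
  rw [hgcd] at ha ⊢
  rw [Nat.mul_div_cancel _ hg]
  have hNz : (0 : ℤ) < N := by exact_mod_cast hN
  have hgz : (g : ℤ) ≠ 0 := by exact_mod_cast hg.ne'
  have hcz : IsCoprime (N : ℤ) w' := Nat.isCoprime_iff_coprime.mpr hcop
  obtain ⟨b, rfl⟩ := ha
  have key : ∀ x : ℤ, ((N * g : ℕ) : ℤ) ∣ g * b - x * ((w' * g : ℕ) : ℤ) ↔
      (N : ℤ) ∣ b - x * w' := fun x ↦ by
    rw [show (g * b - x * ((w' * g : ℕ) : ℤ) : ℤ) = (b - x * w') * g by push_cast; ring,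
      Nat.cast_mul, mul_dvd_mul_iff_right hgz]
  simp only [key]
  obtain ⟨u, t, hut⟩ := hcz
  refine ⟨t * b % N, ⟨⟨Int.emod_nonneg _ hNz.ne', Int.emod_lt_of_pos _ hNz⟩,
    ⟨u * b + t * b / N * w', ?_⟩⟩, ?_⟩
  · have h := Int.emod_add_mul_ediv (t * b) N
    linear_combination (-b) * hut - w' * h
  · rintro y ⟨⟨hy0, hyN⟩, z, hz⟩
    rw [← Int.emod_eq_of_lt hy0 hyN, Int.emod_eq_emod_iff_emod_sub_eq_zero]
    exact Int.emod_eq_zero_of_dvd ⟨y * u - t * z, by linear_combination (-y) * hut - t * hz⟩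

/-- Bézout's relation for the gcd's of a sequence of positive integers:
every integer divisible by `d k = gcd (v 0, …, v k)` has a unique representation
`a = a₀ v₀ + ⋯ + a_k v_k` with `a₀ ∈ ℤ` and `0 ≤ a_i < n_i` for `1 ≤ i ≤ k`. -/
theorem bezout_relation (k : ℕ) (v : ℕ → ℕ) (hv : ∀ i ≤ k, 0 < v i)
    (d : ℕ → ℕ) (hd : ∀ i, d i = (Finset.range (i + 1)).gcd v)
    (n : ℕ → ℕ) (hn : ∀ i, 1 ≤ i → n i = d (i - 1) / d i)
    (a : ℤ) (ha : (d k : ℤ) ∣ a) :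
    ∃! c : Fin (k + 1) → ℤ,
      (∀ i : Fin (k + 1), 1 ≤ (i : ℕ) → 0 ≤ c i ∧ c i < (n (i : ℕ) : ℤ)) ∧
      a = ∑ i : Fin (k + 1), c i * (v (i : ℕ) : ℤ) := by
  induction k generalizing a with
  | zero =>
    have h0 : d 0 = v 0 := by simp [hd]
    have hv0 : (v 0 : ℤ) ≠ 0 := by exact_mod_cast (hv 0 le_rfl).ne'
    obtain ⟨b, rfl⟩ := h0 ▸ ha
    refine ⟨fun _ ↦ b, ⟨fun i hi ↦ by omega, by simp [mul_comm]⟩, ?_⟩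
    rintro c ⟨-, hc⟩
    ext i
    rw [Fin.fin_one_eq_zero i]
    refine mul_left_cancel₀ hv0 ?_
    simpa [mul_comm] using hc.symm
  | succ k ih =>
    have hgcd : d (k + 1) = (d k).gcd (v (k + 1)) := by
      rw [hd, hd, Finset.range_add_one, Finset.gcd_insert, gcd_comm]
      rfl
    have hpos : 0 < d k := by
      refine Nat.pos_of_ne_zero fun h ↦ (hv 0 (Nat.zero_le _)).ne' ?_
      rw [hd, Finset.gcd_eq_zero_iff] at h
      exact h 0 (by simp)
    have hdvd (c : Fin (k + 1) → ℤ) : (d k : ℤ) ∣ ∑ i : Fin (k + 1), c i * (v (i : ℕ) : ℤ) := by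
      refine Finset.dvd_sum fun i _ ↦ Dvd.dvd.mul_left (Int.natCast_dvd_natCast.mpr ?_) _
      rw [hd]
      exact Finset.gcd_dvd (Finset.mem_range.mpr i.isLt)
    have hnk : n (k + 1) = d k / (d k).gcd (v (k + 1)) := by
      rw [hn _ (Nat.le_add_left _ _), Nat.add_sub_cancel, hgcd]
    obtain ⟨x, ⟨hx, hxa⟩, hxu⟩ := existsUnique_dvd_sub_mul hpos (hgcd ▸ ha)
    obtain ⟨c, ⟨hc, hca⟩, hcu⟩ := ih (fun i hi ↦ hv i (Nat.le_succ_of_le hi)) _ hxa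
    refine ⟨Fin.snoc (α := fun _ ↦ ℤ) c x, ⟨fun i ↦ ?_, ?_⟩, ?_⟩
    · induction i using Fin.lastCases with
      | last => simpa [hnk] using hx
      | cast i => simpa using hc i
    · rw [Fin.sum_univ_castSucc]
      simp only [Fin.snoc_castSucc, Fin.snoc_last, Fin.val_castSucc, Fin.val_last, ← hca]
      ring
    · rintro e ⟨he, hea⟩
      rw [Fin.sum_univ_castSucc] at hea
      simp only [Fin.val_castSucc, Fin.val_last] at hea
      have hinit : a - e (Fin.last (k + 1)) * v (k + 1) =
          ∑ i : Fin (k + 1), e i.castSucc * (v (i : ℕ) : ℤ) := by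
        rw [hea]
        ring
      have hlast : e (Fin.last (k + 1)) = x := by
        refine hxu _ ⟨?_, hinit ▸ hdvd fun i ↦ e i.castSucc⟩
        simpa [hnk] using he (Fin.last (k + 1)) (by simp)
      have hcast : (fun i : Fin (k + 1) ↦ e i.castSucc) = c :=
        hcu _ ⟨fun i hi ↦ by simpa using he i.castSucc hi, by rw [← hinit, hlast]⟩
      ext i
      induction i using Fin.lastCases with
      | last => simpa using hlast
      | cast i => simpa using congrFun hcast i
end

section
/- Let G = ℕv_0 + ⋯ + ℕv_h where (v_0, …, v_h) is a Seidenberg n-characteristic sequence, and let c = Σ_{k=1}^h (n_k − 1) v_k − v_0 + 1. Then for every pair of integers a, b with a + b = c − 1, exactly one element of the pair (a, b) belongs to G; consequently c is the smallest element of G such that every integer greater than or equal to c lies in G. Moreover c is even and the number of elements of ℕ \ G equals c/2. -/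
def eseq (b : ℕ → ℕ) (k : ℕ) : ℕ := (Finset.range (k + 1)).gcd b

def nseq (b : ℕ → ℕ) (k : ℕ) : ℕ := eseq b (k - 1) / eseq b k

/-- `(v 0, …, v h)` is a Seidenberg `n`-characteristic sequence. -/
def SeidenbergSeq (n h : ℕ) (b : ℕ → ℕ) : Prop :=
  b 0 = n ∧ (∀ i ≤ h, 0 < b i) ∧ eseq b h = 1 ∧
  (∀ i, 1 ≤ i → i ≤ h → 1 < nseq b i) ∧
  (∀ i, 2 ≤ i → i ≤ h → nseq b (i - 1) * b (i - 1) < b i)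

/-- The submonoid of `ℤ` generated by `v 0, …, v k`. -/
def genUpTo (v : ℕ → ℕ) (k : ℕ) : AddSubmonoid ℤ where
  carrier := {m : ℤ | ∃ a : ℕ → ℕ, m = ∑ i ∈ Finset.range (k + 1), (a i * v i : ℤ)}
  zero_mem' := ⟨0, by simp⟩
  add_mem' := by
    rintro _ _ ⟨a, rfl⟩ ⟨b, rfl⟩
    refine ⟨a + b, ?_⟩
    rw [← Finset.sum_add_distrib]
    exact Finset.sum_congr rfl fun i _ => by push_cast [Pi.add_apply]; ring

/-- For a Seidenberg sequence, the largest multiple of `eseq v k` outside `genUpTo v k`. -/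
def frobUpTo (v : ℕ → ℕ) (k : ℕ) : ℤ :=
  ∑ i ∈ Finset.Icc 1 k, ((nseq v i : ℤ) - 1) * (v i : ℤ) - (v 0 : ℤ)

theorem mem_genUpTo {v : ℕ → ℕ} {k : ℕ} {m : ℤ} :
    m ∈ genUpTo v k ↔ ∃ a : ℕ → ℕ, m = ∑ i ∈ Finset.range (k + 1), (a i * v i : ℤ) :=
  Iff.rfl

theorem mem_genUpTo_zero {v : ℕ → ℕ} {m : ℤ} :
    m ∈ genUpTo v 0 ↔ ∃ i : ℕ, m = i * v 0 := by
  rw [mem_genUpTo]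
  constructor
  · rintro ⟨a, ha⟩
    exact ⟨a 0, by simpa using ha⟩
  · rintro ⟨i, hi⟩
    exact ⟨fun _ => i, by simpa using hi⟩

theorem mem_genUpTo_succ {v : ℕ → ℕ} {k : ℕ} {m : ℤ} :
    m ∈ genUpTo v (k + 1) ↔ ∃ i : ℕ, m - i * v (k + 1) ∈ genUpTo v k := by
  constructor
  · rintro ⟨a, rfl⟩
    exact ⟨a (k + 1), a, by rw [Finset.sum_range_succ]; ring⟩
  · rintro ⟨i, a, ha⟩
    refine ⟨Function.update a (k + 1) i, ?_⟩
    rw [Finset.sum_range_succ, Function.update_self, ← sub_eq_iff_eq_add, ha]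
    refine Finset.sum_congr rfl fun j hj => ?_
    rw [Function.update_of_ne (Finset.mem_range.mp hj).ne]

theorem nonneg_of_mem_genUpTo {v : ℕ → ℕ} {k : ℕ} {m : ℤ} (hm : m ∈ genUpTo v k) : 0 ≤ m := by
  obtain ⟨a, rfl⟩ := hm
  positivity

theorem eseq_dvd_of_mem_genUpTo {v : ℕ → ℕ} {k : ℕ} {m : ℤ} (hm : m ∈ genUpTo v k) :
    (eseq v k : ℤ) ∣ m := by
  obtain ⟨a, rfl⟩ := hm
  exact Finset.dvd_sum fun i hi =>
    Dvd.dvd.mul_left (Int.natCast_dvd_natCast.mpr (Finset.gcd_dvd hi)) _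

theorem eseq_zero (v : ℕ → ℕ) : eseq v 0 = v 0 := by
  simp [eseq]

theorem eseq_succ (v : ℕ → ℕ) (k : ℕ) : eseq v (k + 1) = Nat.gcd (v (k + 1)) (eseq v k) := by
  rw [eseq, Finset.range_add_one, Finset.gcd_insert]
  rfl

theorem eseq_eq_nseq_mul (v : ℕ → ℕ) (k : ℕ) :
    eseq v k = nseq v (k + 1) * eseq v (k + 1) := by
  rw [nseq, Nat.add_sub_cancel]
  exact (Nat.div_mul_cancel (eseq_succ v k ▸ Nat.gcd_dvd_right _ _)).symm

theorem frobUpTo_succ (v : ℕ → ℕ) (k : ℕ) :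
    frobUpTo v (k + 1) = frobUpTo v k + ((nseq v (k + 1) : ℤ) - 1) * v (k + 1) := by
  rw [frobUpTo, frobUpTo, Finset.sum_Icc_succ_top (by lia)]
  ring

/-- Gluing a new generator `w` onto a symmetric submonoid of `dℤ` yields a symmetric submonoid
of `d'ℤ`, where `d' = gcd d w`, provided `(d / d') * w` already lies in the submonoid. -/
theorem xor_mem_of_glue (S : AddSubmonoid ℤ) {d d' w n x y C : ℤ} (hd : d = n * d')
    (hd' : 0 < d') (hn : 0 < n) (hw : d' ∣ w) (bez : d' = w * x + d * y)
    (hS : ∀ s ∈ S, d ∣ s) (hnw : n * w ∈ S) (hdC : d ∣ C)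
    (hC : ∀ m, d ∣ m → Xor (m ∈ S) (C - m ∈ S)) (m : ℤ) (hm : d' ∣ m) :
    Xor (∃ i : ℕ, m - i * w ∈ S) (∃ i : ℕ, C + (n - 1) * w - m - i * w ∈ S) := by
  have hdnw : d ∣ n * w := hd ▸ mul_dvd_mul_left n hw
  have reduce : ∀ m j : ℤ, d ∣ m - j * w → 0 ≤ j → j < n →
      ((∃ i : ℕ, m - i * w ∈ S) ↔ m - j * w ∈ S) := by
    intro m j hj h0 hjn
    refine ⟨?_, fun h => ⟨j.toNat, by rwa [Int.toNat_of_nonneg h0]⟩⟩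
    rintro ⟨i, hi⟩
    have h1 : n * d' ∣ (i - j) * w := by
      have hij : (i - j) * w = (m - j * w) - (m - i * w) := by ring
      rw [← hd, hij]
      exact dvd_sub hj (hS _ hi)
    have h2 : n * d' ∣ (i - j) * d' := by
      have : (i - j) * d' = (i - j) * w * x + n * d' * ((i - j) * y) := by
        linear_combination (i - j) * bez + (i - j) * y * hd
      rw [this]
      exact dvd_add (h1.mul_right x) (dvd_mul_right _ _)
    obtain ⟨q, hq⟩ := Int.dvd_of_mul_dvd_mul_right hd'.ne' h2
    have hq0 : 0 ≤ q := by
      by_contra! hneg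
      nlinarith [Int.natCast_nonneg i]
    have : m - j * w = (m - i * w) + q.toNat • (n * w) := by
      rw [nsmul_eq_mul, Int.toNat_of_nonneg hq0]
      linear_combination w * hq
    rw [this]
    exact S.add_mem hi (S.nsmul_mem hnw _)
  obtain ⟨t, rfl⟩ := hm
  set j := (t * x) % n
  have hj0 : 0 ≤ j := Int.emod_nonneg _ hn.ne'
  have hjn : j < n := Int.emod_lt_of_pos _ hn
  have hdj : d ∣ d' * t - j * w := by
    have : d' * t - j * w = d * (y * t) + (n * w) * ((t * x) / n) := by
      linear_combination t * bez - w * Int.emod_add_mul_ediv (t * x) n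
    rw [this]
    exact dvd_add (dvd_mul_right _ _) (hdnw.mul_right _)
  have hsub : C + (n - 1) * w - d' * t - (n - 1 - j) * w = C - (d' * t - j * w) := by ring
  rw [reduce _ j hdj hj0 hjn, reduce _ (n - 1 - j) (hsub ▸ dvd_sub hdC hdj) (by lia) (by lia),
    hsub]
  exact hC _ hdj

theorem frobUpTo_lt {n h : ℕ} {v : ℕ → ℕ} (hv : SeidenbergSeq n h v) {k : ℕ} (hk : k + 1 ≤ h) :
    frobUpTo v k < v (k + 1) := by
  obtain ⟨-, hpos, -, -, hlt⟩ := hv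
  induction k with
  | zero =>
    have := hpos 1 hk
    rw [frobUpTo, Finset.Icc_eq_empty (by lia), Finset.sum_empty]
    lia
  | succ k ih =>
    have h1 := ih (by lia)
    have h2 : ((nseq v (k + 1) * v (k + 1) : ℕ) : ℤ) < v (k + 2) :=
      Int.ofNat_lt.mpr (hlt (k + 2) (by lia) hk)
    push_cast at h2
    rw [frobUpTo_succ]
    linarith

theorem eseq_dvd_frobUpTo (v : ℕ → ℕ) (k : ℕ) : (eseq v k : ℤ) ∣ frobUpTo v k := by
  have key : ∀ i ≤ k, (eseq v k : ℤ) ∣ v i := fun i hi =>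
    Int.natCast_dvd_natCast.mpr (Finset.gcd_dvd (Finset.mem_range.mpr (by lia)))
  exact dvd_sub (Finset.dvd_sum fun i hi => (key i (Finset.mem_Icc.mp hi).2).mul_left _)
    (key 0 (Nat.zero_le k))

theorem xor_mem_genUpTo {n h : ℕ} {v : ℕ → ℕ} (hv : SeidenbergSeq n h v) {k : ℕ} (hk : k ≤ h)
    (m : ℤ) (hm : (eseq v k : ℤ) ∣ m) :
    Xor (m ∈ genUpTo v k) (frobUpTo v k - m ∈ genUpTo v k) := by
  have hv' := hv
  obtain ⟨-, hpos, -, hn, -⟩ := hv'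
  induction k generalizing m with
  | zero =>
    rw [eseq_zero] at hm
    obtain ⟨t, rfl⟩ := hm
    have h0 : (0 : ℤ) < v 0 := by exact_mod_cast hpos 0 hk
    have key : ∀ s : ℤ, v 0 * s ∈ genUpTo v 0 ↔ 0 ≤ s := by
      intro s
      refine ⟨fun hs => ?_, fun hs => ?_⟩
      · exact nonneg_of_mul_nonneg_right (nonneg_of_mem_genUpTo hs) h0
      · exact mem_genUpTo_zero.mpr ⟨s.toNat, by rw [Int.toNat_of_nonneg hs]; ring⟩
    have hsub : frobUpTo v 0 - v 0 * t = v 0 * (-1 - t) := by simp [frobUpTo]; ring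
    rw [hsub, key, key]
    rcases le_or_gt 0 t with ht | ht
    · exact Or.inl ⟨ht, by lia⟩
    · exact Or.inr ⟨by lia, by lia⟩
  | succ k ih =>
    have hlt := frobUpTo_lt hv hk
    have hn1 : 1 < nseq v (k + 1) := hn (k + 1) (by lia) hk
    have hgcd := eseq_succ v k
    have hmul := eseq_eq_nseq_mul v k
    have hvpos := hpos (k + 1) hk
    have hdvd : eseq v (k + 1) ∣ v (k + 1) := hgcd ▸ Nat.gcd_dvd_left _ _
    have hmem : (nseq v (k + 1) : ℤ) * v (k + 1) ∈ genUpTo v k := by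
      have hdiv : (eseq v k : ℤ) ∣ nseq v (k + 1) * v (k + 1) := by
        rw [hmul]
        exact_mod_cast mul_dvd_mul_left _ hdvd
      rcases ih (by lia) _ hdiv with h1 | h1
      · exact h1.1
      · have := nonneg_of_mem_genUpTo h1.1
        have h2 : (1 : ℤ) < nseq v (k + 1) := by exact_mod_cast hn1
        nlinarith
    rw [mem_genUpTo_succ, mem_genUpTo_succ, frobUpTo_succ]
    refine xor_mem_of_glue (genUpTo v k) (d := eseq v k) (d' := eseq v (k + 1))
      (x := Nat.gcdA (v (k + 1)) (eseq v k)) (y := Nat.gcdB (v (k + 1)) (eseq v k))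
      (by exact_mod_cast hmul) ?_ (by exact_mod_cast (by lia : 0 < nseq v (k + 1)))
      (by exact_mod_cast hdvd) (by rw [hgcd]; exact Nat.gcd_eq_gcd_ab _ _)
      (fun s hs => eseq_dvd_of_mem_genUpTo hs) hmem (eseq_dvd_frobUpTo v k)
      (ih (by lia)) m hm
    exact_mod_cast Nat.pos_of_dvd_of_pos hdvd hvpos

/-- The gaps of a symmetric set of nonnegative integers with Frobenius number `c - 1` make up
half of the interval `[0, c)`. -/
theorem two_mul_ncard_gaps {G : Set ℤ} {c : ℤ} (hc : 0 ≤ c) (hG : ∀ m ∈ G, 0 ≤ m)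
    (hxor : ∀ a b : ℤ, a + b = c - 1 → Xor (a ∈ G) (b ∈ G)) :
    2 * (({m : ℕ | (m : ℤ) ∉ G}).ncard : ℤ) = c := by
  classical
  lift c to ℕ using hc
  have hgap : {m : ℕ | (m : ℤ) ∉ G} = ((Finset.range c).filter fun m : ℕ => (m : ℤ) ∉ G) := by
    ext m
    simp only [Set.mem_ofPred_eq, Finset.coe_filter, Finset.mem_range, iff_and_self]
    intro hm
    rcases hxor m (c - 1 - m) (by ring) with h | h
    · exact absurd h.1 hm
    · have := hG _ h.1
      lia
  have hcard : ((Finset.range c).filter fun m : ℕ => (m : ℤ) ∈ G).card =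
      ((Finset.range c).filter fun m : ℕ => (m : ℤ) ∉ G).card := by
    refine Finset.card_bij' (fun m _ => c - 1 - m) (fun m _ => c - 1 - m) ?_ ?_ ?_ ?_ <;>
      simp only [Finset.mem_filter, Finset.mem_range] <;> rintro m ⟨hm, hmG⟩
    · rcases hxor m (c - 1 - m : ℕ) (by lia) with h | h
      · exact ⟨by lia, h.2⟩
      · exact absurd hmG h.2
    · rcases hxor m (c - 1 - m : ℕ) (by lia) with h | h
      · exact absurd h.1 hmG
      · exact ⟨by lia, h.1⟩
    · lia
    · lia
  have htot := Finset.card_filter_add_card_filter_not (s := Finset.range c)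
    (fun m : ℕ => (m : ℤ) ∈ G)
  rw [hcard, Finset.card_range] at htot
  rw [hgap, Set.ncard_coe_finset]
  lia

/-- Properties of the conductor `c = Σ_{k=1}^h (n_k - 1) v_k - v_0 + 1` of the semigroup
generated by a Seidenberg `n`-characteristic sequence: for `a + b = c - 1` exactly one of
`a, b` lies in `G`; `c` is the least element of `G` all of whose successors lie in `G`;
`c` is even and `#(ℕ \ G) = c / 2`. -/
theorem conductor_of_seidenberg (n h : ℕ) (v : ℕ → ℕ) (hv : SeidenbergSeq n h v)
    (G : Set ℤ)
    (hG : G = {m : ℤ | ∃ a : ℕ → ℕ, m = ∑ i ∈ Finset.range (h + 1), (a i * v i : ℤ)})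
    (c : ℤ)
    (hc : c = ∑ k ∈ Finset.Icc 1 h, ((nseq v k : ℤ) - 1) * (v k : ℤ) - (v 0 : ℤ) + 1) :
    (∀ a b : ℤ, a + b = c - 1 → Xor' (a ∈ G) (b ∈ G)) ∧
    IsLeast {m : ℤ | m ∈ G ∧ ∀ p : ℤ, m ≤ p → p ∈ G} c ∧
    Even c ∧ 2 * (({m : ℕ | (m : ℤ) ∉ G}).ncard : ℤ) = c := by
  obtain rfl : G = (genUpTo v h : Set ℤ) := hG
  have hfrob : c - 1 = frobUpTo v h := by rw [hc, frobUpTo]; ring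
  have hxor : ∀ a b : ℤ, a + b = c - 1 →
      Xor (a ∈ (genUpTo v h : Set ℤ)) (b ∈ (genUpTo v h : Set ℤ)) := by
    intro a b hab
    have := xor_mem_genUpTo hv le_rfl a (by rw [hv.2.2.1]; simp)
    rwa [← hfrob, ← hab, add_sub_cancel_left] at this
  have hnonneg : ∀ m ∈ (genUpTo v h : Set ℤ), 0 ≤ m := fun m hm => nonneg_of_mem_genUpTo hm
  have hlarge : ∀ p : ℤ, c ≤ p → p ∈ (genUpTo v h : Set ℤ) := by
    intro p hp
    rcases hxor p (c - 1 - p) (by ring) with h1 | h1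
    · exact h1.1
    · have := hnonneg _ h1.1
      lia
  have hfrob_notMem : c - 1 ∉ (genUpTo v h : Set ℤ) := by
    rcases hxor 0 (c - 1) (by ring) with h1 | h1
    · exact h1.2
    · exact absurd (genUpTo v h).zero_mem h1.2
  have hcard := two_mul_ncard_gaps (hnonneg c (hlarge c le_rfl)) hnonneg hxor
  refine ⟨hxor, ⟨⟨hlarge c le_rfl, hlarge⟩, ?_⟩, hcard ▸ even_two_mul _, hcard⟩
  rintro m ⟨-, hm⟩
  by_contra! hlt
  exact hfrob_notMem (hm _ (by lia))
end

section
/- Let A be a nonempty set and d : A × A → ℝ ∪ {+∞} a logarithmic distance. For any elements a_1, …, a_m, b_1, …, b_n, c ∈ A, at least one of the following holds: (I) there exists j ∈ {1, …, n} such that d(a_i, c) ≤ d(a_i, b_j) for every i ∈ {1, …, m}; or (II) there exists i ∈ {1, …, m} such that d(b_j, c) ≤ d(a_i, b_j) for every j ∈ {1, …, n}. -/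
/-- A logarithmic distance on `A`: values in `ℝ ∪ {+∞}`, `d a a = +∞`, symmetry,
and the strong triangle inequality `d a b ≥ inf {d a c, d b c}`. -/
def IsLogDist {A : Type*} (d : A → A → WithTop ℝ) : Prop :=
  (∀ a, d a a = ⊤) ∧ (∀ a b, d a b = d b a) ∧ (∀ a b c, min (d a c) (d b c) ≤ d a b)

/-- For a logarithmic distance `d` and elements `a_1, …, a_m`, `b_1, …, b_n`, `c`,
either (I) there is `j` with `d(a_i, c) ≤ d(a_i, b_j)` for all `i`, or
(II) there is `i` with `d(b_j, c) ≤ d(a_i, b_j)` for all `j`. -/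
theorem log_dist_alternative {A : Type*} [Nonempty A] (d : A → A → WithTop ℝ)
    (hd : IsLogDist d) (m n : ℕ) (hm : 0 < m) (hn : 0 < n)
    (a : Fin m → A) (b : Fin n → A) (c : A) :
    (∃ j : Fin n, ∀ i : Fin m, d (a i) c ≤ d (a i) (b j)) ∨
    (∃ i : Fin m, ∀ j : Fin n, d (b j) c ≤ d (a i) (b j)) := by
  obtain ⟨-, -, htri⟩ := hd
  have : Nonempty (Fin m) := ⟨⟨0, hm⟩⟩
  have : Nonempty (Fin n) := ⟨⟨0, hn⟩⟩
  obtain ⟨i₀, hi₀⟩ := Finite.exists_max fun i => d (a i) c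
  obtain ⟨j₀, hj₀⟩ := Finite.exists_max fun j => d (b j) c
  rcases le_total (d (a i₀) c) (d (b j₀) c) with h | h
  · exact Or.inl ⟨j₀, fun i => (le_min le_rfl ((hi₀ i).trans h)).trans (htri _ _ _)⟩
  · exact Or.inr ⟨i₀, fun j => (le_min ((hj₀ j).trans h) le_rfl).trans (htri _ _ _)⟩
end

section
/- (Abhyankar–Moh Embedding Line Theorem) Let K be an algebraically closed field and let F = (P, Q) : K → K² be a polynomial embedding, i.e. P, Q ∈ K[t] and there exists a polynomial G ∈ K[x,y] with G(P(t), Q(t)) = t identically. Suppose m = deg P, n = deg Q > 0, and gcd(m, n) is not divisible by char K. Then m divides n or n divides m. -/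
section AbhyankarMoh

set_option linter.unusedSectionVars false

open Polynomial

section InitialForms

variable {K L : Type*} [Field K] [Field L] [Algebra (PowerSeries K) L]
  [IsFractionRing (PowerSeries K) L]

/-- The image in `L = Frac K⟦τ⟧` of the uniformizer `τ`. -/
noncomputable def unif (K L : Type*) [Field K] [Field L] [Algebra (PowerSeries K) L] : L :=
  algebraMap (PowerSeries K) L PowerSeries.X

/-- `HasInit H M s` says that `H ∈ K((τ))[U]` is `τ ^ M * (s + O(τ))` with `s ∈ K[U]`. -/
def HasInit (H : L[X]) (M : ℤ) (s : K[X]) : Prop :=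
  ∃ H₀ : (PowerSeries K)[X], H = C (unif K L ^ M) * H₀.map (algebraMap (PowerSeries K) L) ∧
    H₀.map PowerSeries.constantCoeff = s

theorem unif_ne_zero : unif K L ≠ 0 := by
  simp [unif]

namespace HasInit

variable {H H' : L[X]} {M M' : ℤ} {s s' : K[X]}

theorem mul (h : HasInit H M s) (h' : HasInit H' M' s') : HasInit (H * H') (M + M') (s * s') := by
  obtain ⟨A, rfl, rfl⟩ := h
  obtain ⟨B, rfl, rfl⟩ := h'
  refine ⟨A * B, ?_, by simp⟩
  rw [zpow_add₀ unif_ne_zero]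
  simp only [Polynomial.map_mul, C_mul]
  ring

theorem add (h : HasInit H M s) (h' : HasInit H' M s') : HasInit (H + H') M (s + s') := by
  obtain ⟨A, rfl, rfl⟩ := h
  obtain ⟨B, rfl, rfl⟩ := h'
  exact ⟨A + B, by simp only [Polynomial.map_add]; ring, by simp⟩

theorem zero (M : ℤ) : HasInit (0 : L[X]) M (0 : K[X]) := ⟨0, by simp, by simp⟩

theorem const (a : K) :
    HasInit (C (algebraMap (PowerSeries K) L (PowerSeries.C a))) 0 (C a) :=
  ⟨C (PowerSeries.C a), by simp, by simp⟩

theorem one : HasInit (1 : L[X]) 0 (1 : K[X]) := ⟨1, by simp, by simp⟩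

theorem const_mul (a : K) (h : HasInit H M s) :
    HasInit (C (algebraMap (PowerSeries K) L (PowerSeries.C a)) * H) M (C a * s) := by
  simpa using (const a).mul h

theorem pow (h : HasInit H M s) (n : ℕ) : HasInit (H ^ n) (n * M) (s ^ n) := by
  induction n with
  | zero => simpa using one
  | succ n ih =>
    rw [pow_succ, pow_succ]
    convert ih.mul h using 1
    push_cast; ring

theorem sum {ι : Type*} (S : Finset ι) {H : ι → L[X]} {s : ι → K[X]}
    (h : ∀ i ∈ S, HasInit (H i) M (s i)) : HasInit (∑ i ∈ S, H i) M (∑ i ∈ S, s i) := by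
  classical
  induction S using Finset.induction_on with
  | empty => simpa using zero M
  | insert i S hi ih =>
    rw [Finset.sum_insert hi, Finset.sum_insert hi]
    exact (h i (by simp)).add (ih fun j hj => h j (by simp [hj]))

theorem prod {ι : Type*} (S : Finset ι) {H : ι → L[X]} {s : ι → K[X]} {N : ι → ℤ}
    (h : ∀ i ∈ S, HasInit (H i) (N i) (s i)) :
    HasInit (∏ i ∈ S, H i) (∑ i ∈ S, N i) (∏ i ∈ S, s i) := by
  classical
  induction S using Finset.induction_on with
  | empty => simpa using one
  | insert i S hi ih =>
    rw [Finset.prod_insert hi, Finset.prod_insert hi, Finset.sum_insert hi]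
    exact (h i (by simp)).mul (ih fun j hj => h j (by simp [hj]))

theorem lower (h : HasInit H M s) (hM : M' < M) : HasInit H M' (0 : K[X]) := by
  obtain ⟨A, rfl, rfl⟩ := h
  obtain ⟨n, rfl⟩ : ∃ n : ℕ, M = M' + (n + 1 : ℕ) := ⟨(M - M' - 1).toNat, by omega⟩
  refine ⟨C (PowerSeries.X ^ (n + 1)) * A, ?_, by simp⟩
  rw [zpow_add₀ unif_ne_zero, zpow_natCast]
  simp [unif, mul_assoc]

theorem eq_of_exponent_eq (h : HasInit H M s) (h' : HasInit H M s') : s = s' := by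
  obtain ⟨A, rfl, rfl⟩ := h
  obtain ⟨B, hB, rfl⟩ := h'
  have h0 : C (unif K L ^ M) ≠ 0 := by simpa using zpow_ne_zero M unif_ne_zero
  have := mul_left_cancel₀ h0 hB
  rw [Polynomial.map_injective _ (IsFractionRing.injective (PowerSeries K) L) this]

theorem exponent_eq (h : HasInit H M s) (h' : HasInit H M' s') (hs : s ≠ 0) (hs' : s' ≠ 0) :
    M = M' := by
  rcases lt_trichotomy M M' with hlt | heq | hlt
  · exact absurd (h.eq_of_exponent_eq (h'.lower hlt)) hs
  · exact heq
  · exact absurd (h'.eq_of_exponent_eq (h.lower hlt)) hs'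

theorem eval (h : HasInit H M s) (u : PowerSeries K) :
    ∃ w : PowerSeries K, H.eval (algebraMap _ L u) = unif K L ^ M * algebraMap _ L w ∧
      PowerSeries.constantCoeff w = s.eval (PowerSeries.constantCoeff u) := by
  obtain ⟨A, rfl, rfl⟩ := h
  refine ⟨A.eval u, ?_, ?_⟩
  · simp [Polynomial.eval_map_algebraMap, Polynomial.aeval_algebraMap_apply]
  · rw [Polynomial.eval_map, Polynomial.eval₂_hom]

/-- The substitution `U ↦ c + τ U`. -/
noncomputable def blowup (K L : Type*) [Field K] [Field L] [Algebra (PowerSeries K) L] (c : K) :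
    L[X] := C (algebraMap (PowerSeries K) L (PowerSeries.C c)) + C (unif K L) * X

theorem blowup_eq (c : K) : blowup K L c =
    (C (PowerSeries.C c) + C PowerSeries.X * X : (PowerSeries K)[X]).map
      (algebraMap (PowerSeries K) L) := by
  simp [blowup, unif]

theorem comp_blowup (h : HasInit H M s) (c : K) :
    HasInit (H.comp (blowup K L c)) M (C (s.eval c)) := by
  obtain ⟨A, rfl, rfl⟩ := h
  refine ⟨A.comp (C (PowerSeries.C c) + C PowerSeries.X * X), ?_, ?_⟩
  · rw [mul_comp, C_comp, blowup_eq, Polynomial.map_comp]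
  · rw [Polynomial.map_comp]
    simp

theorem comp_blowup_of_root (h : HasInit H M s) {c : K} (hc : s.eval c = 0) :
    ∃ a, HasInit (H.comp (blowup K L c)) (M + 1) (C (s.derivative.eval c) * X + C a) := by
  obtain ⟨A, rfl, rfl⟩ := h
  have h0 : PowerSeries.constantCoeff (A.eval (PowerSeries.C c)) = 0 := by
    rw [← hc, Polynomial.eval_map, ← Polynomial.eval₂_hom]; simp
  obtain ⟨w, hw⟩ := PowerSeries.X_dvd_iff.mpr h0
  obtain ⟨B, hB⟩ := Polynomial.binomExpansion (A.map C) (C (PowerSeries.C c))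
    (C PowerSeries.X * X : (PowerSeries K)[X])
  have hB' : A.comp (C (PowerSeries.C c) + C PowerSeries.X * X) = C PowerSeries.X *
      (C w + C (A.derivative.eval (PowerSeries.C c)) * X + B * (C PowerSeries.X * X ^ 2)) := by
    rw [Polynomial.comp, Polynomial.eval₂_eq_eval_map, hB, Polynomial.derivative_map,
      Polynomial.eval_map, Polynomial.eval_map, Polynomial.eval₂_at_apply,
      Polynomial.eval₂_at_apply, hw]
    simp only [C_mul]
    ring
  refine ⟨PowerSeries.constantCoeff w,
    C w + C (A.derivative.eval (PowerSeries.C c)) * X + B * (C PowerSeries.X * X ^ 2), ?_, ?_⟩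
  · rw [mul_comp, C_comp, blowup_eq, ← Polynomial.map_comp, hB', Polynomial.map_mul,
      zpow_add_one₀ unif_ne_zero, C_mul, mul_assoc, Polynomial.map_C]
    rfl
  · have : PowerSeries.constantCoeff (A.derivative.eval (PowerSeries.C c)) =
        (A.map PowerSeries.constantCoeff).derivative.eval c := by
      rw [Polynomial.derivative_map, Polynomial.eval_map, ← Polynomial.eval₂_hom]
      simp
    simp [this, add_comm]

end HasInit

end InitialForms

section AdicExpansion

theorem Polynomial.Monic.exists_adic_expansion {R : Type*} [CommRing R] [Nontrivial R] {g : R[X]}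
    (hg : g.Monic) {D : ℕ} (hgD : g.natDegree = D) (hD : 0 < D) (N : ℕ) (h : R[X])
    (hN : h.natDegree < N * D) :
    ∃ c : ℕ → R[X], (∀ i, (c i).natDegree < D) ∧ h = ∑ i ∈ Finset.range N, c i * g ^ i := by
  induction N generalizing h with
  | zero => simp at hN
  | succ N ih =>
    rcases Nat.eq_zero_or_pos N with rfl | hpos
    · refine ⟨fun i => h, fun i => by simpa using hN, by simp⟩
    · have h1 : (h /ₘ g).natDegree < N * D := by
        have : 0 < N * D := Nat.mul_pos hpos hD
        rw [natDegree_divByMonic h hg, hgD]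
        rw [add_mul] at hN
        omega
      obtain ⟨c, hc, hsum⟩ := ih _ h1
      have hg1 : g ≠ 1 := by rintro rfl; simp at hgD; omega
      refine ⟨fun i => Nat.casesOn i (h %ₘ g) c, ?_, ?_⟩
      · rintro (_ | i)
        · exact hgD ▸ natDegree_modByMonic_lt h hg hg1
        · exact hc i
      · rw [Finset.sum_range_succ']
        conv_lhs => rw [← modByMonic_add_div h g, hsum]
        simp only [pow_zero, mul_one, pow_succ, Finset.mul_sum]
        rw [add_comm]
        congr 1
        exact Finset.sum_congr rfl fun i _ => by ring

theorem Polynomial.coeff_sum_linear_pow {K : Type*} [Field K] (N k : ℕ) (β : ℕ → K) (a b : K) :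
    (∑ i ∈ Finset.range N, C (β i) * (C b * (X + C a)) ^ i).coeff k =
      ∑ i ∈ Finset.range N, β i * b ^ i * (a ^ (i - k) * (i.choose k)) := by
  rw [finsetSum_coeff]
  refine Finset.sum_congr rfl fun i _ => ?_
  rw [mul_pow, ← C_pow, ← mul_assoc, ← C_mul, coeff_C_mul, coeff_X_add_C_pow]

theorem Polynomial.sum_linear_pow_ne_zero {K : Type*} [Field K] {N : ℕ} {β : ℕ → K} {a b : K}
    (hb : b ≠ 0) (hβ : ∃ i < N, β i ≠ 0) :
    ∑ i ∈ Finset.range N, C (β i) * (C b * (X + C a)) ^ i ≠ 0 := by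
  intro h0
  have hs : (C b * (X + C a)).natDegree = 1 := by
    rw [natDegree_C_mul hb, natDegree_X_add_C]
  have h1 : (∑ i ∈ Finset.range N, C (β i) * X ^ i).comp (C b * (X + C a)) = 0 := by
    rw [← h0, Polynomial.sum_comp]
    simp
  rcases comp_eq_zero_iff.mp h1 with h2 | ⟨_, h2⟩
  · obtain ⟨i, hi, hβi⟩ := hβ
    apply hβi
    have := congrArg (fun p => p.coeff i) h2
    simpa [finsetSum_coeff, coeff_X_pow, hi] using this
  · rw [h2, natDegree_C] at hs
    omega

variable {K L : Type*} [Field K] [Field L] [Algebra (PowerSeries K) L]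
  [IsFractionRing (PowerSeries K) L] {Λ : K[X][X] →+* L[X]} {D : ℕ}

theorem exists_common_exponent
    (hconst : ∀ h : K[X][X], h ≠ 0 → h.natDegree < D → ∃ (s : ℤ) (β : K), β ≠ 0 ∧
      HasInit (Λ h) s (C β))
    (M : ℤ) {N : ℕ} {c : ℕ → K[X][X]} (hc : ∀ i, (c i).natDegree < D) (hne : ∃ i < N, c i ≠ 0) :
    ∃ (M₀ : ℤ) (β : ℕ → K), (∃ i < N, β i ≠ 0) ∧
      ∀ i < N, HasInit (Λ (c i)) (M₀ - i * M) (C (β i)) := by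
  classical
  have h1 : ∀ i, ∃ (s : ℤ) (β : K), (c i ≠ 0 → β ≠ 0) ∧ (c i ≠ 0 → HasInit (Λ (c i)) s (C β)) := by
    intro i
    by_cases hi : c i = 0
    · exact ⟨0, 0, by simp [hi]⟩
    · obtain ⟨s, β, hβ, h⟩ := hconst _ hi (hc i)
      exact ⟨s, β, fun _ => hβ, fun _ => h⟩
  choose s b hb hinit using h1
  obtain ⟨i₀, hi₀, hmin⟩ := Finset.exists_min_image ((Finset.range N).filter fun i => c i ≠ 0)
    (fun i => s i + i * M) (by
      obtain ⟨i, hi, hci⟩ := hne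
      exact ⟨i, by simp [hi, hci]⟩)
  simp only [Finset.mem_filter, Finset.mem_range] at hi₀ hmin
  refine ⟨s i₀ + i₀ * M, fun i => if c i ≠ 0 ∧ s i + i * M = s i₀ + i₀ * M then b i else 0,
    ⟨i₀, hi₀.1, by simp [hi₀.2, hb i₀ hi₀.2]⟩, fun i hi => ?_⟩
  by_cases hci : c i = 0
  · simpa [hci] using HasInit.zero _
  · have hle := hmin i ⟨hi, hci⟩
    rcases hle.eq_or_lt with heq | hlt
    · beta_reduce
      rw [if_pos ⟨hci, heq.symm⟩, show s i₀ + i₀ * M - i * M = s i by linarith]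
      exact hinit i hci
    · beta_reduce
      rw [if_neg (fun h => hlt.ne' h.2), C_0]
      exact (hinit i hci).lower (by linarith)

theorem hasInit_adic_sum {g : K[X][X]} {M M₀ : ℤ} {s : K[X]} {N : ℕ} {c : ℕ → K[X][X]}
    {β : ℕ → K} (hg : HasInit (Λ g) M s)
    (hβ : ∀ i < N, HasInit (Λ (c i)) (M₀ - i * M) (C (β i))) :
    HasInit (Λ (∑ i ∈ Finset.range N, c i * g ^ i)) M₀
      (∑ i ∈ Finset.range N, C (β i) * s ^ i) := by
  rw [map_sum]
  refine HasInit.sum _ fun i hi => ?_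
  rw [map_mul, map_pow]
  simpa using (hβ i (Finset.mem_range.mp hi)).mul (hg.pow i)

theorem exists_monic_expansion (hD : 0 < D)
    (hconst : ∀ h : K[X][X], h ≠ 0 → h.natDegree < D → ∃ (s : ℤ) (β : K), β ≠ 0 ∧
      HasInit (Λ h) s (C β))
    {g f : K[X][X]} {M N : ℤ} {a b : K} {F : K[X]} {e : ℕ} (hb : b ≠ 0) (hg : g.Monic)
    (hgD : g.natDegree = D) (hginit : HasInit (Λ g) M (C b * (X + C a))) (hf : f.Monic)
    (hfD : f.natDegree = e * D) (hfinit : HasInit (Λ f) N F) (hF : F.coeff e ≠ 0) :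
    ∃ (c : ℕ → K[X][X]) (β : ℕ → K), (∀ i, (c i).natDegree < D) ∧
      (∀ i ≤ e, HasInit (Λ (c i)) ((e - i) * M) (C (β i))) ∧
      F = ∑ i ∈ Finset.range (e + 1), C (β i) * (C b * (X + C a)) ^ i ∧ β e = 1 := by
  have hF0 : F ≠ 0 := by rintro rfl; simp at hF
  obtain ⟨c, hc, hfc, hce⟩ : ∃ c : ℕ → K[X][X], (∀ i, (c i).natDegree < D) ∧
      f = ∑ i ∈ Finset.range (e + 1), c i * g ^ i ∧ c e = 1 := by
    have hgm : (g ^ e).Monic := hg.pow e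
    have hgn : (g ^ e).natDegree = e * D := by rw [hg.natDegree_pow, hgD]
    rcases Nat.eq_zero_or_pos e with rfl | hpos
    · refine ⟨fun _ => 1, by simpa using hD, ?_, rfl⟩
      simpa using hf.natDegree_eq_zero.mp (by simpa using hfD)
    have hlt : (f - g ^ e).natDegree < e * D := by
      rcases eq_or_ne (f - g ^ e) 0 with h0 | h0
      · rw [h0]; simpa using ⟨hpos, hD⟩
      · rw [← hfD]
        refine natDegree_lt_natDegree h0 (degree_sub_lt_left ?_ hf.ne_zero ?_)
        · rw [degree_eq_natDegree hf.ne_zero, degree_eq_natDegree hgm.ne_zero, hfD, hgn]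
        · rw [hf.leadingCoeff, hgm.leadingCoeff]
    obtain ⟨c, hc, hsum⟩ := hg.exists_adic_expansion hgD hD e _ hlt
    refine ⟨Function.update c e 1, fun i => ?_, ?_, by simp⟩
    · by_cases hi : i = e
      · subst hi; simpa using hD
      · simpa [Function.update_of_ne hi] using hc i
    · rw [Finset.sum_range_succ, Function.update_self, one_mul]
      refine (sub_eq_iff_eq_add.mp hsum).trans (congrArg (· + g ^ e) ?_)
      refine Finset.sum_congr rfl fun i hi => ?_
      rw [Function.update_of_ne (Finset.mem_range.mp hi).ne]
  obtain ⟨M₀, β, hne, hβ⟩ := exists_common_exponent hconst M hc (N := e + 1)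
    ⟨e, by simp, by simp [hce]⟩
  have hsum := hasInit_adic_sum hginit hβ
  rw [← hfc] at hsum
  have hne0 := Polynomial.sum_linear_pow_ne_zero (a := a) hb hne
  obtain rfl := hsum.exponent_eq hfinit hne0 hF0
  have hFeq := hfinit.eq_of_exponent_eq hsum
  have hβe : β e ≠ 0 := by
    intro h
    apply hF
    rw [hFeq, coeff_sum_linear_pow]
    refine Finset.sum_eq_zero fun i hi => ?_
    rcases (Nat.lt_succ_iff.mp (Finset.mem_range.mp hi)).eq_or_lt with rfl | hlt
    · simp [h]
    · simp [Nat.choose_eq_zero_of_lt hlt]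
  have h1 := hβ e (by simp)
  rw [hce, map_one] at h1
  have h2 := h1.exponent_eq HasInit.one (by simpa using hβe) one_ne_zero
  obtain rfl : M₀ = e * M := by linarith
  refine ⟨c, β, hc, fun i hi => ?_, hFeq, ?_⟩
  · rw [sub_mul]
    exact hβ i (by omega)
  · rw [h2] at h1
    exact C_injective ((h1.eq_of_exponent_eq HasInit.one).trans C_1.symm)

end AdicExpansion

section KeyPolynomials

theorem Polynomial.X_pow_sub_C_pow_eq_expand {K : Type*} [Field K] (l n : ℕ) (w : K) :
    (X ^ l - C w : K[X]) ^ n = expand K l ((X + C (-w)) ^ n) := by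
  simp [sub_eq_add_neg]

theorem Polynomial.coeff_X_pow_sub_C_pow_top {K : Type*} [Field K] {l : ℕ} (hl : 0 < l) (n : ℕ)
    (w : K) : ((X ^ l - C w : K[X]) ^ n).coeff (l * n) = 1 := by
  rw [X_pow_sub_C_pow_eq_expand, coeff_expand_mul' hl, coeff_X_add_C_pow]
  simp

theorem Polynomial.coeff_X_pow_sub_C_pow_next {K : Type*} [Field K] {l : ℕ} (hl : 0 < l) (n : ℕ)
    (w : K) : ((X ^ l - C w : K[X]) ^ (n + 1)).coeff (l * n) = -(w * (n + 1)) := by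
  rw [X_pow_sub_C_pow_eq_expand, coeff_expand_mul' hl, coeff_X_add_C_pow]
  simp

theorem Polynomial.coeff_X_pow_sub_C_pow_of_not_dvd {K : Type*} [Field K] {l k : ℕ} (hl : 0 < l)
    (n : ℕ) (w : K) (hk : ¬ l ∣ k) : ((X ^ l - C w : K[X]) ^ n).coeff k = 0 := by
  rw [X_pow_sub_C_pow_eq_expand, coeff_expand hl, if_neg hk]

theorem Polynomial.Monic.add_of_natDegree_lt {R : Type*} [CommRing R] {p q : R[X]}
    (hp : p.Monic) (hq : q.natDegree < p.natDegree) :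
    (p + q).Monic ∧ (p + q).natDegree = p.natDegree :=
  ⟨hp.add_of_left (degree_lt_degree hq), natDegree_add_eq_left_of_natDegree_lt hq⟩

variable {K L : Type*} [Field K] [Field L] [Algebra (PowerSeries K) L]
  [IsFractionRing (PowerSeries K) L] {Λ : K[X][X] →+* L[X]} {D : ℕ}

theorem exists_centered (hD : 0 < D)
    (hΛ : ∀ a : K, Λ (C (C a)) = C (algebraMap (PowerSeries K) L (PowerSeries.C a)))
    (hconst : ∀ h : K[X][X], h ≠ 0 → h.natDegree < D → ∃ (s : ℤ) (β : K), β ≠ 0 ∧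
      HasInit (Λ h) s (C β))
    {g f : K[X][X]} {M N : ℤ} {a b δ : K} {F : K[X]} {e : ℕ} (hb : b ≠ 0) (hg : g.Monic)
    (hgD : g.natDegree = D) (hginit : HasInit (Λ g) M (C b * (X + C a))) (hf : f.Monic)
    (hfD : f.natDegree = (e + 1) * D) (hfinit : HasInit (Λ f) N F) (hF : F.coeff (e + 1) ≠ 0)
    (heK : ((e + 1 : ℕ) : K) ≠ 0) (hδ : F.coeff e = -((e + 1 : ℕ) * δ * F.coeff (e + 1))) :
    ∃ g₁ : K[X][X], g₁.Monic ∧ g₁.natDegree = D ∧ HasInit (Λ g₁) M (C b * (X + C (-δ))) := by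
  obtain ⟨c, β, hc, hβ, hFeq, hβe⟩ := exists_monic_expansion hD hconst hb hg hgD hginit hf hfD
    hfinit hF
  have h1 : F.coeff (e + 1) = b ^ (e + 1) := by
    rw [hFeq, coeff_sum_linear_pow, Finset.sum_range_succ, Finset.sum_eq_zero]
    · simp [hβe]
    · intro i hi
      simp [Nat.choose_eq_zero_of_lt (Finset.mem_range.mp hi)]
  have h2 : F.coeff e = β e * b ^ e + b ^ (e + 1) * (a * (e + 1 : ℕ)) := by
    rw [hFeq, coeff_sum_linear_pow, Finset.sum_range_succ, Finset.sum_range_succ,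
      Finset.sum_eq_zero]
    · simp [hβe]
    · intro i hi
      simp [Nat.choose_eq_zero_of_lt (Finset.mem_range.mp hi)]
  have hβ' : β e = -((e + 1 : ℕ) * b * (δ + a)) := by
    have hbe : b ^ e ≠ 0 := pow_ne_zero _ hb
    apply mul_right_cancel₀ hbe
    rw [h1, h2] at hδ
    linear_combination hδ
  have hdeg : (C (C ((e + 1 : ℕ) : K)⁻¹) * c e).natDegree < g.natDegree :=
    hgD ▸ (natDegree_C_mul_le _ _).trans_lt (hc e)
  obtain ⟨hm, hn⟩ := hg.add_of_natDegree_lt hdeg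
  refine ⟨g + C (C ((e + 1 : ℕ) : K)⁻¹) * c e, hm, hn.trans hgD, ?_⟩
  rw [map_add, map_mul, hΛ]
  have h3 := hβ e (by omega)
  rw [show (((e + 1 : ℕ) : ℤ) - (e : ℤ)) * M = M by push_cast; ring] at h3
  convert hginit.add (h3.const_mul ((e + 1 : ℕ) : K)⁻¹) using 1
  have h4 : ((e + 1 : ℕ) : K)⁻¹ * β e = b * (-δ - a) := by
    rw [hβ']; field_simp; ring
  rw [← C_mul, h4]
  simp only [C_mul, C_sub, C_neg]
  ring

theorem exists_next_key (hD : 0 < D)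
    (hΛ : ∀ a : K, Λ (C (C a)) = C (algebraMap (PowerSeries K) L (PowerSeries.C a)))
    (hconst : ∀ h : K[X][X], h ≠ 0 → h.natDegree < D → ∃ (s : ℤ) (β : K), β ≠ 0 ∧
      HasInit (Λ h) s (C β))
    {g f : K[X][X]} {M N : ℤ} {b w C₀ : K} {l e' : ℕ} (hb : b ≠ 0) (hg : g.Monic)
    (hgD : g.natDegree = D) (hginit : HasInit (Λ g) M (C b * (X + C 0))) (hf : f.Monic)
    (hl : 0 < l) (hfD : f.natDegree = (l * (e' + 1)) * D)
    (hfinit : HasInit (Λ f) N (C C₀ * (X ^ l - C w) ^ (e' + 1))) (hC₀ : C₀ ≠ 0)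
    (heK : ((e' + 1 : ℕ) : K) ≠ 0) :
    ∃ g₁ : K[X][X], g₁.Monic ∧ g₁.natDegree = l * D ∧
      HasInit (Λ g₁) (l * M) (C (b ^ l) * (X ^ l - C w)) := by
  have hF1 : (C C₀ * (X ^ l - C w) ^ (e' + 1)).coeff (l * (e' + 1)) = C₀ := by
    rw [coeff_C_mul, coeff_X_pow_sub_C_pow_top hl, mul_one]
  have hF2 : (C C₀ * (X ^ l - C w) ^ (e' + 1)).coeff (l * e') = C₀ * -(w * (e' + 1)) := by
    rw [coeff_C_mul, coeff_X_pow_sub_C_pow_next hl]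
  obtain ⟨c, β, hc, hβ, hFeq, hβe⟩ := exists_monic_expansion hD hconst hb hg hgD hginit hf hfD
    hfinit (by rwa [hF1])
  have hcoeff : ∀ k ≤ l * (e' + 1), (C C₀ * (X ^ l - C w) ^ (e' + 1)).coeff k = β k * b ^ k := by
    intro k hk
    rw [hFeq, coeff_sum_linear_pow, Finset.sum_eq_single k]
    · simp
    · intro i _ hi
      rcases lt_or_gt_of_ne hi with h | h
      · simp [Nat.choose_eq_zero_of_lt h]
      · simp [Nat.sub_ne_zero_of_lt h]
    · intro h
      simp only [Finset.mem_range] at h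
      omega
  have hle : l * e' ≤ l * (e' + 1) := Nat.mul_le_mul_left _ (Nat.le_succ _)
  have h1 : C₀ = b ^ (l * (e' + 1)) := by
    rw [← hF1, hcoeff _ le_rfl, hβe, one_mul]
  have hβ' : β (l * e') = -((e' + 1 : ℕ) * (b ^ l * w)) := by
    apply mul_right_cancel₀ (pow_ne_zero (l * e') hb)
    rw [← hcoeff _ hle, hF2, h1]
    push_cast
    ring
  have hgl : (g ^ l).natDegree = l * D := by rw [hg.natDegree_pow, hgD]
  have hdeg : (C (C ((e' + 1 : ℕ) : K)⁻¹) * c (l * e')).natDegree < (g ^ l).natDegree := by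
    rw [hgl]
    exact (natDegree_C_mul_le _ _).trans_lt ((hc _).trans_le (Nat.le_mul_of_pos_left D hl))
  obtain ⟨hm, hn⟩ := (hg.pow l).add_of_natDegree_lt hdeg
  refine ⟨g ^ l + C (C ((e' + 1 : ℕ) : K)⁻¹) * c (l * e'), hm, hn.trans hgl, ?_⟩
  rw [map_add, map_mul, hΛ, map_pow]
  have h3 := hβ (l * e') hle
  rw [show (((l * (e' + 1) : ℕ) : ℤ) - ((l * e' : ℕ) : ℤ)) * M = l * M by push_cast; ring] at h3
  convert (hginit.pow l).add (h3.const_mul ((e' + 1 : ℕ) : K)⁻¹) using 1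
  have h4 : ((e' + 1 : ℕ) : K)⁻¹ * β (l * e') = -(b ^ l * w) := by
    rw [hβ']; field_simp
  rw [← C_mul, h4]
  simp only [C_mul, C_neg, C_0, add_zero, mul_pow, C_pow]
  ring

theorem exists_monomial_init (hD : 0 < D) {e l : ℕ} {Pr : ℤ → Prop}
    (hconst : ∀ h : K[X][X], h ≠ 0 → h.natDegree < D → ∃ (s : ℤ) (β : K), β ≠ 0 ∧
      HasInit (Λ h) s (C β) ∧ (e : ℤ) ∣ s ∧ Pr s)
    {g : K[X][X]} {M : ℤ} {b : K} (hb : b ≠ 0) (hg : g.Monic)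
    (hgD : g.natDegree = D) (hginit : HasInit (Λ g) M (C b * (X + C 0)))
    (hM : ∀ i : ℤ, (e : ℤ) ∣ i * M → (l : ℤ) ∣ i) {h : K[X][X]} (hh : h ≠ 0)
    (hhD : h.natDegree < l * D) :
    ∃ (i : ℕ) (s : ℤ) (β : K), i < l ∧ β ≠ 0 ∧ HasInit (Λ h) (s + i * M) (C β * X ^ i) ∧
      (e : ℤ) ∣ s ∧ Pr s := by
  obtain ⟨c, hc, hsum⟩ := hg.exists_adic_expansion hgD hD l h hhD
  have hne : ∃ i < l, c i ≠ 0 := by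
    by_contra! H
    apply hh
    rw [hsum]
    exact Finset.sum_eq_zero fun i hi => by rw [H i (Finset.mem_range.mp hi), zero_mul]
  obtain ⟨M₀, β, ⟨i, hi, hβi⟩, hβ⟩ := exists_common_exponent (Λ := Λ)
    (fun h h0 h1 => by obtain ⟨s, β, h2, h3, -⟩ := hconst h h0 h1; exact ⟨s, β, h2, h3⟩)
    M hc hne
  have key : ∀ j < l, β j ≠ 0 → (e : ℤ) ∣ M₀ - j * M ∧ Pr (M₀ - j * M) := by
    intro j hj hβj
    have hcj : c j ≠ 0 := by
      intro h0
      have h1 := hβ j hj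
      rw [h0, map_zero] at h1
      exact hβj (C_eq_zero.mp (h1.eq_of_exponent_eq (HasInit.zero _)))
    obtain ⟨s, γ, hγ, h1, h2, h3⟩ := hconst _ hcj (hc j)
    have := h1.exponent_eq (hβ j hj) (by simpa using hγ) (by simpa using hβj)
    subst this
    exact ⟨h2, h3⟩
  have huniq : ∀ j < l, j ≠ i → β j = 0 := by
    intro j hj hji
    by_contra hβj
    have h1 := dvd_sub (key j hj hβj).1 (key i hi hβi).1
    have h3 : ((i : ℤ) - j) * M = M₀ - j * M - (M₀ - i * M) := by ring
    have h2 := hM (i - j) (h3 ▸ h1)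
    apply hji
    have h4 := Int.eq_zero_of_abs_lt_dvd h2 (by rw [abs_lt]; omega)
    omega
  refine ⟨i, M₀ - i * M, β i * b ^ i, hi, mul_ne_zero hβi (pow_ne_zero _ hb), ?_, key i hi hβi⟩
  have h1 := hasInit_adic_sum hginit hβ
  rw [← hsum, Finset.sum_eq_single i] at h1
  · rw [sub_add_cancel]
    convert h1 using 1
    simp [mul_pow, mul_assoc]
  · intro j hj hji
    rw [huniq j (Finset.mem_range.mp hj) hji, C_0, zero_mul]
  · intro h; simp at h; omega

theorem HasInit.step (hD : 0 < D) {e l e' : ℕ} {Pr : ℤ → Prop}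
    (hΛ : ∀ a : K, Λ (C (C a)) = C (algebraMap (PowerSeries K) L (PowerSeries.C a)))
    (hconst : ∀ h : K[X][X], h ≠ 0 → h.natDegree < D → ∃ (s : ℤ) (β : K), β ≠ 0 ∧
      HasInit (Λ h) s (C β) ∧ (e : ℤ) ∣ s ∧ Pr s)
    {g f : K[X][X]} {M N : ℤ} {a b c C₀ : K} (hb : b ≠ 0) (hg : g.Monic)
    (hgD : g.natDegree = D) (hginit : HasInit (Λ g) M (C b * (X + C a)))
    (hf : f.Monic) (hfD : f.natDegree = e * D) (he : e = l * e') (heK : (e : K) ≠ 0)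
    (hfinit : HasInit (Λ f) N (C C₀ * (X ^ l - C (c ^ l)) ^ e')) (hC₀ : C₀ ≠ 0)
    (hl : l = 1 ∨ (c ≠ 0 ∧ (e' : ℤ) ∣ M ∧ ∀ i : ℤ, (e : ℤ) ∣ i * M → (l : ℤ) ∣ i))
    (hPr : ∀ (s : ℤ) (i : ℕ), i < l → (e : ℤ) ∣ s → Pr s → Pr (s + i * M)) :
    (∃ (g' : K[X][X]) (a' b' : K), b' ≠ 0 ∧ g'.Monic ∧ g'.natDegree = l * D ∧
      HasInit ((Λ g').comp (HasInit.blowup K L c)) (l * M + 1) (C b' * (X + C a'))) ∧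
    ∀ h : K[X][X], h ≠ 0 → h.natDegree < l * D → ∃ (s : ℤ) (β : K), β ≠ 0 ∧
      HasInit ((Λ h).comp (HasInit.blowup K L c)) s (C β) ∧ (e' : ℤ) ∣ s ∧ Pr s := by
  have hconst' : ∀ h : K[X][X], h ≠ 0 → h.natDegree < D → ∃ (s : ℤ) (β : K), β ≠ 0 ∧
      HasInit (Λ h) s (C β) :=
    fun h h0 h1 => by obtain ⟨s, β, h2, h3, -⟩ := hconst h h0 h1; exact ⟨s, β, h2, h3⟩
  have he0 : e ≠ 0 := by rintro rfl; simp at heK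
  have hl0 : 0 < l := Nat.pos_of_ne_zero (by rintro rfl; simp at he; omega)
  obtain ⟨e'', rfl⟩ : ∃ e'', e' = e'' + 1 :=
    Nat.exists_eq_succ_of_ne_zero (by rintro rfl; simp at he; omega)
  have hlK : (l : K) ≠ 0 := by
    rintro h; apply heK; rw [he]; push_cast; rw [h, zero_mul]
  have heK' : ((e'' + 1 : ℕ) : K) ≠ 0 := by
    rintro h; apply heK; rw [he, Nat.cast_mul, h, mul_zero]
  have hlin : ∀ {g' : K[X][X]} {M' : ℤ} {b' : K}, b' ≠ 0 → (l = 1 ∨ c ≠ 0) →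
      HasInit (Λ g') M' (C b' * (X ^ l - C (c ^ l))) → ∃ a' b'' : K, b'' ≠ 0 ∧
        HasInit ((Λ g').comp (HasInit.blowup K L c)) (M' + 1) (C b'' * (X + C a')) := by
    intro g' M' b' hb' hlc hinit
    obtain ⟨r, hr⟩ := hinit.comp_blowup_of_root (c := c) (by simp)
    have hne : (C b' * (X ^ l - C (c ^ l))).derivative.eval c ≠ 0 := by
      have : (C b' * (X ^ l - C (c ^ l))).derivative.eval c = b' * (l * c ^ (l - 1)) := by
        generalize c ^ l = w
        simp [derivative_X_pow]
      rw [this]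
      refine mul_ne_zero hb' (mul_ne_zero hlK ?_)
      rcases hlc with rfl | hc
      · simp
      · exact pow_ne_zero _ hc
    refine ⟨r / (C b' * (X ^ l - C (c ^ l))).derivative.eval c, _, hne, ?_⟩
    rw [mul_add, ← C_mul, mul_div_cancel₀ _ hne]
    exact hr
  obtain ⟨e₀, he₀⟩ : ∃ e₀, e = e₀ + 1 := Nat.exists_eq_succ_of_ne_zero he0
  have hFtop : (C C₀ * (X ^ l - C (c ^ l)) ^ (e'' + 1)).coeff (e₀ + 1) = C₀ := by
    rw [← he₀, he, coeff_C_mul, coeff_X_pow_sub_C_pow_top hl0, mul_one]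
  have hcent := fun δ => exists_centered (δ := δ) hD hΛ hconst' hb hg hgD hginit hf
    (he₀ ▸ hfD) hfinit (by rwa [hFtop]) (he₀ ▸ heK)
  by_cases hl1 : l = 1
  · subst hl1
    obtain rfl : e₀ = e'' := by omega
    obtain ⟨g₁, hg₁, hg₁D, hg₁init⟩ := hcent c (by
      rw [hFtop, coeff_C_mul]
      have := coeff_X_pow_sub_C_pow_next one_pos e₀ (c ^ 1)
      rw [one_mul] at this
      rw [this]
      push_cast; ring)
    constructor
    · obtain ⟨a', b'', hb'', hinit⟩ := hlin hb (Or.inl rfl) (by simpa [sub_eq_add_neg] using hg₁init)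
      exact ⟨g₁, a', b'', hb'', hg₁, by simpa using hg₁D, by simpa using hinit⟩
    · intro h hh hhD
      obtain ⟨s, β, hβ, h1, h2, h3⟩ := hconst h hh (by simpa using hhD)
      refine ⟨s, β, hβ, by simpa using h1.comp_blowup c, ?_, h3⟩
      rwa [he₀] at h2
  · obtain ⟨hc, hM', hM⟩ := hl.resolve_left hl1
    obtain ⟨g₁, hg₁, hg₁D, hg₁init⟩ := hcent 0 (by
      rw [mul_zero, zero_mul, neg_zero, coeff_C_mul, coeff_X_pow_sub_C_pow_of_not_dvd hl0, mul_zero]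
      intro hdvd
      have h1 : l ∣ e₀ + 1 := he₀ ▸ he ▸ Dvd.intro _ rfl
      exact hl1 (Nat.dvd_one.mp ((Nat.dvd_add_right hdvd).mp h1)))
    rw [neg_zero] at hg₁init
    constructor
    · obtain ⟨g', hg', hg'D, hinit⟩ := exists_next_key hD hΛ hconst' hb hg₁ hg₁D hg₁init hf hl0
        (he ▸ hfD) hfinit hC₀ heK'
      obtain ⟨a', b'', hb'', hinit'⟩ := hlin (pow_ne_zero l hb) (Or.inr hc) hinit
      exact ⟨g', a', b'', hb'', hg', hg'D, hinit'⟩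
    · intro h hh hhD
      obtain ⟨i, s, β, hi, hβ, h1, h2, h3⟩ := exists_monomial_init hD hconst hb hg₁ hg₁D hg₁init
        hM hh hhD
      refine ⟨s + i * M, β * c ^ i, mul_ne_zero hβ (pow_ne_zero _ hc),
        by simpa using h1.comp_blowup c, ?_, hPr s i hi h2 h3⟩
      refine dvd_add (dvd_trans ?_ h2) (hM'.mul_left _)
      rw [he]; push_cast
      exact Dvd.intro_left _ rfl

end KeyPolynomials

section GenericTruncation

theorem IsPrimitiveRoot.prod_nthRootsFinset {R A : Type*} [CommRing R] [IsDomain R] [CommMonoid A]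
    {n : ℕ} (hn : 0 < n) {ζ : R} (hζ : IsPrimitiveRoot ζ n) (F : R → A) :
    ∏ ε ∈ nthRootsFinset n (1 : R), F ε = ∏ i ∈ Finset.range n, F (ζ ^ i) := by
  symm
  refine Finset.prod_bij (fun i _ => ζ ^ i) ?_ ?_ ?_ (fun _ _ => rfl)
  · intro i _
    rw [Polynomial.mem_nthRootsFinset hn, ← pow_mul, mul_comm, pow_mul, hζ.pow_eq_one, one_pow]
  · intro i hi j hj h
    exact hζ.pow_inj (by simpa using hi) (by simpa using hj) h
  · intro ε hε
    have : NeZero n := ⟨hn.ne'⟩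
    obtain ⟨i, hi, rfl⟩ := hζ.eq_pow_of_pow_eq_one ((Polynomial.mem_nthRootsFinset hn _).1 hε)
    exact ⟨i, by simpa using hi, rfl⟩

theorem Finset.prod_range_mul_of_periodic {A : Type*} [CommMonoid A] (F : ℕ → A) {l : ℕ}
    (hF : ∀ i, F (i + l) = F i) (n : ℕ) :
    ∏ i ∈ Finset.range (l * n), F i = (∏ i ∈ Finset.range l, F i) ^ n := by
  have hper : ∀ n i, F (l * n + i) = F i := by
    intro n
    induction n with
    | zero => simp
    | succ n ih =>
      intro i
      rw [← ih i, ← hF (l * n + i)]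
      congr 1; ring
  induction n with
  | zero => simp
  | succ n ih => simp [Nat.mul_succ, Finset.prod_range_add, ih, hper, pow_succ]

theorem Polynomial.prod_X_sub_C_mul_zpow {K : Type*} [Field K] [IsAlgClosed K] {e : ℕ}
    (heK : (e : K) ≠ 0) (c : K) (k : ℤ) :
    ∏ ε ∈ nthRootsFinset e (1 : K), (X - C (c * ε ^ k)) =
      (X ^ (e / Int.gcd e k) - C (c ^ (e / Int.gcd e k))) ^ (Int.gcd e k) := by
  have he : 0 < e := Nat.pos_of_ne_zero (by rintro rfl; simp at heK)
  have : NeZero (e : K) := ⟨heK⟩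
  obtain ⟨ζ, hζ⟩ := HasEnoughRootsOfUnity.exists_primitiveRoot K e
  have hg : 0 < Int.gcd e k := Int.gcd_pos_of_ne_zero_left _ (by exact_mod_cast he.ne')
  have hge : Int.gcd e k ∣ e := by exact_mod_cast Int.gcd_dvd_left (e : ℤ) k
  have hl : 0 < e / Int.gcd e k := Nat.div_pos (Nat.le_of_dvd he hge) hg
  have hξ : IsPrimitiveRoot (ζ ^ k) (e / Int.gcd e k) := by
    have h1 : ζ ^ (Int.gcd e k : ℤ) = (ζ ^ k) ^ (Int.gcdB e k) := by
      rw [Int.gcd_eq_gcd_ab, zpow_add₀ (hζ.ne_zero he.ne'), zpow_mul, zpow_mul, zpow_natCast,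
        hζ.pow_eq_one, one_zpow, one_mul]
    have h2 : IsPrimitiveRoot (ζ ^ Int.gcd e k) (e / Int.gcd e k) :=
      hζ.pow he (Nat.div_mul_cancel hge |>.symm.trans (mul_comm _ _))
    rw [zpow_natCast] at h1
    refine IsPrimitiveRoot.of_map_of_injective (f := MonoidHom.id K) ?_ (fun _ _ h => h)
    have h3 : (ζ ^ k) ^ (e / Int.gcd e k) = 1 := by
      obtain ⟨j, hj⟩ := Int.gcd_dvd_right (e : ℤ) k
      have h4 : ζ ^ k = (ζ ^ Int.gcd e k) ^ j := by
        rw [← zpow_natCast, ← zpow_mul, ← hj]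
      rw [h4, ← zpow_natCast, ← zpow_mul, mul_comm, zpow_mul, zpow_natCast, h2.pow_eq_one,
        one_zpow]
    refine ⟨h3, fun l hl => ?_⟩
    refine h2.dvd_of_pow_eq_one l ?_
    simp only [MonoidHom.id_apply] at hl
    rw [h1, ← zpow_natCast, ← zpow_mul, mul_comm, zpow_mul, zpow_natCast, hl, one_zpow]
  rw [hζ.prod_nthRootsFinset he]
  have h1 : ∀ i : ℕ, (ζ ^ i) ^ k = (ζ ^ k) ^ i := fun i => by
    rw [← zpow_natCast, ← zpow_natCast, ← zpow_mul, ← zpow_mul, mul_comm]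
  simp only [h1]
  conv_lhs => rw [← Nat.div_mul_cancel hge]
  rw [Finset.prod_range_mul_of_periodic (l := e / Int.gcd e k)
    (fun i => (X - C (c * (ζ ^ k) ^ i)))]
  · congr 1
    rw [← hξ.prod_nthRootsFinset hl (fun x => X - C (c * x))]
    have := (hξ.map_of_injective (C_injective (R := K))).pow_sub_pow_eq_prod_sub_mul X (C c) hl
    rw [C_pow, this, hξ.prod_nthRootsFinset hl,
      (hξ.map_of_injective (C_injective (R := K))).prod_nthRootsFinset hl]
    refine Finset.prod_congr rfl fun i _ => ?_
    simp [mul_comm]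
  · intro i
    rw [pow_add, hξ.pow_eq_one, mul_one]

variable {K L : Type*} [Field K] [Field L] [Algebra (PowerSeries K) L]
  [IsFractionRing (PowerSeries K) L]

/-- The generic truncation of `τ ^ (-n) * q₀` at order `r`, the tail being replaced by a variable. -/
noncomputable def truncGeneric (L : Type*) [Field L] [Algebra (PowerSeries K) L] (n : ℕ)
    (q₀ : PowerSeries K) (r : ℕ) : L[X] :=
  C (unif K L ^ (-n : ℤ)) *
    (C (PowerSeries.trunc r q₀ : PowerSeries K) + C (PowerSeries.X ^ r) * X :
      (PowerSeries K)[X]).map (algebraMap (PowerSeries K) L)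

/-- The conjugate of `τ ^ (-n) * q₀` under `τ ↦ ε τ`. -/
noncomputable def conjSeries (L : Type*) [Field L] [Algebra (PowerSeries K) L] (n : ℕ)
    (q₀ : PowerSeries K) (ε : K) : L :=
  unif K L ^ (-n : ℤ) *
    algebraMap (PowerSeries K) L (PowerSeries.C (ε ^ (-n : ℤ)) * PowerSeries.rescale ε q₀)

theorem truncGeneric_succ (n : ℕ) (q₀ : PowerSeries K) (r : ℕ) :
    truncGeneric L n q₀ (r + 1) =
      (truncGeneric L n q₀ r).comp (HasInit.blowup K L (PowerSeries.coeff r q₀)) := by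
  rw [truncGeneric, truncGeneric, mul_comp, C_comp, HasInit.blowup_eq, ← Polynomial.map_comp]
  congr 2
  rw [PowerSeries.trunc_succ]
  simp only [Polynomial.coe_add, Polynomial.coe_monomial, add_comp,
    C_comp, mul_comp, X_comp, C_add, pow_succ, C_mul]
  have : (PowerSeries.monomial r (PowerSeries.coeff r q₀) : PowerSeries K) =
      PowerSeries.X ^ r * PowerSeries.C (PowerSeries.coeff r q₀) := by
    ext i
    rw [mul_comm, PowerSeries.coeff_C_mul, PowerSeries.coeff_monomial, PowerSeries.coeff_X_pow]
    simp
  rw [this, C_mul]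
  ring

theorem truncGeneric_sub (n : ℕ) (q₀ : PowerSeries K) (r : ℕ) (ε : K) :
    truncGeneric L n q₀ r - C (conjSeries L n q₀ ε) = C (unif K L ^ (-n : ℤ)) *
      (C ((PowerSeries.trunc r q₀ : PowerSeries K) -
        PowerSeries.C (ε ^ (-n : ℤ)) * PowerSeries.rescale ε q₀) +
        C (PowerSeries.X ^ r) * X : (PowerSeries K)[X]).map (algebraMap (PowerSeries K) L) := by
  rw [truncGeneric, conjSeries, C_mul, ← mul_sub]
  congr 1
  simp
  ring

theorem coeff_trunc_sub_conj {n : ℕ} (q₀ : PowerSeries K) {r : ℕ} {ε : K} (hε : ε ≠ 0) (j : ℕ) :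
    PowerSeries.coeff j ((PowerSeries.trunc r q₀ : PowerSeries K) -
        PowerSeries.C (ε ^ (-n : ℤ)) * PowerSeries.rescale ε q₀) =
      (if j < r then PowerSeries.coeff j q₀ else 0) - PowerSeries.coeff j q₀ * ε ^ (j - n : ℤ) := by
  rw [map_sub, PowerSeries.coeff_C_mul, PowerSeries.coeff_rescale, Polynomial.coeff_coe,
    PowerSeries.coeff_trunc, sub_eq_add_neg (j : ℤ), add_comm (j : ℤ), zpow_add₀ hε, zpow_natCast]
  ring

theorem hasInit_truncGeneric_sub_of_eq {n : ℕ} {q₀ : PowerSeries K} {r : ℕ} {ε : K} (hε : ε ≠ 0)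
    (h : ∀ i < r, PowerSeries.coeff i q₀ ≠ 0 → ε ^ (i - n : ℤ) = 1) :
    HasInit (truncGeneric L n q₀ r - C (conjSeries L n q₀ ε)) (r - n)
      (X - C (PowerSeries.coeff r q₀ * ε ^ (r - n : ℤ))) := by
  rw [truncGeneric_sub]
  have hc := fun j => coeff_trunc_sub_conj (n := n) q₀ (r := r) hε j
  set w := (PowerSeries.trunc r q₀ : PowerSeries K) -
        PowerSeries.C (ε ^ (-n : ℤ)) * PowerSeries.rescale ε q₀
  obtain ⟨v, hv⟩ : PowerSeries.X ^ r ∣ w := by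
    rw [PowerSeries.X_pow_dvd_iff]
    intro j hj
    rw [hc, if_pos hj]
    by_cases h0 : PowerSeries.coeff j q₀ = 0
    · simp [h0]
    · simp [h j hj h0]
  have hv0 : PowerSeries.constantCoeff v = -(PowerSeries.coeff r q₀ * ε ^ (r - n : ℤ)) := by
    have := hc r
    rw [hv, PowerSeries.coeff_X_pow_mul'] at this
    simpa using this
  refine ⟨C v + X, ?_, by simp [hv0, sub_eq_add_neg, add_comm]⟩
  rw [hv, sub_eq_add_neg (r : ℤ), add_comm (r : ℤ), zpow_add₀ unif_ne_zero, zpow_natCast]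
  simp [unif]
  ring

theorem hasInit_truncGeneric_sub_of_ne {n : ℕ} {q₀ : PowerSeries K} {r : ℕ} {ε : K} (hε : ε ≠ 0)
    (h : ∃ i < r, PowerSeries.coeff i q₀ ≠ 0 ∧ ε ^ (i - n : ℤ) ≠ 1) :
    ∃ (N : ℤ) (β : K), β ≠ 0 ∧
      HasInit (truncGeneric L n q₀ r - C (conjSeries L n q₀ ε)) N (C β) := by
  classical
  rw [truncGeneric_sub]
  have hc := fun j => coeff_trunc_sub_conj (n := n) q₀ (r := r) hε j
  set w := (PowerSeries.trunc r q₀ : PowerSeries K) -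
        PowerSeries.C (ε ^ (-n : ℤ)) * PowerSeries.rescale ε q₀
  have hex : ∃ j, j < r ∧ PowerSeries.coeff j w ≠ 0 := by
    obtain ⟨i, hi, h0, h1⟩ := h
    refine ⟨i, hi, ?_⟩
    rw [hc, if_pos hi]
    intro h2
    apply h1
    apply mul_left_cancel₀ h0
    rw [mul_one]
    exact (sub_eq_zero.1 h2).symm
  obtain ⟨j, ⟨hjr, hj⟩, hmin⟩ : ∃ j, (j < r ∧ PowerSeries.coeff j w ≠ 0) ∧
      ∀ i < j, ¬ (i < r ∧ PowerSeries.coeff i w ≠ 0) :=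
    ⟨_, Nat.find_spec hex, fun i hi => Nat.find_min hex hi⟩
  obtain ⟨v, hv⟩ : PowerSeries.X ^ j ∣ w := by
    rw [PowerSeries.X_pow_dvd_iff]
    intro i hi
    by_contra h0
    exact hmin i hi ⟨hi.trans hjr, h0⟩
  have hv0 : PowerSeries.constantCoeff v ≠ 0 := by
    rw [hv, PowerSeries.coeff_X_pow_mul'] at hj
    simpa using hj
  refine ⟨j - n, _, hv0, C v + C (PowerSeries.X ^ (r - j)) * X, ?_, ?_⟩
  · rw [hv, sub_eq_add_neg (j : ℤ), add_comm (j : ℤ), zpow_add₀ unif_ne_zero, zpow_natCast]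
    obtain ⟨t, rfl⟩ := Nat.exists_eq_add_of_lt hjr
    rw [show j + t + 1 - j = t + 1 by omega]
    simp [unif]
    ring
  · have : r - j ≠ 0 := by omega
    simp [this]

theorem hasInit_prod_truncGeneric_sub [IsAlgClosed K] {n m e : ℕ} {q₀ : PowerSeries K} {r : ℕ}
    (hm : (m : K) ≠ 0) (hem : e ∣ m)
    (he : ∀ ε : K, ε ^ m = 1 →
      (ε ^ e = 1 ↔ ∀ i < r, PowerSeries.coeff i q₀ ≠ 0 → ε ^ (i - n : ℤ) = 1)) :
    ∃ (N : ℤ) (C₀ : K), C₀ ≠ 0 ∧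
      HasInit (∏ ε ∈ nthRootsFinset m (1 : K), (truncGeneric L n q₀ r - C (conjSeries L n q₀ ε))) N
        (C C₀ * ∏ ε ∈ nthRootsFinset e (1 : K),
          (X - C (PowerSeries.coeff r q₀ * ε ^ (r - n : ℤ)))) := by
  classical
  have hm0 : 0 < m := Nat.pos_of_ne_zero (by rintro rfl; simp at hm)
  have he0 : 0 < e := Nat.pos_of_dvd_of_pos hem hm0
  have hne : ∀ ε ∈ nthRootsFinset m (1 : K), ε ≠ 0 := by
    rintro ε hε rfl
    rw [mem_nthRootsFinset hm0, zero_pow hm0.ne'] at hε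
    simp at hε
  have hfil : nthRootsFinset e (1 : K) = (nthRootsFinset m (1 : K)).filter (fun ε => ε ^ e = 1) := by
    ext ε
    rw [Finset.mem_filter, mem_nthRootsFinset hm0, mem_nthRootsFinset he0]
    refine ⟨fun h => ⟨?_, h⟩, fun h => h.2⟩
    obtain ⟨t, rfl⟩ := hem
    rw [pow_mul, h, one_pow]
  rw [← Finset.prod_filter_mul_prod_filter_not _ (fun ε : K => ε ^ e = 1), ← hfil]
  have h1 := HasInit.prod (L := L) (nthRootsFinset e (1 : K)) (fun ε hε => by
    rw [hfil, Finset.mem_filter] at hε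
    exact hasInit_truncGeneric_sub_of_eq (L := L) (hne _ hε.1)
      ((he ε ((mem_nthRootsFinset hm0 _).1 hε.1)).1 hε.2))
  have h2 : ∀ ε ∈ (nthRootsFinset m (1 : K)).filter (fun ε => ¬ ε ^ e = 1), ∃ (N : ℤ) (β : K),
      β ≠ 0 ∧ HasInit (truncGeneric L n q₀ r - C (conjSeries L n q₀ ε)) N (C β) := by
    intro ε hε
    rw [Finset.mem_filter] at hε
    refine hasInit_truncGeneric_sub_of_ne (hne _ hε.1) ?_
    have := hε.2
    rw [he ε ((mem_nthRootsFinset hm0 _).1 hε.1)] at this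
    push Not at this
    exact this
  choose! N β hβ hN using h2
  have h3 := HasInit.prod (L := L) _ hN
  have h4 := h1.mul h3
  rw [← map_prod C, mul_comm (∏ ε ∈ nthRootsFinset e (1 : K), (X - C _))] at h4
  exact ⟨_, _, Finset.prod_ne_zero_iff.2 hβ, h4⟩

end GenericTruncation

section ExpansionState

variable {K L : Type*} [Field K] [Field L] [Algebra (PowerSeries K) L]
  [IsFractionRing (PowerSeries K) L]

/-- Substitution of the generic truncation `truncGeneric L n q₀ r` for the outer variable. -/
noncomputable def evalTrunc (φ : K[X] →+* L) (n : ℕ) (q₀ : PowerSeries K) (r : ℕ) :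
    K[X][X] →+* L[X] :=
  eval₂RingHom ((C : L →+* L[X]).comp φ) (truncGeneric L n q₀ r)

theorem evalTrunc_succ (φ : K[X] →+* L) (n : ℕ) (q₀ : PowerSeries K) (r : ℕ) (h : K[X][X]) :
    evalTrunc φ n q₀ (r + 1) h =
      (evalTrunc φ n q₀ r h).comp (HasInit.blowup K L (PowerSeries.coeff r q₀)) := by
  simp only [evalTrunc, coe_eval₂RingHom, ← Polynomial.coe_compRingHom_apply, Polynomial.hom_eval₂]
  rw [truncGeneric_succ]
  congr 1
  ext <;> simp

theorem evalTrunc_eq_prod {φ : K[X] →+* L} {n m : ℕ} {q₀ : PowerSeries K} (r : ℕ) {f : K[X][X]}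
    (hf : f.map φ = ∏ ε ∈ nthRootsFinset m (1 : K), (X - C (conjSeries L n q₀ ε))) :
    evalTrunc φ n q₀ r f =
      ∏ ε ∈ nthRootsFinset m (1 : K), (truncGeneric L n q₀ r - C (conjSeries L n q₀ ε)) := by
  rw [evalTrunc, coe_eval₂RingHom, ← Polynomial.eval₂_map, hf, ← Polynomial.comp,
    Polynomial.prod_comp]
  simp

/-- Minus `s` lies in the numerical semigroup generated by `m` and `n`, provided `s` is divisible
by `gcd m n`. -/
def NegMemSemigroup (m n : ℕ) (s : ℤ) : Prop :=
  (Nat.gcd m n : ℤ) ∣ s → ∃ a b : ℕ, -s = a * m + b * n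

/-- The state of the expansion process at order `r`: `e` is the order of the group of `m`-th roots
of unity fixing the truncation of `τ ^ (-n) * q₀` at order `r`, and there is a monic polynomial of
degree `m / e` whose expansion has a linear initial form. -/
structure TruncState (φ : K[X] →+* L) (m n : ℕ) (q₀ : PowerSeries K) (r e D : ℕ) : Prop where
  mul_eq : e * D = m
  stab : ∀ ε : K, ε ^ m = 1 →
    (ε ^ e = 1 ↔ ∀ i < r, PowerSeries.coeff i q₀ ≠ 0 → ε ^ (i - n : ℤ) = 1)
  key : ∃ (g : K[X][X]) (M : ℤ) (a b : K), b ≠ 0 ∧ g.Monic ∧ g.natDegree = D ∧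
    HasInit (evalTrunc φ n q₀ r g) M (C b * (X + C a)) ∧ (e : ℤ) ∣ M - (r - n) ∧
    (r = 0 → M = -n)
  const : ∀ h : K[X][X], h ≠ 0 → h.natDegree < D → ∃ (s : ℤ) (β : K), β ≠ 0 ∧
    HasInit (evalTrunc φ n q₀ r h) s (C β) ∧ (e : ℤ) ∣ s ∧ NegMemSemigroup m n s
  eq_of_zero : r = 0 → e = m
  dvd_gcd : r ≠ 0 → e ∣ Nat.gcd m n

theorem TruncState.zero {φ : K[X] →+* L} {m n : ℕ} (q₀ : PowerSeries K)
    (hφ : ∀ a : K[X], a ≠ 0 → ∃ β : K, β ≠ 0 ∧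
      HasInit (C (φ a)) (-(m * a.natDegree : ℤ)) (C β)) :
    TruncState φ m n q₀ 0 m 1 where
  mul_eq := mul_one m
  stab := by simp
  key := by
    refine ⟨X, -n, 0, 1, one_ne_zero, monic_X, natDegree_X, ⟨X, ?_, by simp⟩, by simp, by simp⟩
    simp [evalTrunc, truncGeneric]
  const := by
    intro h h0 hd
    obtain ⟨a, rfl⟩ := natDegree_eq_zero.1 (Nat.lt_one_iff.1 hd)
    obtain ⟨β, hβ, hβ'⟩ := hφ a (by rintro rfl; simp at h0)
    refine ⟨-(m * a.natDegree : ℤ), β, hβ, ?_, ?_, ?_⟩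
    · simpa [evalTrunc] using hβ'
    · exact ⟨-a.natDegree, by ring⟩
    · intro _
      exact ⟨a.natDegree, 0, by push_cast; ring⟩
  eq_of_zero := by simp
  dvd_gcd := by simp

theorem Int.dvd_of_dvd_mul_of_eq_gcd {e l i k : ℤ} (he0 : e ≠ 0) (hel : e = l * Int.gcd e k)
    (h : e ∣ i * k) : l ∣ i := by
  have hg : (Int.gcd e k : ℤ) ≠ 0 := by
    intro h0
    rw [h0, mul_zero] at hel
    exact he0 hel
  have h1 : e ∣ i * Int.gcd e k := by
    rw [Int.gcd_eq_gcd_ab, mul_add]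
    refine dvd_add ⟨i * Int.gcdA e k, by ring⟩ ?_
    rw [← mul_assoc]
    exact h.mul_right _
  have h2 : l * (Int.gcd e k : ℤ) ∣ i * Int.gcd e k := hel ▸ h1
  exact Int.dvd_of_mul_dvd_mul_right hg h2

theorem pow_gcd_zpow_eq_one_iff {K : Type*} [Field K] {ε : K} (hε : ε ≠ 0) (e : ℕ) (k : ℤ) :
    ε ^ Int.gcd e k = 1 ↔ ε ^ e = 1 ∧ ε ^ k = 1 := by
  constructor
  · intro h
    have : ∀ z : ℤ, (Int.gcd e k : ℤ) ∣ z → ε ^ z = 1 := by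
      rintro _ ⟨j, rfl⟩
      rw [zpow_mul, zpow_natCast, h, one_zpow]
    exact ⟨by simpa using this e (Int.gcd_dvd_left _ _), this k (Int.gcd_dvd_right _ _)⟩
  · rintro ⟨h1, h2⟩
    rw [← zpow_natCast, Int.gcd_eq_gcd_ab, zpow_add₀ hε, zpow_mul, zpow_mul, zpow_natCast, h1, h2,
      one_zpow, one_zpow, one_mul]

theorem TruncState.succ [IsAlgClosed K] {φ : K[X] →+* L} {m n : ℕ} {q₀ : PowerSeries K}
    (hφC : ∀ a : K, φ (C a) = algebraMap (PowerSeries K) L (PowerSeries.C a))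
    (hm : (m : K) ≠ 0) (hq₀ : PowerSeries.constantCoeff q₀ ≠ 0)
    {f : K[X][X]} (hfm : f.Monic) (hfd : f.natDegree = m)
    (hf : f.map φ = ∏ ε ∈ nthRootsFinset m (1 : K), (X - C (conjSeries L n q₀ ε)))
    {r e D : ℕ} (S : TruncState φ m n q₀ r e D) :
    ∃ e' D', TruncState φ m n q₀ (r + 1) e' D' := by
  have hm0 : m ≠ 0 := by rintro rfl; simp at hm
  have he0 : e ≠ 0 := by rintro rfl; have := S.mul_eq; omega
  have hD : 0 < D := Nat.pos_of_ne_zero (by rintro rfl; have := S.mul_eq; omega)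
  have hem : e ∣ m := ⟨D, S.mul_eq.symm⟩
  have heK : (e : K) ≠ 0 := by
    rintro h
    apply hm
    rw [← S.mul_eq, Nat.cast_mul, h, zero_mul]
  obtain ⟨g, M, a, b, hb, hg, hgD, hginit, hMk, hM0⟩ := S.key
  obtain ⟨N, C₀, hC₀, hfinit⟩ := hasInit_prod_truncGeneric_sub (L := L) hm hem S.stab
  rw [← evalTrunc_eq_prod r hf] at hfinit
  have hΛ : ∀ a : K, evalTrunc φ n q₀ r (C (C a)) =
      C (algebraMap (PowerSeries K) L (PowerSeries.C a)) := by
    intro a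
    simp [evalTrunc, hφC]
  have hdn : (Nat.gcd m n : ℤ) ∣ n := by exact_mod_cast Nat.gcd_dvd_right m n
  set c := PowerSeries.coeff r q₀ with hc
  by_cases hc0 : c = 0
  · have hr : r ≠ 0 := by
      rintro rfl
      apply hq₀
      rw [← hc0, hc, PowerSeries.coeff_zero_eq_constantCoeff_apply]
    rw [hc0] at hfinit
    have hcard : (nthRootsFinset e (1 : K)).card = e := by
      have : NeZero (e : K) := ⟨heK⟩
      obtain ⟨ζ, hζ⟩ := HasEnoughRootsOfUnity.exists_primitiveRoot K e
      exact hζ.card_nthRootsFinset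
    have hfinit' : HasInit (evalTrunc φ n q₀ r f) N (C C₀ * (X ^ 1 - C (c ^ 1)) ^ e) := by
      simpa [hc0, hcard] using hfinit
    obtain ⟨⟨g', a', b', hb', hg', hgD', hg'i⟩, h2⟩ := HasInit.step hD hΛ S.const hb hg hgD hginit
      hfm (by rw [hfd, S.mul_eq]) (one_mul e).symm heK hfinit' hC₀ (Or.inl rfl)
      (by
        intro s i hi _ hs
        obtain rfl : i = 0 := by omega
        simpa using hs)
    simp only [hc, ← evalTrunc_succ, one_mul] at hg'i h2 hgD'
    refine ⟨e, D, S.mul_eq, ?_, ⟨g', _, a', b', hb', hg', hgD', hg'i, ?_, by simp⟩, h2, by simp,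
      fun _ => S.dvd_gcd hr⟩
    · intro ε hε
      rw [S.stab ε hε]
      refine ⟨fun h i hi hi0 => ?_, fun h i hi hi0 => h i (by omega) hi0⟩
      rcases Nat.lt_succ_iff_lt_or_eq.1 hi with h' | rfl
      · exact h i h' hi0
      · exact absurd hc0 hi0
    · have h1 : ((1 : ℕ) : ℤ) * M + 1 - ((r + 1 : ℕ) - n : ℤ) = M - (r - n) := by
        push_cast
        ring
      rwa [h1]
  · set k : ℤ := r - n with hk
    set e' := Int.gcd e k with he'
    have he'e : e' ∣ e := by exact_mod_cast Int.gcd_dvd_left (e : ℤ) k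
    have he'k : (e' : ℤ) ∣ k := Int.gcd_dvd_right _ _
    have hel : e = e / e' * e' := (Nat.div_mul_cancel he'e).symm
    have he'M : (e' : ℤ) ∣ M := by
      have h1 : (e' : ℤ) ∣ M - k := (Int.natCast_dvd_natCast.2 he'e).trans hMk
      have := dvd_add h1 he'k
      rwa [sub_add_cancel] at this
    have hli : ∀ i : ℤ, (e : ℤ) ∣ i * M → ((e / e' : ℕ) : ℤ) ∣ i := by
      intro i hi
      refine Int.dvd_of_dvd_mul_of_eq_gcd (e := e) (k := k) (by exact_mod_cast he0)
        (by exact_mod_cast hel) ?_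
      have := dvd_sub hi (hMk.mul_left i)
      rwa [show i * M - i * (M - k) = i * k by ring] at this
    rw [prod_X_sub_C_mul_zpow heK] at hfinit
    obtain ⟨⟨g', a', b', hb', hg', hgD', hg'i⟩, h2⟩ := HasInit.step hD hΛ S.const hb hg hgD hginit
      hfm (by rw [hfd, S.mul_eq]) hel heK hfinit hC₀ (Or.inr ⟨hc0, he'M, hli⟩)
      (by
        intro s i hi hes hs hd
        by_cases hr : r = 0
        · rw [hM0 hr] at hd ⊢
          have h1 : (Nat.gcd m n : ℤ) ∣ s := by
            have h2 : (Nat.gcd m n : ℤ) ∣ i * -n := (hdn.neg_right).mul_left i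
            exact (dvd_add_left h2).1 hd
          obtain ⟨x, y, hxy⟩ := hs h1
          refine ⟨x, y + i, ?_⟩
          push_cast
          linear_combination hxy
        · have h1 : (e : ℤ) ∣ s + i * M := (Int.natCast_dvd_natCast.2 (S.dvd_gcd hr)).trans hd
          have h2 := Int.natCast_dvd_natCast.1 (hli i ((dvd_add_right hes).1 h1))
          obtain rfl : i = 0 := Nat.eq_zero_of_dvd_of_lt h2 hi
          simp only [Nat.cast_zero, zero_mul, add_zero] at hd ⊢
          exact hs hd)
    simp only [hc, ← evalTrunc_succ] at hg'i h2
    refine ⟨e', e / e' * D, ?_, ?_, ⟨g', _, a', b', hb', hg', hgD', hg'i, ?_, by simp⟩, h2, by simp,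
      fun _ => ?_⟩
    · rw [← mul_assoc, mul_comm e', ← hel, S.mul_eq]
    · intro ε hε
      have hε0 : ε ≠ 0 := by
        rintro rfl
        rw [zero_pow hm0] at hε
        simp at hε
      rw [he', pow_gcd_zpow_eq_one_iff hε0, S.stab ε hε]
      constructor
      · rintro ⟨h1, h2⟩ i hi hi0
        rcases Nat.lt_succ_iff_lt_or_eq.1 hi with h' | rfl
        · exact h1 i h' hi0
        · exact h2
      · intro h
        exact ⟨fun i hi => h i (by omega), h r (by omega) hc0⟩
    · have h1 := dvd_sub (he'M.mul_left ((e / e' : ℕ) : ℤ)) he'k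
      have h3 : ((e / e' : ℕ) : ℤ) * M + 1 - ((r + 1 : ℕ) - n : ℤ) = ((e / e' : ℕ) : ℤ) * M - k := by
        rw [hk, Nat.cast_add, Nat.cast_one]
        ring
      rwa [h3]
    · by_cases hr : r = 0
      · rw [he', hk, hr, S.eq_of_zero hr]
        simp
      · exact he'e.trans (S.dvd_gcd hr)

theorem exists_semigroup_order [IsAlgClosed K] {φ : K[X] →+* L} {m n : ℕ} {q₀ : PowerSeries K}
    (hφ : ∀ a : K[X], a ≠ 0 → ∃ β : K, β ≠ 0 ∧
      HasInit (C (φ a)) (-(m * a.natDegree : ℤ)) (C β))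
    (hφC : ∀ a : K, φ (C a) = algebraMap (PowerSeries K) L (PowerSeries.C a))
    (hm : (m : K) ≠ 0) (hq₀ : PowerSeries.constantCoeff q₀ ≠ 0)
    {f : K[X][X]} (hfm : f.Monic) (hfd : f.natDegree = m)
    (hf : f.map φ = ∏ ε ∈ nthRootsFinset m (1 : K), (X - C (conjSeries L n q₀ ε)))
    (hconj : ∀ ε : K, ε ^ m = 1 → conjSeries L n q₀ ε = conjSeries L n q₀ 1 → ε = 1)
    {h : K[X][X]} (h0 : h ≠ 0) (hd : h.natDegree < m) :
    ∃ (s : ℤ) (w : PowerSeries K), PowerSeries.constantCoeff w ≠ 0 ∧ NegMemSemigroup m n s ∧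
      h.eval₂ φ (unif K L ^ (-n : ℤ) * algebraMap _ L q₀) = unif K L ^ s * algebraMap _ L w := by
  have hm0 : 0 < m := Nat.pos_of_ne_zero (by rintro rfl; simp at hm)
  have hstate : ∀ r, ∃ e D, TruncState φ m n q₀ r e D := by
    intro r
    induction r with
    | zero => exact ⟨_, _, TruncState.zero q₀ hφ⟩
    | succ r ih =>
      obtain ⟨e, D, S⟩ := ih
      exact S.succ hφC hm hq₀ hfm hfd hf
  have hex : ∀ ε ∈ nthRootsFinset m (1 : K), ∃ j : ℕ, ε ≠ 1 →
      PowerSeries.coeff j q₀ ≠ 0 ∧ ε ^ (j - n : ℤ) ≠ 1 := by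
    intro ε hε
    rw [Polynomial.mem_nthRootsFinset hm0] at hε
    have hε0 : ε ≠ 0 := by
      rintro rfl
      rw [zero_pow hm0.ne'] at hε
      simp at hε
    by_contra! hcon
    obtain ⟨h1, -⟩ := hcon 0
    apply h1
    apply hconj ε hε
    rw [conjSeries, conjSeries]
    congr 2
    ext j
    rw [PowerSeries.coeff_C_mul, PowerSeries.coeff_rescale, PowerSeries.coeff_C_mul,
      PowerSeries.coeff_rescale]
    by_cases hj : PowerSeries.coeff j q₀ = 0
    · simp [hj]
    · have h2 := (hcon j).2 hj
      rw [sub_eq_add_neg, add_comm, zpow_add₀ hε0, zpow_natCast] at h2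
      rw [← mul_assoc, h2]
      simp
  choose! j hj using hex
  set r := (nthRootsFinset m (1 : K)).sup j + 1 with hr
  obtain ⟨e, D, S⟩ := hstate r
  have he0 : e ≠ 0 := by rintro rfl; have := S.mul_eq; omega
  have he1 : e = 1 := by
    have heK : (e : K) ≠ 0 := by
      rintro h
      apply hm
      rw [← S.mul_eq, Nat.cast_mul, h, zero_mul]
    have : NeZero (e : K) := ⟨heK⟩
    obtain ⟨ζ, hζ⟩ := HasEnoughRootsOfUnity.exists_primitiveRoot K e
    have hζm : ζ ^ m = 1 := by rw [← S.mul_eq, pow_mul, hζ.pow_eq_one, one_pow]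
    have hmem := (Polynomial.mem_nthRootsFinset hm0 (1 : K)).2 hζm
    have hζ1 : ζ = 1 := by
      by_contra hne
      obtain ⟨h1, h2⟩ := hj ζ hmem hne
      exact h2 ((S.stab ζ hζm).1 hζ.pow_eq_one _ (Nat.lt_succ_of_le (Finset.le_sup hmem)) h1)
    rw [hζ1] at hζ
    exact Nat.dvd_one.1 (hζ.dvd_of_pow_eq_one 1 (one_pow 1))
  have hDm : D = m := by rw [← S.mul_eq, he1, one_mul]
  obtain ⟨s, β, hβ, hs, -, hsP⟩ := S.const h h0 (by rwa [hDm])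
  obtain ⟨u, hu⟩ : ∃ u, q₀ = (PowerSeries.trunc r q₀ : PowerSeries K) + PowerSeries.X ^ r * u := by
    obtain ⟨u, hu⟩ : PowerSeries.X ^ r ∣ q₀ - (PowerSeries.trunc r q₀ : PowerSeries K) := by
      rw [PowerSeries.X_pow_dvd_iff]
      intro i hi
      rw [map_sub, Polynomial.coeff_coe, PowerSeries.coeff_trunc, if_pos hi, sub_self]
    exact ⟨u, by rw [← hu]; ring⟩
  obtain ⟨w, hw, hw0⟩ := hs.eval u
  refine ⟨s, w, ?_, hsP, ?_⟩
  · rw [hw0, eval_C]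
    exact hβ
  · rw [← hw, evalTrunc, coe_eval₂RingHom, ← Polynomial.coe_evalRingHom, Polynomial.hom_eval₂]
    have h1 : (evalRingHom (algebraMap (PowerSeries K) L u)).comp ((C : L →+* L[X]).comp φ) = φ := by
      ext <;> simp
    rw [h1]
    congr 1
    rw [truncGeneric]
    conv_lhs => rw [hu]
    simp

end ExpansionState

section PuiseuxParametrization

/-- Every polynomial is a combination of `1, X, …, X ^ (m - 1)` with coefficients in `K[P]`,
where `m = deg P`. -/
theorem Polynomial.exists_eq_sum_comp_mul_X_pow {K : Type*} [Field K] {P : K[X]}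
    (hP : 0 < P.natDegree) (h : K[X]) :
    ∃ a : Fin P.natDegree → K[X], h = ∑ i, (a i).comp P * X ^ (i : ℕ) := by
  have hP0 : P ≠ 0 := by rintro rfl; simp at hP
  have hlc : P.leadingCoeff ≠ 0 := leadingCoeff_ne_zero.2 hP0
  induction hN : h.natDegree using Nat.strong_induction_on generalizing h with
  | _ N ih =>
    have hmod : (h % P).natDegree < P.natDegree := natDegree_mod_lt h hP.ne'
    have hsum : h % P = ∑ i : Fin P.natDegree, C ((h % P).coeff i) * X ^ (i : ℕ) := by
      conv_lhs => rw [as_sum_range_C_mul_X_pow' (h % P) hmod]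
      rw [Finset.sum_range]
    by_cases hlt : h.natDegree < P.natDegree
    · refine ⟨fun i => C (h.coeff i), ?_⟩
      have : h % P = h := (mod_eq_self_iff hP0).2 (degree_lt_degree hlt)
      rw [this] at hsum
      simpa using hsum
    · have hdiv : (h / P).natDegree < N := by
        rw [← hN]
        have := degree_div_lt (p := h) (q := P) (by rintro rfl; simp at hlt; omega)
          (natDegree_pos_iff_degree_pos.1 hP)
        by_cases hd0 : h / P = 0
        · rw [hd0, natDegree_zero]
          omega
        · exact natDegree_lt_natDegree hd0 this
      obtain ⟨b, hb⟩ := ih _ hdiv (h / P) rfl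
      refine ⟨fun i => C ((h % P).coeff i) + X * b i, ?_⟩
      simp only [add_comp, mul_comp, C_comp, X_comp, add_mul, Finset.sum_add_distrib, mul_assoc]
      rw [← hsum, ← Finset.mul_sum, ← hb, EuclideanDomain.mod_add_div]

/-- The implicit equation of a parametrized plane curve. -/
theorem Polynomial.exists_monic_eval₂_compRingHom_eq_zero {K : Type*} [Field K] {P : K[X]}
    (hP : 0 < P.natDegree) (Q : K[X]) :
    ∃ f : K[X][X], f.Monic ∧ f.natDegree = P.natDegree ∧ f.eval₂ (compRingHom P) Q = 0 := by
  choose A hA using fun j : Fin P.natDegree =>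
    Polynomial.exists_eq_sum_comp_mul_X_pow hP (Q * X ^ (j : ℕ))
  let M : Matrix (Fin P.natDegree) (Fin P.natDegree) K[X] := Matrix.of A
  refine ⟨M.charpoly, M.charpoly_monic, by simp, ?_⟩
  rw [eval₂_eq_eval_map, ← Matrix.charpoly_map, Matrix.eval_charpoly]
  refine Matrix.exists_mulVec_eq_zero_iff.1 ⟨fun i => X ^ (i : ℕ), ?_, ?_⟩
  · intro h0
    exact pow_ne_zero _ X_ne_zero (congrFun h0 ⟨0, hP⟩)
  · ext1 j
    rw [Matrix.sub_mulVec, Pi.sub_apply, Pi.zero_apply, sub_eq_zero]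
    simp only [Matrix.scalar_apply, Matrix.mulVec_diagonal]
    rw [hA j]
    simp [Matrix.mulVec, dotProduct, M]

theorem Polynomial.Monic.eq_prod_X_sub_C_of_injOn {R ι : Type*} [CommRing R] [IsDomain R]
    {p : R[X]} (hp : p.Monic) {S : Finset ι} {x : ι → R} (hS : S.card = p.natDegree)
    (hx : Set.InjOn x S) (hroot : ∀ i ∈ S, p.IsRoot (x i)) : p = ∏ i ∈ S, (X - C (x i)) := by
  classical
  have hle : (S.image x).val ≤ p.roots := by
    rw [Multiset.le_iff_subset (S.image x).nodup]
    intro y hy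
    obtain ⟨i, hi, rfl⟩ := Finset.mem_image.1 hy
    exact (mem_roots hp.ne_zero).2 (hroot i hi)
  have hcard : Multiset.card (S.image x).val = p.natDegree := by
    rw [Finset.card_val, Finset.card_image_of_injOn hx, hS]
  have heq : (S.image x).val = p.roots :=
    Multiset.eq_of_le_of_card_le hle (by rw [hcard]; exact card_roots' p)
  rw [← Finset.prod_image (f := fun y => X - C y) hx]
  conv_lhs => rw [← prod_multiset_X_sub_C_of_monic_of_roots_card_eq hp (by rw [← heq, hcard]),
    ← heq]
  rfl

section Puiseux

variable {K L : Type*} [Field K] [Field L] [Algebra (PowerSeries K) L]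
  [IsFractionRing (PowerSeries K) L]

/-- The power series `τ ^ (j * N) * p (τ ^ (-j) * u)`, for `p` of degree at most `N`. -/
noncomputable def poleEval (p : K[X]) (N j : ℕ) (u : PowerSeries K) : PowerSeries K :=
  ∑ i ∈ Finset.range (N + 1), PowerSeries.C (p.coeff i) * PowerSeries.X ^ (j * (N - i)) * u ^ i

theorem constantCoeff_poleEval (p : K[X]) (N : ℕ) {j : ℕ} (hj : 0 < j) (u : PowerSeries K) :
    PowerSeries.constantCoeff (poleEval p N j u) =
      p.coeff N * PowerSeries.constantCoeff u ^ N := by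
  rw [poleEval, map_sum, Finset.sum_range_succ, Finset.sum_eq_zero]
  · simp
  · intro i hi
    have h0 : j * (N - i) ≠ 0 := by
      have := Finset.mem_range.1 hi
      exact (Nat.mul_pos hj (by omega)).ne'
    simp [h0]

theorem eval₂_pole (p : K[X]) {N : ℕ} (hN : p.natDegree ≤ N) (j : ℕ) (u : PowerSeries K) :
    p.eval₂ ((algebraMap (PowerSeries K) L).comp PowerSeries.C)
      (unif K L ^ (-j : ℤ) * algebraMap _ L u) =
      unif K L ^ (-(j * N) : ℤ) * algebraMap _ L (poleEval p N j u) := by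
  rw [eval₂_eq_sum_range' _ (Nat.lt_succ_of_le hN), poleEval, map_sum, Finset.mul_sum]
  refine Finset.sum_congr rfl fun i hi => ?_
  have hi' : i ≤ N := Nat.lt_succ_iff.1 (Finset.mem_range.1 hi)
  obtain ⟨t, rfl⟩ := Nat.exists_eq_add_of_le hi'
  have h1 : (unif K L ^ (-j : ℤ)) ^ i =
      unif K L ^ (-(j * (i + t : ℕ)) : ℤ) * unif K L ^ (j * t) := by
    rw [← zpow_natCast, ← zpow_natCast, ← zpow_mul, ← zpow_add₀ unif_ne_zero]
    congr 1
    push_cast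
    ring
  rw [mul_pow, h1]
  simp [unif]
  ring

theorem exists_poleEval_eq_one [IsAlgClosed K] {P : K[X]}
    (hm : (P.natDegree : K) ≠ 0) :
    ∃ v : PowerSeries K, PowerSeries.constantCoeff v ≠ 0 ∧ poleEval P P.natDegree 1 v = 1 := by
  set m := P.natDegree with hmdef
  have hm0 : 0 < m := Nat.pos_of_ne_zero (by rintro h; simp [h] at hm)
  have hP0 : P ≠ 0 := by rintro rfl; simp [hmdef] at hm0
  have hlc : P.coeff m ≠ 0 := leadingCoeff_ne_zero.2 hP0
  obtain ⟨α, hα⟩ := IsAlgClosed.exists_pow_nat_eq (P.coeff m)⁻¹ hm0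
  have hα0 : α ≠ 0 := by
    rintro rfl
    rw [zero_pow hm0.ne'] at hα
    exact inv_ne_zero hlc hα.symm
  let R : (PowerSeries K)[X] := ∑ i ∈ Finset.range m,
    C (PowerSeries.C ((P.coeff m)⁻¹ * P.coeff i) * PowerSeries.X ^ (m - i)) * X ^ i -
      C (PowerSeries.C (P.coeff m)⁻¹)
  let F : (PowerSeries K)[X] := X ^ m + R
  have hRdeg : R.degree < m := by
    refine (degree_sub_le _ _).trans_lt (max_lt ?_ ?_)
    · refine (degree_sum_le _ _).trans_lt ?_
      rw [Finset.sup_lt_iff (by exact_mod_cast WithBot.bot_lt_coe m)]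
      intro i hi
      exact (degree_C_mul_X_pow_le _ _).trans_lt (by exact_mod_cast Finset.mem_range.1 hi)
    · exact degree_C_le.trans_lt (by exact_mod_cast hm0)
  have hF : F.Monic := monic_X_pow_add hRdeg
  have hFmap : F.map PowerSeries.constantCoeff = X ^ m - C (P.coeff m)⁻¹ := by
    have : ∑ i ∈ Finset.range m, (C (PowerSeries.C ((P.coeff m)⁻¹ * P.coeff i) *
        PowerSeries.X ^ (m - i)) * X ^ i : (PowerSeries K)[X]).map PowerSeries.constantCoeff
        = 0 := by
      refine Finset.sum_eq_zero fun i hi => ?_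
      have h0 : m - i ≠ 0 := by
        have := Finset.mem_range.1 hi
        omega
      simp [h0]
    simp only [F, R, Polynomial.map_add, Polynomial.map_sub, Polynomial.map_sum, this]
    simp [sub_eq_add_neg]
  have heval : ∀ (H : (PowerSeries K)[X]) (u : PowerSeries K), PowerSeries.constantCoeff (H.eval u) =
      (H.map PowerSeries.constantCoeff).eval (PowerSeries.constantCoeff u) := by
    intro H u
    rw [Polynomial.eval_map, Polynomial.eval₂_hom]
  have hmem : F.eval (PowerSeries.C α) ∈ (Ideal.span {PowerSeries.X} : Ideal (PowerSeries K)) := by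
    rw [Ideal.mem_span_singleton, PowerSeries.X_dvd_iff, heval, hFmap]
    simp [hα]
  have hunit : IsUnit (Ideal.Quotient.mk (Ideal.span {PowerSeries.X} : Ideal (PowerSeries K))
      (F.derivative.eval (PowerSeries.C α))) := by
    refine IsUnit.map _ ?_
    rw [PowerSeries.isUnit_iff_constantCoeff, isUnit_iff_ne_zero, heval, ← derivative_map, hFmap]
    simp [derivative_X_pow, hm, hα0]
  have hH : HenselianRing (PowerSeries K) (Ideal.span {PowerSeries.X}) := inferInstance
  obtain ⟨v, hv, hvα⟩ := hH.is_henselian F hF _ hmem hunit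
  have hv0 : PowerSeries.constantCoeff v = α := by
    rw [Ideal.mem_span_singleton, PowerSeries.X_dvd_iff, map_sub, sub_eq_zero] at hvα
    simpa using hvα
  refine ⟨v, by rwa [hv0], ?_⟩
  have h1 : poleEval P m 1 v = PowerSeries.C (P.coeff m) * F.eval v + 1 := by
    have h2 : (1 : PowerSeries K) = PowerSeries.C (P.coeff m) * PowerSeries.C (P.coeff m)⁻¹ := by
      rw [← map_mul, mul_inv_cancel₀ hlc, map_one]
    have h3 : ∀ i, PowerSeries.C (P.coeff m) * PowerSeries.C ((P.coeff m)⁻¹ * P.coeff i) =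
        PowerSeries.C (P.coeff i) := by
      intro i
      rw [← map_mul, mul_inv_cancel_left₀ hlc]
    simp only [F, R, eval_add, eval_sub, eval_pow, eval_X, eval_C, eval_finsetSum, eval_mul,
      poleEval, Finset.sum_range_succ, mul_add, mul_sub, Finset.mul_sum, ← mul_assoc, h3, ← h2]
    simp
    ring
  rw [h1, hv.eq_zero, mul_zero, zero_add]

/-- The automorphism `τ ↦ ε τ` of `K((τ))`. -/
noncomputable def rescaleHom (L : Type*) [Field L] [Algebra (PowerSeries K) L]
    [IsFractionRing (PowerSeries K) L] (ε : Kˣ) : L →+* L :=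
  IsFractionRing.lift (A := PowerSeries K)
    (g := (algebraMap (PowerSeries K) L).comp (PowerSeries.rescale (ε : K)))
    ((IsFractionRing.injective (PowerSeries K) L).comp (PowerSeries.rescale_injective ε.ne_zero))

theorem rescaleHom_algebraMap (ε : Kˣ) (u : PowerSeries K) :
    rescaleHom L ε (algebraMap _ L u) = algebraMap _ L (PowerSeries.rescale (ε : K) u) := by
  simp [rescaleHom]

theorem PowerSeries.rescale_C {R : Type*} [CommSemiring R] (r a : R) :
    PowerSeries.rescale r (PowerSeries.C a) = PowerSeries.C a := by
  ext i
  rw [coeff_rescale, coeff_C]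
  split_ifs with h <;> simp [h]

theorem rescaleHom_unif_zpow (ε : Kˣ) (k : ℤ) :
    rescaleHom L ε (unif K L ^ k) =
      algebraMap _ L (PowerSeries.C ((ε : K) ^ k)) * unif K L ^ k := by
  rw [map_zpow₀, unif, rescaleHom_algebraMap, PowerSeries.rescale_X, map_mul, mul_zpow]
  congr 1
  change _ = ((algebraMap (PowerSeries K) L).comp PowerSeries.C) ((ε : K) ^ k)
  rw [map_zpow₀]
  rfl

theorem rescaleHom_eq_conjSeries (ε : Kˣ) (n : ℕ) (q₀ : PowerSeries K) :
    rescaleHom L ε (unif K L ^ (-n : ℤ) * algebraMap _ L q₀) = conjSeries L n q₀ (ε : K) := by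
  rw [map_mul, rescaleHom_unif_zpow, rescaleHom_algebraMap, conjSeries, map_mul]
  ring

end Puiseux

end PuiseuxParametrization

section Conclusion

theorem natDegree_dvd_of_natCast_ne_zero {K : Type*} [Field K] [IsAlgClosed K] {P Q : K[X]}
    (hm : (P.natDegree : K) ≠ 0) (hn : 0 < Q.natDegree) (G : MvPolynomial (Fin 2) K)
    (hG : MvPolynomial.aeval ![P, Q] G = (X : K[X])) :
    P.natDegree ∣ Q.natDegree ∨ Q.natDegree ∣ P.natDegree := by
  let L := FractionRing (PowerSeries K)
  have hm0 : 0 < P.natDegree := Nat.pos_of_ne_zero (by rintro h; simp [h] at hm)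
  have hQ0 : Q ≠ 0 := by rintro rfl; simp at hn
  obtain ⟨v, hv0, hv⟩ := exists_poleEval_eq_one hm
  set m := P.natDegree with hmdef
  set n := Q.natDegree with hndef
  set ι : K →+* L := (algebraMap (PowerSeries K) L).comp PowerSeries.C with hι
  set θ : L := unif K L ^ (-(1 : ℕ) : ℤ) * algebraMap _ L v with hθ
  set ev : K[X] →+* L := eval₂RingHom ι θ with hev
  set φ : K[X] →+* L := eval₂RingHom ι (unif K L ^ (-m : ℤ)) with hφdef
  set q₀ := poleEval Q n 1 v with hq₀def
  have hq₀ : PowerSeries.constantCoeff q₀ ≠ 0 := by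
    rw [hq₀def, constantCoeff_poleEval _ _ one_pos]
    exact mul_ne_zero (leadingCoeff_ne_zero.2 hQ0) (pow_ne_zero _ hv0)
  set q : L := unif K L ^ (-n : ℤ) * algebraMap _ L q₀ with hq
  have hevP : ev P = unif K L ^ (-m : ℤ) := by
    rw [hev, coe_eval₂RingHom, hθ, eval₂_pole (L := L) P le_rfl, ← hmdef, hv]
    simp
  have hevQ : ev Q = q := by
    rw [hev, coe_eval₂RingHom, hθ, eval₂_pole (L := L) Q le_rfl, ← hndef, ← hq₀def, hq]
    simp
  have hevcomp : ev.comp (compRingHom P) = φ := by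
    ext a
    · simp [hev, hφdef]
    · simp only [RingHom.comp_apply, coe_compRingHom_apply, X_comp, hevP, hφdef]
      simp
  have hφ : ∀ a : K[X], a ≠ 0 → ∃ β : K, β ≠ 0 ∧
      HasInit (C (φ a)) (-(m * a.natDegree : ℤ)) (C β) := by
    intro a ha
    refine ⟨_, ?_, C (poleEval a a.natDegree m 1), ?_, map_C _⟩
    · rw [constantCoeff_poleEval _ _ hm0]
      simpa using ha
    · have := eval₂_pole (L := L) a le_rfl m 1
      rw [map_one, mul_one] at this
      rw [hφdef, coe_eval₂RingHom, this, map_C, C_mul]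
  have hφC : ∀ a : K, φ (C a) = algebraMap (PowerSeries K) L (PowerSeries.C a) := by
    intro a
    simp [hφdef, hι]
  obtain ⟨f, hfm, hfd, hf0⟩ := Polynomial.exists_monic_eval₂_compRingHom_eq_zero hm0 Q
  have hfq : f.eval₂ φ q = 0 := by
    rw [← hevcomp, ← hevQ, ← Polynomial.hom_eval₂, hf0, map_zero]
  -- conjugation by roots of unity
  have hσφ : ∀ ε : Kˣ, (ε : K) ^ m = 1 → (rescaleHom L ε).comp φ = φ := by
    intro ε hε
    ext a
    · simp [hφdef, hι, rescaleHom_algebraMap, PowerSeries.rescale_C]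
    · simp only [hφdef, RingHom.comp_apply, coe_eval₂RingHom, eval₂_X, rescaleHom_unif_zpow]
      rw [zpow_neg, zpow_natCast, hε]
      simp
  have hσθ : ∀ ε ε' : Kˣ, (ε : K) ^ m = 1 → (ε' : K) ^ m = 1 →
      rescaleHom L ε q = rescaleHom L ε' q → ε = ε' := by
    intro ε ε' hε hε' h
    have h1 : rescaleHom L ε θ = rescaleHom L ε' θ := by
      have h2 : ((rescaleHom L ε).comp ev).comp (MvPolynomial.aeval (R := K) ![P, Q]).toRingHom =
          ((rescaleHom L ε').comp ev).comp (MvPolynomial.aeval (R := K) ![P, Q]).toRingHom := by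
        refine MvPolynomial.ringHom_ext ?_ ?_
        · intro a
          simp [hev, hι, rescaleHom_algebraMap, PowerSeries.rescale_C]
        · intro i
          fin_cases i
          · have h3 := DFunLike.congr_fun ((hσφ ε hε).trans (hσφ ε' hε').symm) X
            simpa [hφdef, hevP] using h3
          · simpa [hevQ] using h
      have h3 := DFunLike.congr_fun h2 G
      have h4 : ev X = θ := by simp [hev]
      simpa [hG, h4] using h3
    rw [hθ, rescaleHom_eq_conjSeries, rescaleHom_eq_conjSeries, conjSeries, conjSeries] at h1
    have h2 := IsFractionRing.injective (PowerSeries K) L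
      (mul_left_cancel₀ (zpow_ne_zero _ unif_ne_zero) h1)
    have h3 := congrArg PowerSeries.constantCoeff h2
    simp only [map_mul, PowerSeries.constantCoeff_C] at h3
    rw [← PowerSeries.coeff_zero_eq_constantCoeff_apply, PowerSeries.coeff_rescale,
      ← PowerSeries.coeff_zero_eq_constantCoeff_apply, PowerSeries.coeff_rescale] at h3
    simp only [pow_zero, one_mul, PowerSeries.coeff_zero_eq_constantCoeff_apply] at h3
    have h4 := mul_right_cancel₀ hv0 h3
    ext
    simpa using h4
  have hunit : ∀ ε : K, ε ^ m = 1 → ∃ η : Kˣ, (η : K) = ε := by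
    intro ε hε
    refine ⟨Units.mk0 ε ?_, rfl⟩
    rintro rfl
    rw [zero_pow hm0.ne'] at hε
    simp at hε
  have hconj : ∀ ε ε' : K, ε ^ m = 1 → ε' ^ m = 1 →
      conjSeries L n q₀ ε = conjSeries L n q₀ ε' → ε = ε' := by
    intro ε ε' hε hε' h
    obtain ⟨η, rfl⟩ := hunit ε hε
    obtain ⟨η', rfl⟩ := hunit ε' hε'
    rw [← rescaleHom_eq_conjSeries, ← rescaleHom_eq_conjSeries] at h
    rw [hσθ η η' hε hε' h]
  have hfprod : f.map φ = ∏ ε ∈ nthRootsFinset m (1 : K), (X - C (conjSeries L n q₀ ε)) := by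
    have hcard : (nthRootsFinset m (1 : K)).card = m := by
      have : NeZero (m : K) := ⟨hm⟩
      obtain ⟨ζ, hζ⟩ := HasEnoughRootsOfUnity.exists_primitiveRoot K m
      exact hζ.card_nthRootsFinset
    refine (hfm.map φ).eq_prod_X_sub_C_of_injOn ?_ ?_ ?_
    · rw [hcard, hfm.natDegree_map, hfd]
    · intro ε hε ε' hε' h
      exact hconj ε ε' ((Polynomial.mem_nthRootsFinset hm0 _).1 hε)
        ((Polynomial.mem_nthRootsFinset hm0 _).1 hε') h
    · intro ε hε
      have hε' := (Polynomial.mem_nthRootsFinset hm0 _).1 hε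
      obtain ⟨η, rfl⟩ := hunit ε hε'
      rw [IsRoot.def, eval_map, ← rescaleHom_eq_conjSeries, ← hσφ η hε', ← Polynomial.hom_eval₂,
        hfq, map_zero]
  -- the polynomial `t ^ d` has order `-d`
  set d := Nat.gcd m n with hd
  obtain ⟨G', hG'⟩ : ∃ G' : K[X][X], G'.eval₂ (compRingHom P) Q = X := by
    refine ⟨MvPolynomial.aeval ![C X, X] G, ?_⟩
    have : (eval₂RingHom (compRingHom P) Q).comp
        (MvPolynomial.aeval (R := K) ![(C X : K[X][X]), X]).toRingHom =
        (MvPolynomial.aeval (R := K) ![P, Q]).toRingHom := by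
      refine MvPolynomial.ringHom_ext ?_ ?_
      · intro a
        simp [Polynomial.algebraMap_apply]
      · intro i
        fin_cases i <;> simp
    exact (DFunLike.congr_fun this G).trans hG
  set h := G' ^ d %ₘ f with hh
  have hf1 : f ≠ 1 := by
    rintro rfl
    simp at hfd
    omega
  have heval : h.eval₂ (compRingHom P) Q = X ^ d := by
    rw [hh, eval₂_modByMonic_eq_self_of_root hf0, eval₂_pow, hG']
  have hhd : h.natDegree < m := by
    rw [← hmdef] at hfd
    rw [← hfd]
    exact natDegree_modByMonic_lt _ hfm hf1
  have hh0 : h ≠ 0 := by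
    intro h0
    rw [h0, eval₂_zero] at heval
    exact pow_ne_zero d X_ne_zero heval.symm
  obtain ⟨s, w, hw, hs, hsw⟩ := exists_semigroup_order hφ hφC hm hq₀ hfm hfd hfprod
    (fun ε hε => hconj ε 1 hε (one_pow m)) hh0 hhd
  rw [← hq, ← hevcomp, ← hevQ, ← Polynomial.hom_eval₂, heval] at hsw
  have hsd : s = -d := by
    have h1 : HasInit (C (unif K L ^ s * algebraMap _ L w)) s
        (C (PowerSeries.constantCoeff w)) := ⟨C w, by simp, by simp⟩
    have h2 : HasInit (C (unif K L ^ s * algebraMap _ L w)) (-d)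
        (C (PowerSeries.constantCoeff v ^ d)) := by
      refine ⟨C (v ^ d), ?_, by simp⟩
      rw [← hsw, map_pow, hev, coe_eval₂RingHom, eval₂_X, hθ, mul_pow, ← zpow_natCast, ← zpow_mul]
      simp
    exact h1.exponent_eq h2 (by simpa using hw) (by simpa using fun h => absurd h hv0)
  obtain ⟨a, b, hab⟩ := hs (by rw [hsd]; exact (dvd_refl _).neg_right)
  rw [hsd, neg_neg] at hab
  have hab' : d = a * m + b * n := by exact_mod_cast hab
  have hdm : d ∣ m := Nat.gcd_dvd_left m n
  have hdn : d ∣ n := Nat.gcd_dvd_right m n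
  have hd0 : 0 < d := Nat.gcd_pos_of_pos_left _ hm0
  rcases Nat.eq_zero_or_pos a with rfl | ha
  · right
    have : d = n := by
      refine le_antisymm (Nat.le_of_dvd hn hdn) ?_
      rcases Nat.eq_zero_or_pos b with rfl | hb
      · omega
      · nlinarith
    exact this ▸ hdm
  · left
    have : d = m := by
      refine le_antisymm (Nat.le_of_dvd hm0 hdm) ?_
      nlinarith
    exact this ▸ hdn

end Conclusion

end AbhyankarMoh

/-- The Abhyankar–Moh Embedding Line Theorem: if `F = (P, Q) : K → K²` is a polynomial
embedding (i.e. there is `G ∈ K[x,y]` with `G(P(t), Q(t)) = t`), `m = deg P`,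
`n = deg Q > 0`, and `char K` does not divide `gcd(m,n)`, then `m ∣ n` or `n ∣ m`. -/
theorem abhyankar_moh_embedding_line (K : Type*) [Field K] [IsAlgClosed K]
    (P Q : Polynomial K) (G : MvPolynomial (Fin 2) K)
    (hG : MvPolynomial.aeval (fun i : Fin 2 => if i = 0 then P else Q) G =
      (Polynomial.X : Polynomial K))
    (m n : ℕ) (hm : m = P.natDegree) (hn : n = Q.natDegree) (hn0 : 0 < n)
    (hchar : ¬ (ringChar K ∣ Nat.gcd m n)) :
    m ∣ n ∨ n ∣ m := by
  have hPQ : (fun i : Fin 2 => if i = 0 then P else Q) = ![P, Q] := by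
    ext1 i
    fin_cases i <;> rfl
  rw [hPQ] at hG
  rcases Nat.eq_zero_or_pos m with h0 | h0
  · exact Or.inr (h0 ▸ dvd_zero n)
  by_cases hmK : (m : K) = 0
  · have hnK : (n : K) ≠ 0 := by
      intro hnK
      exact hchar (Nat.dvd_gcd ((ringChar.spec K m).1 hmK) ((ringChar.spec K n).1 hnK))
    have hG' : MvPolynomial.aeval ![Q, P] (MvPolynomial.rename (Equiv.swap 0 1) G) =
        (Polynomial.X : Polynomial K) := by
      rw [MvPolynomial.aeval_rename, ← hG]
      congr 2
      ext1 i
      fin_cases i <;> rfl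
    subst hm hn
    exact (natDegree_dvd_of_natCast_ne_zero hnK h0 _ hG').symm
  · subst hm hn
    exact natDegree_dvd_of_natCast_ne_zero hmK hn0 G hG
end

section
/- (Jung–van der Kulk) Let K be an algebraically closed field and let (P, Q) : K² → K² be a polynomial automorphism, i.e. P, Q ∈ K[x,y] and there exist polynomials P', Q' ∈ K[x,y] with P'(P(x,y), Q(x,y)) = x and Q'(P(x,y), Q(x,y)) = y. Then of the two integers m = deg P and n = deg Q, one divides the other. -/
open MvPolynomial

namespace JungVanDerKulk

section Low

variable {σ K : Type*} [Field K]

/-- The polynomials all of whose monomials have total degree less than `N`. -/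
def low (σ K : Type*) [Field K] (N : ℕ) : Submodule K (MvPolynomial σ K) where
  carrier := {f | f = 0 ∨ f.totalDegree < N}
  zero_mem' := Or.inl rfl
  add_mem' := by
    rintro f g (rfl | hf) (rfl | hg)
    · simp
    · simp [hg]
    · simp [hf]
    · exact Or.inr ((totalDegree_add f g).trans_lt (max_lt hf hg))
  smul_mem' := by
    rintro c f (rfl | hf)
    · simp
    · exact Or.inr ((totalDegree_smul_le c f).trans_lt hf)

theorem mem_low {N : ℕ} {f : MvPolynomial σ K} : f ∈ low σ K N ↔ f = 0 ∨ f.totalDegree < N :=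
  Iff.rfl

theorem mem_low_iff {N : ℕ} {f : MvPolynomial σ K} (hf : f ≠ 0) :
    f ∈ low σ K N ↔ f.totalDegree < N := by
  simp [mem_low, hf]

theorem low_mono {M N : ℕ} (h : M ≤ N) {f : MvPolynomial σ K} (hf : f ∈ low σ K M) :
    f ∈ low σ K N :=
  hf.imp_right fun h' => h'.trans_le h

theorem mem_low_succ {N : ℕ} {f : MvPolynomial σ K} :
    f ∈ low σ K (N + 1) ↔ f.totalDegree ≤ N := by
  rw [mem_low, Nat.lt_succ_iff, or_iff_right_iff_imp]
  rintro rfl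
  simp

theorem eq_zero_of_mem_low_zero {f : MvPolynomial σ K} (hf : f ∈ low σ K 0) : f = 0 := by
  simpa [mem_low] using hf

theorem mul_mem_low {a b : ℕ} {f g : MvPolynomial σ K} (hf : f.totalDegree ≤ a)
    (hg : g ∈ low σ K b) : f * g ∈ low σ K (a + b) := by
  rcases hg with rfl | hg
  · simp
  · exact Or.inr ((totalDegree_mul f g).trans_lt (by omega))

theorem C_mul_mem_low {N : ℕ} {f : MvPolynomial σ K} (c : K) (hf : f ∈ low σ K N) :
    C c * f ∈ low σ K N := by
  rw [C_mul']
  exact Submodule.smul_mem _ c hf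

theorem mem_low_of_mul_mem {b : ℕ} {f g : MvPolynomial σ K} (hf : f ≠ 0)
    (h : f * g ∈ low σ K (f.totalDegree + b)) : g ∈ low σ K b := by
  by_cases hg : g = 0
  · exact Or.inl hg
  · rw [mem_low_iff (mul_ne_zero hf hg), totalDegree_mul_of_isDomain hf hg] at h
    exact Or.inr (by omega)

theorem totalDegree_pow_of_ne_zero {f : MvPolynomial σ K} (hf : f ≠ 0) (n : ℕ) :
    (f ^ n).totalDegree = n * f.totalDegree := by
  induction n with
  | zero => simp
  | succ n ih =>
    rw [pow_succ, totalDegree_mul_of_isDomain (pow_ne_zero n hf) hf, ih]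
    ring

theorem pderiv_mem_low {N : ℕ} {f : MvPolynomial σ K} (i : σ) (hf : f.totalDegree ≤ N) :
    pderiv i f ∈ low σ K N := by
  rw [f.as_sum, map_sum]
  refine Submodule.sum_mem _ fun m hm => ?_
  rw [pderiv_monomial]
  by_cases hmi : m i = 0
  · simp [hmi]
  · refine Or.inr ((totalDegree_monomial_le _ _).trans_lt ?_)
    have h₁ : m - Finsupp.single i 1 + Finsupp.single i 1 = m :=
      tsub_add_cancel_of_le (by simpa [Nat.one_le_iff_ne_zero] using hmi)
    have h₂ := congrArg (fun m => m.degree) h₁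
    simp only [map_add, Finsupp.degree_single] at h₂
    have h₃ : m.degree ≤ f.totalDegree := le_totalDegree hm
    change (m - Finsupp.single i 1).degree < N
    omega

/-- Two nonzero polynomials of the same total degree whose leading forms are proportional. -/
def Sim (f g : MvPolynomial σ K) : Prop :=
  f ≠ 0 ∧ g ≠ 0 ∧ f.totalDegree = g.totalDegree ∧
    ∃ c : K, c ≠ 0 ∧ f - C c * g ∈ low σ K f.totalDegree

namespace Sim

variable {f g h f' g' : MvPolynomial σ K}

theorem refl (hf : f ≠ 0) : Sim f f :=
  ⟨hf, hf, rfl, 1, one_ne_zero, by simp⟩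

theorem symm (h : Sim f g) : Sim g f := by
  obtain ⟨hf, hg, hd, c, hc, hl⟩ := h
  refine ⟨hg, hf, hd.symm, c⁻¹, inv_ne_zero hc, ?_⟩
  have : g - C c⁻¹ * f = C (-c⁻¹) * (f - C c * g) := by
    have : C c⁻¹ * C c = (1 : MvPolynomial σ K) := by rw [← C_mul, inv_mul_cancel₀ hc, C_1]
    rw [C_neg]
    linear_combination (-g) * this
  rw [this, ← hd]
  exact C_mul_mem_low _ hl

theorem trans (h₁ : Sim f g) (h₂ : Sim g h) : Sim f h := by
  obtain ⟨hf, hg, hd, c, hc, hl⟩ := h₁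
  obtain ⟨-, hh, hd', c', hc', hl'⟩ := h₂
  refine ⟨hf, hh, hd.trans hd', c * c', mul_ne_zero hc hc', ?_⟩
  have : f - C (c * c') * h = (f - C c * g) + C c * (g - C c' * h) := by
    rw [C_mul]
    ring
  rw [this]
  exact Submodule.add_mem _ hl (C_mul_mem_low _ (hd ▸ hl'))

theorem of_sub_mem_low {c : K} (hc : c ≠ 0) (hg : g ≠ 0)
    (h : f - C c * g ∈ low σ K g.totalDegree) : Sim f g := by
  have hcg : C c * g ≠ 0 := mul_ne_zero (by simpa using hc) hg
  have hd : (C c * g).totalDegree = g.totalDegree := by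
    rw [totalDegree_mul_of_isDomain (left_ne_zero_of_mul hcg) hg, totalDegree_C, zero_add]
  have hfg : f.totalDegree = g.totalDegree := by
    rcases h with h | h
    · rw [sub_eq_zero.1 h, hd]
    · rw [← hd] at h ⊢
      rw [← totalDegree_add_eq_right_of_totalDegree_lt h, sub_add_cancel]
  refine ⟨?_, hg, hfg, c, hc, hfg.symm ▸ h⟩
  rintro rfl
  rw [zero_sub, mem_low_iff (neg_ne_zero.2 hcg), totalDegree_neg, hd] at h
  exact lt_irrefl _ h

theorem mul (h₁ : Sim f g) (h₂ : Sim f' g') : Sim (f * f') (g * g') := by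
  obtain ⟨hf, hg, hd, c, hc, hl⟩ := h₁
  obtain ⟨hf', hg', hd', c', hc', hl'⟩ := h₂
  refine ⟨mul_ne_zero hf hf', mul_ne_zero hg hg', ?_, c * c', mul_ne_zero hc hc', ?_⟩
  · rw [totalDegree_mul_of_isDomain hf hf', totalDegree_mul_of_isDomain hg hg', hd, hd']
  have : f * f' - C (c * c') * (g * g') = f' * (f - C c * g) + C c * (g * (f' - C c' * g')) := by
    rw [C_mul]
    ring
  rw [this, totalDegree_mul_of_isDomain hf hf']
  refine Submodule.add_mem _ ?_ (C_mul_mem_low _ (mul_mem_low hd.ge hl'))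
  rw [add_comm]
  exact mul_mem_low le_rfl hl

theorem pow (h : Sim f g) (n : ℕ) : Sim (f ^ n) (g ^ n) := by
  induction n with
  | zero => simpa using refl one_ne_zero
  | succ n ih => simpa only [pow_succ] using ih.mul h

end Sim

/-- If a binary form in `z` and `w` drops degree, the leading forms of `z` and `w` are
proportional. -/
theorem exists_sub_mem_low_of_homogenize [IsAlgClosed K] {z w : MvPolynomial σ K} {e : ℕ}
    (hw : w.totalDegree = e) (hw0 : w ≠ 0) (N : ℕ)
    (p : Polynomial K) (hp : p ≠ 0) (hN : p.natDegree ≤ N)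
    (h : aeval ![z, w] (p.homogenize N) ∈ low σ K (N * e)) :
    ∃ c : K, z - C c * w ∈ low σ K e := by
  induction N generalizing p with
  | zero =>
    rw [Polynomial.eq_C_of_natDegree_le_zero hN] at h hp
    rw [zero_mul] at h
    have := eq_zero_of_mem_low_zero h
    simp_all [algebraMap_eq]
  | succ N ih =>
    by_cases hdeg : p.degree = 0
    · rw [Polynomial.eq_C_of_degree_eq_zero hdeg] at h hp
      have hc : (C (p.coeff 0) : MvPolynomial σ K) ≠ 0 := by simpa using hp
      simp only [Polynomial.homogenize_C, map_mul, map_pow, aeval_C, aeval_X, algebraMap_eq,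
        Matrix.cons_val_one, Matrix.cons_val_fin_one] at h
      rw [mem_low_iff (mul_ne_zero hc (pow_ne_zero _ hw0)),
        totalDegree_mul_of_isDomain hc (pow_ne_zero _ hw0)] at h
      simp [totalDegree_pow_of_ne_zero hw0, hw] at h
    · obtain ⟨c, hc⟩ := IsAlgClosed.exists_root p hdeg
      obtain ⟨q, rfl⟩ := Polynomial.dvd_iff_isRoot.2 hc
      have hq : q ≠ 0 := right_ne_zero_of_mul hp
      have hqN : q.natDegree ≤ N := by
        rw [Polynomial.natDegree_mul (Polynomial.X_sub_C_ne_zero c) hq,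
          Polynomial.natDegree_X_sub_C] at hN
        omega
      rw [add_comm N 1, Polynomial.homogenize_mul _ _ (by simp) hqN, map_mul] at h
      have hlin : aeval ![z, w] (Polynomial.homogenize (Polynomial.X - Polynomial.C c) 1) =
          z - C c * w := by
        rw [sub_eq_add_neg, ← Polynomial.C_neg, Polynomial.homogenize_add]
        simp [algebraMap_eq, sub_eq_add_neg]
      rw [hlin] at h
      by_cases hl : z - C c * w ∈ low σ K e
      · exact ⟨c, hl⟩
      · refine ih q hq hqN ?_
        have h0 : z - C c * w ≠ 0 := fun h0 => hl (Or.inl h0)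
        rw [mem_low_iff h0] at hl
        refine mem_low_of_mul_mem h0 (low_mono ?_ h)
        nlinarith

end Low

section Bracket

variable {K : Type*} [Field K]

/-- The Jacobian determinant of two polynomials in two variables. -/
noncomputable def bracket (f g : MvPolynomial (Fin 2) K) : MvPolynomial (Fin 2) K :=
  pderiv 0 f * pderiv 1 g - pderiv 1 f * pderiv 0 g

theorem bracket_antisymm (f g : MvPolynomial (Fin 2) K) : bracket f g = -bracket g f := by
  unfold bracket
  ring

theorem bracket_self (f : MvPolynomial (Fin 2) K) : bracket f f = 0 := by
  unfold bracket
  ring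

theorem bracket_C_left (c : K) (g : MvPolynomial (Fin 2) K) : bracket (C c) g = 0 := by
  simp [bracket]

theorem bracket_add_left (f₁ f₂ g : MvPolynomial (Fin 2) K) :
    bracket (f₁ + f₂) g = bracket f₁ g + bracket f₂ g := by
  simp only [bracket, map_add]
  ring

theorem bracket_mul_left (f₁ f₂ g : MvPolynomial (Fin 2) K) :
    bracket (f₁ * f₂) g = f₁ * bracket f₂ g + f₂ * bracket f₁ g := by
  simp only [bracket, pderiv_mul]
  ring

theorem bracket_pow_sub_C_mul (h f w : MvPolynomial (Fin 2) K) (n : ℕ) (c : K) :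
    bracket h (f ^ n - C c * w) =
      (n : MvPolynomial (Fin 2) K) * f ^ (n - 1) * bracket h f - C c * bracket h w := by
  simp only [bracket, map_sub, pderiv_pow, pderiv_C_mul]
  ring

theorem bracket_mem_low (f g : MvPolynomial (Fin 2) K) :
    bracket f g ∈ low (Fin 2) K (f.totalDegree + g.totalDegree - 1) := by
  have key (i j : Fin 2) :
      pderiv i f * pderiv j g ∈ low (Fin 2) K (f.totalDegree + g.totalDegree - 1) := by
    rcases pderiv_mem_low i (le_refl f.totalDegree) with h | h
    · simp [h]
    · rw [show f.totalDegree + g.totalDegree - 1 = (f.totalDegree - 1) + g.totalDegree by omega]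
      exact mul_mem_low (by omega) (pderiv_mem_low j le_rfl)
  exact Submodule.sub_mem _ (key 0 1) (key 1 0)

/-- The bracket of two polynomials in `P` and `Q` is divisible by the bracket of `P` and `Q`. -/
theorem bracket_dvd_bracket_aeval (v : Fin 2 → MvPolynomial (Fin 2) K)
    (p q : MvPolynomial (Fin 2) K) :
    bracket (v 0) (v 1) ∣ bracket (aeval v p) (aeval v q) := by
  have key (g : MvPolynomial (Fin 2) K) (hg : ∀ i, bracket (v 0) (v 1) ∣ bracket (v i) g)
      (p : MvPolynomial (Fin 2) K) : bracket (v 0) (v 1) ∣ bracket (aeval v p) g := by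
    induction p using MvPolynomial.induction_on with
    | C c => simp [algebraMap_eq, bracket_C_left]
    | add p q hp hq =>
      rw [map_add, bracket_add_left]
      exact dvd_add hp hq
    | mul_X p i hp =>
      rw [map_mul, aeval_X, bracket_mul_left]
      exact dvd_add ((hg i).mul_left _) (hp.mul_left _)
  refine key _ (fun i => ?_) p
  rw [bracket_antisymm (v i), dvd_neg]
  refine key _ (fun j => ?_) q
  fin_cases i <;> fin_cases j <;> simp [bracket_self]
  rw [bracket_antisymm (v 1), dvd_neg]

theorem isUnit_bracket (v : Fin 2 → MvPolynomial (Fin 2) K) (p q : MvPolynomial (Fin 2) K)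
    (hp : aeval v p = X 0) (hq : aeval v q = X 1) : IsUnit (bracket (v 0) (v 1)) := by
  have := bracket_dvd_bracket_aeval v p q
  rw [hp, hq] at this
  simpa [bracket, isUnit_iff_dvd_one, pderiv_X] using this

/-- The polynomials `u` for which `P * bracket u f` has the same leading form as
`(u.totalDegree / d) * u * τ`. -/
def logBracket (P f τ : MvPolynomial (Fin 2) K) (d : ℕ) (hd : 0 < d) :
    Submonoid (MvPolynomial (Fin 2) K) where
  carrier := {u | u ≠ 0 ∧ d ∣ u.totalDegree ∧
    P * bracket u f - ((u.totalDegree / d : ℕ) : MvPolynomial (Fin 2) K) * (u * τ) ∈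
      low (Fin 2) K (u.totalDegree + τ.totalDegree)}
  one_mem' := by
    have : bracket 1 f = 0 := by simpa using bracket_C_left 1 f
    simp [this]
  mul_mem' := by
    rintro u v ⟨hu, ⟨a, ha⟩, hul⟩ ⟨hv, ⟨b, hb⟩, hvl⟩
    have hdeg : (u * v).totalDegree = d * (a + b) := by
      rw [totalDegree_mul_of_isDomain hu hv, ha, hb, mul_add]
    refine ⟨mul_ne_zero hu hv, hdeg ▸ dvd_mul_right _ _, ?_⟩
    rw [ha, Nat.mul_div_cancel_left _ hd] at hul
    rw [hb, Nat.mul_div_cancel_left _ hd] at hvl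
    rw [hdeg, Nat.mul_div_cancel_left _ hd, bracket_mul_left]
    have h : P * (u * bracket v f + v * bracket u f) -
        ((a + b : ℕ) : MvPolynomial (Fin 2) K) * (u * v * τ) =
        u * (P * bracket v f - b * (v * τ)) + v * (P * bracket u f - a * (u * τ)) := by
      push_cast
      ring
    rw [h]
    refine Submodule.add_mem _ (low_mono ?_ (mul_mem_low ha.le hvl))
      (low_mono ?_ (mul_mem_low hb.le hul)) <;> linarith

/-- The polynomials `u` whose bracket with `t`, multiplied by `h`, has total degree less than
`u.totalDegree + t.totalDegree + T`. -/
def smallBracket (h t : MvPolynomial (Fin 2) K) (T : ℕ) :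
    Submonoid (MvPolynomial (Fin 2) K) where
  carrier := {u | u ≠ 0 ∧ h * bracket u t ∈ low (Fin 2) K (u.totalDegree + t.totalDegree + T)}
  one_mem' := by
    have : bracket 1 t = 0 := by simpa using bracket_C_left 1 t
    simp [this]
  mul_mem' := by
    rintro u v ⟨hu, hul⟩ ⟨hv, hvl⟩
    refine ⟨mul_ne_zero hu hv, ?_⟩
    rw [totalDegree_mul_of_isDomain hu hv, bracket_mul_left]
    have e : h * (u * bracket v t + v * bracket u t) =
        u * (h * bracket v t) + v * (h * bracket u t) := by ring
    rw [e]
    refine Submodule.add_mem _ (low_mono ?_ (mul_mem_low le_rfl hvl))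
      (low_mono ?_ (mul_mem_low le_rfl hul)) <;> linarith

theorem mem_smallBracket_comm {h t u : MvPolynomial (Fin 2) K} {T : ℕ} (ht : t ≠ 0)
    (hu : u ∈ smallBracket h t T) : t ∈ smallBracket h u T := by
  refine ⟨ht, ?_⟩
  rw [bracket_antisymm, mul_neg, add_comm t.totalDegree]
  exact Submodule.neg_mem _ hu.2

end Bracket

section Stage

variable {K : Type*} [Field K]

/-- Substitution of two polynomials for the variables of `K[X][Y]`. -/
noncomputable def subst (P Q : MvPolynomial (Fin 2) K) :
    Polynomial (Polynomial K) →+* MvPolynomial (Fin 2) K :=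
  Polynomial.eval₂RingHom (Polynomial.aeval P : Polynomial K →ₐ[K] MvPolynomial (Fin 2) K) Q

@[simp]
theorem subst_C (P Q : MvPolynomial (Fin 2) K) (p : Polynomial K) :
    subst P Q (Polynomial.C p) = Polynomial.aeval P p := by
  simp [subst]

@[simp]
theorem subst_X (P Q : MvPolynomial (Fin 2) K) : subst P Q Polynomial.X = Q := by
  simp [subst]

theorem subst_C_C (P Q : MvPolynomial (Fin 2) K) (c : K) :
    subst P Q (Polynomial.C (Polynomial.C c)) = C c := by
  simp [algebraMap_eq]

/-- A step of the construction of key polynomials of the degree function on `K[P, Q]`. The monoid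
`S` is generated by the previous key polynomials, `F` is the current one, as a polynomial in `P` and
`Q`, and `d` is the greatest common divisor of the degrees of elements of `S`. -/
structure Stage (P Q : MvPolynomial (Fin 2) K) (S : Submonoid (MvPolynomial (Fin 2) K))
    (F : Polynomial (Polynomial K)) (τ : MvPolynomial (Fin 2) K) (d : ℕ) : Prop where
  monic : F.Monic
  ne_zero : τ ≠ 0
  pos : 0 < d
  le_logBracket : S ≤ logBracket P (subst P Q F) τ d pos
  le_smallBracket : ∀ t ∈ S, S ≤ smallBracket (subst P Q F * P) t τ.totalDegree
  sim : ∀ s ∈ S, ∀ t ∈ S, s.totalDegree = t.totalDegree → Sim s t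
  totalDegree_ne_one : ∀ s ∈ S, s.totalDegree ≠ 1
  exists_sim : ∀ V : Polynomial (Polynomial K), V ≠ 0 → V.degree < F.degree →
    ∃ s ∈ S, Sim (subst P Q V) s
  exists_mem : ∀ D : ℤ, (d : ℤ) ∣ D → (τ.totalDegree : ℤ) < D + P.totalDegree →
    ∃ W : Polynomial (Polynomial K), W.degree < F.degree ∧ subst P Q W ∈ S ∧
      ((subst P Q W).totalDegree : ℤ) = D

/-- The multiplicity with which the degree of the current key polynomial `f` has to be taken to
become divisible by `d`. -/
noncomputable def ramification (d : ℕ) (f : MvPolynomial (Fin 2) K) : ℕ :=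
  d / Nat.gcd d f.totalDegree

theorem dvd_of_dvd_mul {d k e : ℕ} (hd : 0 < d) (h : d ∣ k * e) : d / Nat.gcd d e ∣ k := by
  have hg : 0 < Nat.gcd d e := Nat.gcd_pos_of_pos_left _ hd
  refine (Nat.coprime_div_gcd_div_gcd hg).dvd_of_dvd_mul_right ?_
  rw [← Nat.mul_div_assoc _ (Nat.gcd_dvd_right d e)]
  exact Nat.div_dvd_div (Nat.gcd_dvd_left d e) h

theorem dvd_sub_of_add_mul_eq {d a b i j e : ℕ} (hd : 0 < d) (ha : d ∣ a) (hb : d ∣ b)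
    (hij : j ≤ i) (h : a + i * e = b + j * e) : d / Nat.gcd d e ∣ i - j := by
  refine dvd_of_dvd_mul hd ?_
  have : b = a + (i - j) * e := by
    rw [Nat.sub_mul]
    have := Nat.mul_le_mul_right e hij
    omega
  exact (Nat.dvd_add_right ha).1 (this ▸ hb)

theorem ramification_pos {d : ℕ} (hd : 0 < d) (f : MvPolynomial (Fin 2) K) :
    0 < ramification d f :=
  Nat.div_pos (Nat.gcd_le_left _ hd) (Nat.gcd_pos_of_pos_left _ hd)

theorem gcd_mul_ramification (d : ℕ) (f : MvPolynomial (Fin 2) K) :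
    Nat.gcd d f.totalDegree * ramification d f = d :=
  Nat.mul_div_cancel' (Nat.gcd_dvd_left _ _)

theorem dvd_ramification_mul (d : ℕ) (f : MvPolynomial (Fin 2) K) :
    d ∣ ramification d f * f.totalDegree := by
  obtain ⟨e, he⟩ := Nat.gcd_dvd_right d f.totalDegree
  refine ⟨e, ?_⟩
  conv_rhs => rw [← gcd_mul_ramification d f]
  conv_lhs => rw [he]
  ring

theorem exists_dvd_sub_mul {d : ℕ} (hd : 0 < d) (e : ℕ) {D : ℤ} (hD : ((Nat.gcd d e : ℕ) : ℤ) ∣ D) :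
    ∃ k < d / Nat.gcd d e, (d : ℤ) ∣ D - k * e := by
  obtain ⟨D, rfl⟩ := hD
  have hn : 0 < d / Nat.gcd d e :=
    Nat.div_pos (Nat.gcd_le_left _ hd) (Nat.gcd_pos_of_pos_left _ hd)
  have hdn : (d : ℤ) ∣ ((d / Nat.gcd d e : ℕ) : ℤ) * e := by
    obtain ⟨q, hq⟩ := Nat.gcd_dvd_right d e
    refine ⟨q, ?_⟩
    have : d / Nat.gcd d e * e = d * q :=
      calc d / Nat.gcd d e * e = d / Nat.gcd d e * (Nat.gcd d e * q) := congrArg _ hq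
        _ = d * q := by rw [← mul_assoc, Nat.div_mul_cancel (Nat.gcd_dvd_left d e)]
    exact_mod_cast this
  set n := d / Nat.gcd d e
  have hn' : (0 : ℤ) < n := by exact_mod_cast hn
  obtain ⟨k, hk⟩ := Int.eq_ofNat_of_zero_le (Int.emod_nonneg (D * Nat.gcdB d e) hn'.ne')
  have hlt := Int.emod_lt_of_pos (D * Nat.gcdB d e) hn'
  refine ⟨k, by omega, ?_⟩
  have h₁ := Int.emod_add_mul_ediv (D * Nat.gcdB d e) n
  rw [hk] at h₁
  have h₂ : (Nat.gcd d e : ℤ) * D - k * e =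
      d * (Nat.gcdA d e * D) + n * e * (D * Nat.gcdB d e / n) := by
    rw [Nat.gcd_eq_gcd_ab]
    linear_combination (-(e : ℤ)) * h₁
  rw [h₂]
  exact dvd_add (dvd_mul_right _ _) (hdn.mul_right _)

/-- Expansion of a polynomial in powers of a monic polynomial. -/
theorem exists_expansion {R : Type*} [CommRing R] [Nontrivial R] {F : Polynomial R} (hF : F.Monic)
    (N : ℕ) (G : Polynomial R) (hG : G.degree < N * F.natDegree) :
    ∃ V : ℕ → Polynomial R, (∀ k, (V k).degree < F.degree) ∧
      G = ∑ k ∈ Finset.range N, V k * F ^ k := by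
  induction N generalizing G with
  | zero =>
    refine ⟨0, fun k => ?_, ?_⟩
    · simpa [bot_lt_iff_ne_bot] using hF.ne_zero
    · simpa using hG
  | succ N ih =>
    have hq : (G /ₘ F).degree < N * F.natDegree := by
      by_cases hq0 : G /ₘ F = 0
      · rw [hq0, Polynomial.degree_zero, bot_lt_iff_ne_bot]
        exact_mod_cast WithBot.coe_ne_bot
      have hG0 : G ≠ 0 := by
        rintro rfl
        simp at hq0
      have := Polynomial.natDegree_divByMonic G hF
      have hle : F.degree ≤ G.degree := by
        by_contra h
        exact hq0 ((Polynomial.divByMonic_eq_zero_iff hF).2 (not_le.1 h))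
      have hle' := Polynomial.natDegree_le_natDegree hle
      rw [Polynomial.degree_eq_natDegree hG0] at hG
      rw [Polynomial.degree_eq_natDegree hq0, this]
      norm_cast at hG ⊢
      rw [Nat.succ_mul] at hG
      omega
    obtain ⟨V, hV, hsum⟩ := ih _ hq
    refine ⟨fun k => k.casesOn (G %ₘ F) V, fun k => ?_, ?_⟩
    · cases k
      · exact Polynomial.degree_modByMonic_lt _ hF
      · exact hV _
    · rw [Finset.sum_range_succ']
      conv_lhs => rw [← Polynomial.modByMonic_add_div G F, hsum]
      simp only [pow_succ, pow_zero, mul_one, Finset.mul_sum]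
      rw [add_comm]
      congr 1
      exact Finset.sum_congr rfl fun k _ => by ring

/-- In a finite sum which is not identically zero, only the terms of maximal degree matter. -/
theorem exists_max_totalDegree {σ ι : Type*} (s : Finset ι) (t : ι → MvPolynomial σ K)
    (h : ∃ i ∈ s, t i ≠ 0) :
    ∃ i ∈ s, t i ≠ 0 ∧ ∀ j ∈ s, t j ∈ low σ K ((t i).totalDegree + 1) := by
  classical
  obtain ⟨i, hi, hmax⟩ := (s.filter fun i => t i ≠ 0).exists_max_image
    (fun i => (t i).totalDegree) (by simpa [Finset.Nonempty] using h)
  rw [Finset.mem_filter] at hi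
  refine ⟨i, hi.1, hi.2, fun j hj => ?_⟩
  by_cases h0 : t j = 0
  · exact Or.inl h0
  · exact mem_low_succ.2 (hmax j (Finset.mem_filter.2 ⟨hj, h0⟩))

namespace Stage

variable {P Q τ : MvPolynomial (Fin 2) K} {S : Submonoid (MvPolynomial (Fin 2) K)}
  {F : Polynomial (Polynomial K)} {d : ℕ}

theorem mem_ne_zero (h : Stage P Q S F τ d) {s : MvPolynomial (Fin 2) K} (hs : s ∈ S) : s ≠ 0 :=
  (h.le_logBracket hs).1

theorem dvd_totalDegree (h : Stage P Q S F τ d) {s : MvPolynomial (Fin 2) K} (hs : s ∈ S) :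
    d ∣ s.totalDegree :=
  (h.le_logBracket hs).2.1

/-- The lower bound for the degree of a key polynomial given by the Jacobian. -/
theorem lower_bound (h : Stage P Q S F τ d) :
    τ.totalDegree + 2 ≤ P.totalDegree + (subst P Q F).totalDegree := by
  set f := subst P Q F
  obtain ⟨s, hs, hne⟩ : ∃ s ∈ S, ((s.totalDegree / d : ℕ) : K) ≠ 0 := by
    have hd : (0 : ℤ) < d := by exact_mod_cast h.pos
    have key (k : ℕ) (hk : τ.totalDegree < k) : ∃ s ∈ S, s.totalDegree / d = k := by
      obtain ⟨W, -, hW, hdeg⟩ := h.exists_mem (d * k) (dvd_mul_right _ _) (by nlinarith)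
      refine ⟨_, hW, ?_⟩
      rw [show (subst P Q W).totalDegree = d * k by exact_mod_cast hdeg,
        Nat.mul_div_cancel_left _ h.pos]
    obtain ⟨s, hs, hsk⟩ := key (τ.totalDegree + 1) (by omega)
    obtain ⟨t, ht, htk⟩ := key (τ.totalDegree + 2) (by omega)
    by_cases h0 : ((τ.totalDegree + 1 : ℕ) : K) = 0
    · refine ⟨t, ht, ?_⟩
      rw [htk, show τ.totalDegree + 2 = τ.totalDegree + 1 + 1 by ring, Nat.cast_succ, h0]
      simp
    · exact ⟨s, hs, hsk ▸ h0⟩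
  obtain ⟨hs0, -, hl⟩ := h.le_logBracket hs
  by_contra hlt
  have h₁ : P * bracket s f ∈ low (Fin 2) K (s.totalDegree + τ.totalDegree) := by
    rcases bracket_mem_low s f with h' | h'
    · simp [h']
    · exact low_mono (by omega) (mul_mem_low le_rfl (mem_low_succ.2 le_rfl))
  have h₂ := Submodule.sub_mem _ h₁ hl
  rw [sub_sub_cancel, ← map_natCast C] at h₂
  have hC : (C ((s.totalDegree / d : ℕ) : K) : MvPolynomial (Fin 2) K) ≠ 0 := by
    rwa [Ne, C_eq_zero]
  have hst := mul_ne_zero hs0 h.ne_zero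
  rw [mem_low_iff (mul_ne_zero hC hst), totalDegree_mul_of_isDomain hC hst,
    totalDegree_mul_of_isDomain hs0 h.ne_zero] at h₂
  omega

theorem totalDegree_subst_mul_pow (hf0 : subst P Q F ≠ 0) {V : Polynomial (Polynomial K)} {k : ℕ}
    (h : subst P Q V * subst P Q F ^ k ≠ 0) :
    (subst P Q V * subst P Q F ^ k).totalDegree =
      (subst P Q V).totalDegree + k * (subst P Q F).totalDegree := by
  rw [totalDegree_mul_of_isDomain (left_ne_zero_of_mul h) (right_ne_zero_of_mul h),
    totalDegree_pow_of_ne_zero hf0]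

theorem exists_sim_of_subst_ne_zero (h : Stage P Q S F τ d) {V : Polynomial (Polynomial K)}
    (hV : subst P Q V ≠ 0) (hdeg : V.degree < F.degree) : ∃ s ∈ S, Sim (subst P Q V) s :=
  h.exists_sim V (by rintro rfl; simp at hV) hdeg

/-- A polynomial of small degree in `Q` whose leading form is that of a suitable power of the
current key polynomial. -/
theorem exists_mem_ramification (h : Stage P Q S F τ d) :
    ∃ W : Polynomial (Polynomial K), W.degree < F.degree ∧ subst P Q W ∈ S ∧
      (subst P Q W).totalDegree = ramification d (subst P Q F) * (subst P Q F).totalDegree := by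
  have hlow := h.lower_bound
  set f := subst P Q F
  have hle : f.totalDegree ≤ ramification d f * f.totalDegree :=
    Nat.le_mul_of_pos_left _ (ramification_pos h.pos f)
  obtain ⟨W, hWF, hWS, hW⟩ := h.exists_mem ((ramification d f * f.totalDegree : ℕ) : ℤ)
    (by exact_mod_cast dvd_ramification_mul d f) (by exact_mod_cast (by omega))
  exact ⟨W, hWF, hWS, by exact_mod_cast hW⟩

/-- If a sum of terms has degree less than the maximal degree of the terms, then some power of the
current key polynomial has the same leading form as a product of previous ones. -/
theorem exists_relation [IsAlgClosed K] (h : Stage P Q S F τ d)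
    (hf0 : subst P Q F ≠ 0) (s : Finset ℕ) (V : ℕ → Polynomial (Polynomial K))
    (hV : ∀ k, (V k).degree < F.degree) (D : ℕ)
    (hmax : ∀ k ∈ s, subst P Q (V k) * subst P Q F ^ k ∈ low (Fin 2) K (D + 1))
    (hex : ∃ k ∈ s, subst P Q (V k) * subst P Q F ^ k ≠ 0 ∧
      (subst P Q (V k) * subst P Q F ^ k).totalDegree = D)
    (hsum : ∑ k ∈ s, subst P Q (V k) * subst P Q F ^ k ∈ low (Fin 2) K D) :
    ∃ (W : Polynomial (Polynomial K)) (c : K), W.degree < F.degree ∧ subst P Q W ∈ S ∧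
      (subst P Q W).totalDegree = ramification d (subst P Q F) * (subst P Q F).totalDegree ∧
      subst P Q F ^ ramification d (subst P Q F) - C c * subst P Q W ∈
        low (Fin 2) K (ramification d (subst P Q F) * (subst P Q F).totalDegree) := by
  classical
  obtain ⟨W, hWF, hWS, hW⟩ := h.exists_mem_ramification
  have hdeg (k : ℕ) := totalDegree_subst_mul_pow (V := V k) (k := k) hf0
  set f := subst P Q F
  set w := subst P Q W
  set n := ramification d f
  have hn : 0 < n := ramification_pos h.pos f
  set I := s.filter fun k => subst P Q (V k) * f ^ k ≠ 0 ∧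
    (subst P Q (V k) * f ^ k).totalDegree = D
  have hI : I.Nonempty := by
    obtain ⟨k, hk, hk'⟩ := hex
    exact ⟨k, Finset.mem_filter.2 ⟨hk, hk'⟩⟩
  have hsumI : ∑ k ∈ I, subst P Q (V k) * f ^ k ∈ low (Fin 2) K D := by
    rw [← Finset.sum_filter_add_sum_filter_not s fun k => subst P Q (V k) * f ^ k ≠ 0 ∧
      (subst P Q (V k) * f ^ k).totalDegree = D] at hsum
    refine (Submodule.add_mem_iff_left _ (Submodule.sum_mem _ fun k hk => ?_)).1 hsum
    rw [Finset.mem_filter] at hk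
    by_cases h0 : subst P Q (V k) * f ^ k = 0
    · exact Or.inl h0
    · have h₁ := mem_low_succ.1 (hmax k hk.1)
      have h₂ : (subst P Q (V k) * f ^ k).totalDegree ≠ D := fun h₂ => hk.2 ⟨h0, h₂⟩
      exact Or.inr (by omega)
  have hdegI : ∀ k ∈ I, (subst P Q (V k)).totalDegree + k * f.totalDegree = D := fun k hk => by
    obtain ⟨-, h₁, h₂⟩ := Finset.mem_filter.1 hk
    rw [← hdeg k h₁, h₂]
  have hsimI : ∀ k ∈ I, ∃ t ∈ S, Sim (subst P Q (V k)) t := fun k hk =>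
    h.exists_sim_of_subst_ne_zero (left_ne_zero_of_mul (Finset.mem_filter.1 hk).2.1) (hV k)
  have hdvd : ∀ k ∈ I, d ∣ (subst P Q (V k)).totalDegree := fun k hk => by
    obtain ⟨t, ht, hsim⟩ := hsimI k hk
    exact hsim.2.2.1 ▸ h.dvd_totalDegree ht
  set M := I.max' hI
  set m := I.min' hI
  have hM : M ∈ I := I.max'_mem hI
  have hm : m ∈ I := I.min'_mem hI
  have hj : ∀ k ∈ I, m + n * ((k - m) / n) = k := fun k hk => by
    have hle : m ≤ k := I.min'_le k hk
    have : n ∣ k - m := dvd_sub_of_add_mul_eq h.pos (hdvd k hk) (hdvd m hm) hle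
      ((hdegI k hk).trans (hdegI m hm).symm)
    rw [Nat.mul_div_cancel' this]
    omega
  set j : ℕ → ℕ := fun k => (k - m) / n
  have hjM : ∀ k ∈ I, j k ≤ j M := fun k hk =>
    Nat.div_le_div_right (Nat.sub_le_sub_right (I.le_max' k hk) _)
  have hDk : ∀ k ∈ I, k * f.totalDegree = m * f.totalDegree + j k * (n * f.totalDegree) :=
    fun k hk => by
      conv_lhs => rw [← hj k hk]
      ring
  obtain ⟨t, htS, ht⟩ := hsimI M hM
  have hcoeff : ∀ k ∈ I, ∃ c : K, c ≠ 0 ∧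
      subst P Q (V k) * f ^ k - t * f ^ m * (C c * (f ^ n) ^ j k * w ^ (j M - j k)) ∈
        low (Fin 2) K D := fun k hk => by
    obtain ⟨u, huS, hu⟩ := hsimI k hk
    have hsim : Sim (subst P Q (V k)) (t * w ^ (j M - j k)) := by
      refine hu.trans (h.sim _ huS _ (S.mul_mem htS (S.pow_mem hWS _)) ?_)
      rw [totalDegree_mul_of_isDomain (h.mem_ne_zero htS) (pow_ne_zero _ (h.mem_ne_zero hWS)),
        totalDegree_pow_of_ne_zero (h.mem_ne_zero hWS), ← hu.2.2.1, ← ht.2.2.1, hW]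
      have h₁ := hdegI k hk
      have h₂ := hdegI M hM
      rw [hDk k hk] at h₁
      rw [hDk M hM] at h₂
      rw [Nat.sub_mul]
      have := Nat.mul_le_mul_right (n * f.totalDegree) (hjM k hk)
      omega
    obtain ⟨-, -, -, c, hc, hl⟩ := hsim
    refine ⟨c, hc, ?_⟩
    have e : subst P Q (V k) * f ^ k - t * f ^ m * (C c * (f ^ n) ^ j k * w ^ (j M - j k)) =
        f ^ k * (subst P Q (V k) - C c * (t * w ^ (j M - j k))) := by
      conv_lhs => rw [← pow_mul]
      conv_rhs => rw [← hj k hk, pow_add]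
      conv_lhs => rw [← hj k hk, pow_add]
      simp only [hj k hk]
      ring
    rw [e, ← hdegI k hk, add_comm]
    exact mul_mem_low (totalDegree_pow_of_ne_zero hf0 k).le hl
  choose! c hc hcl using hcoeff
  set p : Polynomial K := ∑ k ∈ I, Polynomial.monomial (j k) (c k)
  have hp : aeval ![f ^ n, w] (p.homogenize (j M)) =
      ∑ k ∈ I, C (c k) * (f ^ n) ^ j k * w ^ (j M - j k) := by
    rw [Polynomial.homogenize_finsetSum, map_sum]
    refine Finset.sum_congr rfl fun k hk => ?_
    rw [← Polynomial.C_mul_X_pow_eq_monomial, Polynomial.homogenize_C_mul,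
      Polynomial.homogenize_X_pow (hjM k hk)]
    simp [algebraMap_eq, mul_assoc]
  have hp0 : p ≠ 0 := by
    have hpM : p.coeff (j M) = c M := by
      rw [Polynomial.finsetSum_coeff, Finset.sum_eq_single M]
      · simp
      · intro k hk hkM
        rw [Polynomial.coeff_monomial, if_neg]
        intro hjk
        apply hkM
        rw [← hj k hk, ← hj M hM]
        change m + n * j k = m + n * j M
        rw [hjk]
      · exact fun hM' => absurd hM hM'
    intro h0
    rw [h0, Polynomial.coeff_zero] at hpM
    exact hc M hM hpM.symm
  have hpN : p.natDegree ≤ j M := Polynomial.natDegree_sum_le_of_forall_le _ _ fun k hk =>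
    (Polynomial.natDegree_monomial_le _).trans (hjM k hk)
  have htf : t * f ^ m ≠ 0 := mul_ne_zero (h.mem_ne_zero htS) (pow_ne_zero _ hf0)
  have hrel : aeval ![f ^ n, w] (p.homogenize (j M)) ∈
      low (Fin 2) K (j M * (n * f.totalDegree)) := by
    refine mem_low_of_mul_mem htf ?_
    rw [totalDegree_mul_of_isDomain (h.mem_ne_zero htS) (pow_ne_zero _ hf0),
      totalDegree_pow_of_ne_zero hf0, ← ht.2.2.1, add_assoc, ← hDk M hM, hdegI M hM, hp,
      Finset.mul_sum]
    have := Submodule.sub_mem _ hsumI (Submodule.sum_mem _ hcl)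
    rwa [Finset.sum_sub_distrib, sub_sub_cancel] at this
  obtain ⟨c, hc⟩ := exists_sub_mem_low_of_homogenize hW (h.mem_ne_zero hWS) _ p hp0 hpN hrel
  exact ⟨W, c, hWF, hWS, hW, hc⟩

theorem le_smallBracket_next {f P τ f' : MvPolynomial (Fin 2) K} {n d : ℕ} (hf0 : f ≠ 0)
    (hn : 0 < n) {hd : 0 < d} (hlog : S ≤ logBracket P f τ d hd) (hτ : τ ≠ 0)
    (hsmall : ∀ t ∈ S, S ≤ smallBracket (f * P) t τ.totalDegree)
    (hf' : f' ∈ low (Fin 2) K (n * f.totalDegree)) :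
    ∀ t ∈ S ⊔ Submonoid.powers f, S ⊔ Submonoid.powers f ≤
      smallBracket (f' * P) t (f ^ (n - 1) * τ).totalDegree := by
  have hT : (f ^ (n - 1) * τ).totalDegree + f.totalDegree = n * f.totalDegree + τ.totalDegree := by
    rw [totalDegree_mul_of_isDomain (pow_ne_zero _ hf0) hτ, totalDegree_pow_of_ne_zero hf0]
    obtain ⟨n, rfl⟩ := Nat.exists_eq_succ_of_ne_zero hn.ne'
    simp
    ring
  set T := (f ^ (n - 1) * τ).totalDegree
  have hSS : ∀ t ∈ S, ∀ u ∈ S, u ∈ smallBracket (f' * P) t T := fun t ht u hu => by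
    refine ⟨(hlog hu).1, ?_⟩
    have h₁ := (hsmall t ht hu).2
    rw [mul_assoc] at h₁
    refine mem_low_of_mul_mem hf0 ?_
    rw [show f * (f' * P * bracket u t) = f * (P * bracket u t) * f' by ring]
    rcases h₁ with h₁ | h₁
    · simp [h₁]
    · by_cases hlt : u.totalDegree + t.totalDegree + τ.totalDegree = 0
      · omega
      refine low_mono ?_ (mul_mem_low (Nat.le_sub_one_of_lt h₁) hf')
      omega
  have hfS : ∀ u ∈ S, u ∈ smallBracket (f' * P) f T := fun u hu => by
    obtain ⟨h0, -, hl⟩ := hlog hu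
    refine ⟨h0, ?_⟩
    have h₁ : (P * bracket u f).totalDegree ≤ u.totalDegree + τ.totalDegree := by
      rw [← mem_low_succ]
      have h₂ : C ((u.totalDegree / d : ℕ) : K) * (u * τ) ∈
          low (Fin 2) K (u.totalDegree + τ.totalDegree + 1) :=
        C_mul_mem_low _ (mem_low_succ.2 (totalDegree_mul _ _))
      rw [map_natCast] at h₂
      have := Submodule.add_mem _ (low_mono (Nat.le_succ _) hl) h₂
      rwa [sub_add_cancel] at this
    rw [mul_assoc, mul_comm f']
    refine low_mono ?_ (mul_mem_low h₁ hf')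
    omega
  have hff : f ∈ smallBracket (f' * P) f T := ⟨hf0, by simp [bracket_self]⟩
  have key : ∀ t, (∀ u ∈ S, u ∈ smallBracket (f' * P) t T) →
      f ∈ smallBracket (f' * P) t T → S ⊔ Submonoid.powers f ≤ smallBracket (f' * P) t T :=
    fun t h₁ h₂ => sup_le h₁ (Submonoid.powers_le.2 h₂)
  intro t ht u hu
  have hS0 : S ⊔ Submonoid.powers f ≤ smallBracket (f' * P) f T := key f hfS hff
  refine key t (fun v hv => ?_) (mem_smallBracket_comm hf0 (hS0 ht)) hu
  have hv0 := (hlog hv).1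
  exact mem_smallBracket_comm hv0 (key v (hSS v hv)
    (mem_smallBracket_comm hf0 (hfS v hv)) ht)

theorem le_logBracket_next {f P w τ : MvPolynomial (Fin 2) K} {d : ℕ} (hf0 : f ≠ 0)
    {hd : 0 < d} (hlog : S ≤ logBracket P f τ d hd) (hτ : τ ≠ 0)
    (hsmall : ∀ t ∈ S, S ≤ smallBracket (f * P) t τ.totalDegree) (hw : w ∈ S)
    (hdeg : w.totalDegree = ramification d f * f.totalDegree) (c : K)
    (hc : f ^ ramification d f - C c * w ∈ low (Fin 2) K (ramification d f * f.totalDegree)) :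
    S ⊔ Submonoid.powers f ≤ logBracket P (f ^ ramification d f - C c * w)
      (f ^ (ramification d f - 1) * τ) (Nat.gcd d f.totalDegree)
      (Nat.gcd_pos_of_pos_left _ hd) := by
  have hg : 0 < Nat.gcd d f.totalDegree := Nat.gcd_pos_of_pos_left _ hd
  have hgn := gcd_mul_ramification d f
  have hn := ramification_pos hd f
  have hgf : Nat.gcd d f.totalDegree ∣ f.totalDegree := Nat.gcd_dvd_right _ _
  set n := ramification d f
  set g := Nat.gcd d f.totalDegree
  have hpow : f ^ n = f ^ (n - 1) * f := by rw [← pow_succ, Nat.sub_add_cancel hn]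
  have hT : (f ^ (n - 1) * τ).totalDegree + f.totalDegree = n * f.totalDegree + τ.totalDegree := by
    rw [totalDegree_mul_of_isDomain (pow_ne_zero _ hf0) hτ, totalDegree_pow_of_ne_zero hf0]
    obtain ⟨n, hn'⟩ := Nat.exists_eq_succ_of_ne_zero hn.ne'
    rw [hn']
    simp
    ring
  have hnf : (n - 1) * f.totalDegree + f.totalDegree = n * f.totalDegree := by
    rw [← Nat.succ_mul, Nat.succ_eq_add_one, Nat.sub_add_cancel hn]
  set T := (f ^ (n - 1) * τ).totalDegree
  refine sup_le (fun u hu => ?_) (Submonoid.powers_le.2 ?_)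
  · obtain ⟨h0, ⟨a, ha⟩, hl⟩ := hlog hu
    have ha' : u.totalDegree = g * (n * a) := by rw [ha, ← mul_assoc, hgn]
    refine ⟨h0, ⟨_, ha'⟩, ?_⟩
    rw [ha, Nat.mul_div_cancel_left _ hd, ← ha] at hl
    rw [show u.totalDegree / g = n * a by rw [ha', Nat.mul_div_cancel_left _ hg],
      bracket_pow_sub_C_mul]
    have e : P * ((n : MvPolynomial (Fin 2) K) * f ^ (n - 1) * bracket u f - C c * bracket u w) -
        ((n * a : ℕ) : MvPolynomial (Fin 2) K) * (u * (f ^ (n - 1) * τ)) =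
        C (n : K) * (f ^ (n - 1) * (P * bracket u f - (a : MvPolynomial (Fin 2) K) * (u * τ))) -
          C c * (P * bracket u w) := by
      rw [map_natCast]
      push_cast
      ring
    rw [e]
    refine Submodule.sub_mem _ (C_mul_mem_low _ (low_mono ?_
      (mul_mem_low (totalDegree_pow_of_ne_zero hf0 _).le hl))) (C_mul_mem_low _ ?_)
    · omega
    · have h₁ := (hsmall w hw hu).2
      rw [mul_assoc, hdeg] at h₁
      refine mem_low_of_mul_mem hf0 (low_mono ?_ h₁)
      omega
  · refine ⟨hf0, hgf, ?_⟩
    obtain ⟨-, -, hl⟩ := hlog hw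
    obtain ⟨b, hb⟩ := hgf
    have hwb : w.totalDegree = d * b := by
      rw [hdeg]
      conv_lhs => rw [hb]
      rw [← hgn]
      ring
    rw [show w.totalDegree / d = b by rw [hwb, Nat.mul_div_cancel_left _ hd]] at hl
    rw [show f.totalDegree / g = b by
      conv_lhs => rw [hb]
      exact Nat.mul_div_cancel_left _ hg, bracket_pow_sub_C_mul, bracket_self,
      bracket_antisymm f w]
    have e : P * ((n : MvPolynomial (Fin 2) K) * f ^ (n - 1) * 0 - C c * -bracket w f) -
        (b : MvPolynomial (Fin 2) K) * (f * (f ^ (n - 1) * τ)) =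
        C c * (P * bracket w f - (b : MvPolynomial (Fin 2) K) * (w * τ)) -
          C (b : K) * (τ * (f ^ n - C c * w)) := by
      rw [map_natCast, hpow]
      ring
    rw [e]
    refine Submodule.sub_mem _ (C_mul_mem_low _ (low_mono ?_ hl))
      (C_mul_mem_low _ (low_mono ?_ (mul_mem_low le_rfl hc))) <;> omega

/-- The construction of the next key polynomial. -/
theorem next (h : Stage P Q S F τ d) (hf : 2 ≤ (subst P Q F).totalDegree)
    {W : Polynomial (Polynomial K)} {c : K} (hWF : W.degree < F.degree) (hWS : subst P Q W ∈ S)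
    (hW : (subst P Q W).totalDegree =
      ramification d (subst P Q F) * (subst P Q F).totalDegree)
    (hc : subst P Q F ^ ramification d (subst P Q F) - C c * subst P Q W ∈
      low (Fin 2) K (ramification d (subst P Q F) * (subst P Q F).totalDegree)) :
    Stage P Q (S ⊔ Submonoid.powers (subst P Q F))
      (F ^ ramification d (subst P Q F) - Polynomial.C (Polynomial.C c) * W)
      (subst P Q F ^ (ramification d (subst P Q F) - 1) * τ)
      (Nat.gcd d (subst P Q F).totalDegree) := by
  have hf0 : subst P Q F ≠ 0 := by
    intro h0
    simp [h0] at hf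
  have hFnat : F.degree ≤ (F ^ ramification d (subst P Q F)).degree := by
    rw [Polynomial.degree_eq_natDegree h.monic.ne_zero,
      Polynomial.degree_eq_natDegree (h.monic.pow _).ne_zero, h.monic.natDegree_pow]
    exact_mod_cast Nat.le_mul_of_pos_left _ (ramification_pos h.pos (subst P Q F))
  have hlt : (Polynomial.C (Polynomial.C c) * W).degree <
      (F ^ ramification d (subst P Q F)).degree := by
    refine lt_of_le_of_lt ?_ (hWF.trans_le hFnat)
    rw [Polynomial.C_mul']
    exact Polynomial.degree_smul_le _ _
  have hF' := Polynomial.degree_sub_eq_left_of_degree_lt hlt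
  have hsubst : subst P Q (F ^ ramification d (subst P Q F) -
      Polynomial.C (Polynomial.C c) * W) =
      subst P Q F ^ ramification d (subst P Q F) - C c * subst P Q W := by
    rw [map_sub, map_mul, map_pow, subst_C_C]
  have hlog := le_logBracket_next hf0 h.le_logBracket h.ne_zero h.le_smallBracket hWS hW c hc
  have hn := ramification_pos h.pos (subst P Q F)
  have hgn := gcd_mul_ramification d (subst P Q F)
  set f := subst P Q F
  set n := ramification d f with hndef
  have hdegF' : (F ^ n - Polynomial.C (Polynomial.C c) * W).degree = n * F.natDegree := by
    rw [hF', Polynomial.degree_eq_natDegree (h.monic.pow n).ne_zero, h.monic.natDegree_pow]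
    norm_cast
  refine ⟨(h.monic.pow n).sub_of_left hlt, mul_ne_zero (pow_ne_zero _ hf0) h.ne_zero,
    Nat.gcd_pos_of_pos_left _ h.pos, ?_, ?_, ?_, ?_, ?_, ?_⟩
  · rw [hsubst]
    exact hlog
  · rw [hsubst]
    exact le_smallBracket_next hf0 hn h.le_logBracket h.ne_zero h.le_smallBracket hc
  · have hc0 : c ≠ 0 := by
      rintro rfl
      rw [C_0, zero_mul, sub_zero, mem_low_iff (pow_ne_zero _ hf0),
        totalDegree_pow_of_ne_zero hf0] at hc
      exact lt_irrefl _ hc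
    have hfw : Sim (f ^ n) (subst P Q W) :=
      ⟨pow_ne_zero _ hf0, h.mem_ne_zero hWS, by rw [totalDegree_pow_of_ne_zero hf0, hW], c, hc0,
        by rwa [totalDegree_pow_of_ne_zero hf0]⟩
    have key : ∀ s ∈ S, ∀ t ∈ S, ∀ a b : ℕ, b ≤ a →
        (s * f ^ a).totalDegree = (t * f ^ b).totalDegree → Sim (s * f ^ a) (t * f ^ b) := by
      intro s hs t ht a b hba hst
      have hs0 := h.mem_ne_zero hs
      have ht0 := h.mem_ne_zero ht
      rw [totalDegree_mul_of_isDomain hs0 (pow_ne_zero _ hf0),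
        totalDegree_mul_of_isDomain ht0 (pow_ne_zero _ hf0), totalDegree_pow_of_ne_zero hf0,
        totalDegree_pow_of_ne_zero hf0] at hst
      obtain ⟨l, hl⟩ := dvd_sub_of_add_mul_eq h.pos (h.dvd_totalDegree hs) (h.dvd_totalDegree ht)
        hba hst
      change a - b = n * l at hl
      have ha : a = n * l + b := by omega
      have h₁ : Sim (s * (f ^ n) ^ l) (s * subst P Q W ^ l) := (Sim.refl hs0).mul (hfw.pow l)
      have h₂ : Sim (s * subst P Q W ^ l) t := by
        refine h.sim _ (S.mul_mem hs (S.pow_mem hWS l)) _ ht ?_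
        rw [totalDegree_mul_of_isDomain hs0 (pow_ne_zero _ (h.mem_ne_zero hWS)),
          totalDegree_pow_of_ne_zero (h.mem_ne_zero hWS), hW]
        rw [ha] at hst
        linarith
      have h₃ := (h₁.trans h₂).mul (Sim.refl (pow_ne_zero b hf0))
      rwa [mul_assoc, ← pow_mul, ← pow_add, ← ha] at h₃
    intro s hs t ht hst
    obtain ⟨s', hs', _, ⟨a, rfl⟩, rfl⟩ := Submonoid.mem_sup.1 hs
    obtain ⟨t', ht', _, ⟨b, rfl⟩, rfl⟩ := Submonoid.mem_sup.1 ht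
    rcases le_total b a with hba | hab
    · exact key s' hs' t' ht' a b hba hst
    · exact (key t' ht' s' hs' b a hab hst.symm).symm
  · intro s hs
    obtain ⟨s', hs', _, ⟨a, rfl⟩, rfl⟩ := Submonoid.mem_sup.1 hs
    change (s' * f ^ a).totalDegree ≠ 1
    rw [totalDegree_mul_of_isDomain (h.mem_ne_zero hs') (pow_ne_zero _ hf0),
      totalDegree_pow_of_ne_zero hf0]
    rcases a with - | a
    · simpa using h.totalDegree_ne_one s' hs'
    · rw [Nat.succ_mul]
      omega
  · intro G hG0 hG
    rw [hdegF'] at hG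
    obtain ⟨V, hV, hGV⟩ := exists_expansion h.monic n G hG
    have hne : ∃ k ∈ Finset.range n, subst P Q (V k) * f ^ k ≠ 0 := by
      by_contra! hall
      refine hG0 (hGV.trans (Finset.sum_eq_zero fun k hk => ?_))
      by_cases hVk : V k = 0
      · rw [hVk, zero_mul]
      · obtain ⟨s, -, hs⟩ := h.exists_sim _ hVk (hV k)
        exact absurd (hall k hk) (mul_ne_zero hs.1 (pow_ne_zero _ hf0))
    obtain ⟨k, hk, hk0, hmax⟩ := exists_max_totalDegree _ _ hne
    have hdegk := totalDegree_subst_mul_pow hf0 hk0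
    obtain ⟨s, hs, hsim⟩ := h.exists_sim_of_subst_ne_zero (left_ne_zero_of_mul hk0) (hV k)
    have hdvdk : d ∣ (subst P Q (V k)).totalDegree := hsim.2.2.1 ▸ h.dvd_totalDegree hs
    refine ⟨s * f ^ k, Submonoid.mul_mem_sup hs ⟨k, rfl⟩,
      Sim.trans (.of_sub_mem_low one_ne_zero hk0 ?_) (hsim.mul (Sim.refl (pow_ne_zero k hf0)))⟩
    rw [C_1, one_mul, hGV, map_sum, ← Finset.add_sum_erase _ _ hk, map_mul, map_pow,
      add_sub_cancel_left]
    refine Submodule.sum_mem _ fun i hi => ?_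
    rw [map_mul, map_pow]
    obtain ⟨hik, hi⟩ := Finset.mem_erase.1 hi
    by_cases hi0 : subst P Q (V i) * f ^ i = 0
    · exact Or.inl hi0
    refine Or.inr (lt_of_le_of_ne (mem_low_succ.1 (hmax i hi)) fun heq => hik ?_)
    obtain ⟨t, ht, hsimt⟩ := h.exists_sim_of_subst_ne_zero (left_ne_zero_of_mul hi0) (hV i)
    have hdvdi : d ∣ (subst P Q (V i)).totalDegree := hsimt.2.2.1 ▸ h.dvd_totalDegree ht
    rw [hdegk, totalDegree_subst_mul_pow hf0 hi0] at heq
    rw [Finset.mem_range] at hi hk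
    rcases le_total i k with hle | hle
    · have := Nat.eq_zero_of_dvd_of_lt
        (dvd_sub_of_add_mul_eq h.pos hdvdk hdvdi hle heq.symm) (show k - i < n by omega)
      omega
    · have := Nat.eq_zero_of_dvd_of_lt
        (dvd_sub_of_add_mul_eq h.pos hdvdi hdvdk hle heq) (show i - k < n by omega)
      omega
  · intro D hgD hD
    obtain ⟨k, hk, hdk⟩ := exists_dvd_sub_mul h.pos f.totalDegree hgD
    change k < n at hk
    rw [totalDegree_mul_of_isDomain (pow_ne_zero _ hf0) h.ne_zero,
      totalDegree_pow_of_ne_zero hf0] at hD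
    have hkn : k * f.totalDegree ≤ (n - 1) * f.totalDegree := Nat.mul_le_mul_right _ (by omega)
    obtain ⟨U, hUF, hUS, hU⟩ := h.exists_mem _ hdk (by zify at hkn; push_cast at hD; linarith)
    have hU0 := h.mem_ne_zero hUS
    refine ⟨U * F ^ k, ?_, ?_, ?_⟩
    · have hUne : U ≠ 0 := by
        rintro rfl
        simp at hU0
      rw [hdegF', Polynomial.degree_eq_natDegree (mul_ne_zero hUne (pow_ne_zero _ h.monic.ne_zero)),
        Polynomial.natDegree_mul hUne (pow_ne_zero _ h.monic.ne_zero), h.monic.natDegree_pow]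
      have h₁ := Polynomial.natDegree_lt_natDegree hUne hUF
      have h₂ : (k + 1) * F.natDegree ≤ n * F.natDegree := Nat.mul_le_mul_right _ hk
      rw [Nat.succ_mul] at h₂
      norm_cast
      omega
    · rw [map_mul, map_pow]
      exact Submonoid.mul_mem_sup hUS ⟨k, rfl⟩
    · rw [map_mul, map_pow, totalDegree_mul_of_isDomain hU0 (pow_ne_zero _ hf0),
        totalDegree_pow_of_ne_zero hf0]
      push_cast
      linarith

/-- If the current key polynomial has degree at least two and the degree of `P` is small enough for
all the later ones to have degree at least two as well, then no polynomial in `P` and `Q` has degree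
one. -/
theorem totalDegree_subst_ne_one [IsAlgClosed K] (h : Stage P Q S F τ d)
    (hf : 2 ≤ (subst P Q F).totalDegree)
    (hP : P.totalDegree ≤
      τ.totalDegree + (ramification d (subst P Q F) - 1) * (subst P Q F).totalDegree)
    (G : Polynomial (Polynomial K)) : (subst P Q G).totalDegree ≠ 1 := by
  intro hG
  induction hd : d using Nat.strong_induction_on generalizing S F τ d with | _ _ ihd
  induction he : (subst P Q F).totalDegree using Nat.strong_induction_on generalizing S F τ d with
    | _ _ ihe
  subst hd he
  have hf0 : subst P Q F ≠ 0 := by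
    intro h0
    simp [h0] at hf
  have hF : 0 < F.natDegree := by
    refine Nat.pos_of_ne_zero fun h0 => ?_
    rw [Polynomial.eq_one_of_monic_natDegree_zero h.monic h0] at hf
    simp at hf
  have hG0 : G ≠ 0 := by
    rintro rfl
    simp at hG
  obtain ⟨V, hV, hGV⟩ := exists_expansion h.monic (G.natDegree + 1) G (by
    rw [Polynomial.degree_eq_natDegree hG0]
    norm_cast
    nlinarith)
  have hsum : subst P Q G =
      ∑ k ∈ Finset.range (G.natDegree + 1), subst P Q (V k) * subst P Q F ^ k := by
    conv_lhs => rw [hGV]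
    simp only [map_sum, map_mul, map_pow]
  have hne : ∃ k ∈ Finset.range (G.natDegree + 1), subst P Q (V k) * subst P Q F ^ k ≠ 0 := by
    by_contra! hall
    rw [hsum, Finset.sum_eq_zero hall] at hG
    simp at hG
  obtain ⟨k, hk, hk0, hmax⟩ := exists_max_totalDegree _ _ hne
  by_cases hrel : subst P Q G ∈
      low (Fin 2) K (subst P Q (V k) * subst P Q F ^ k).totalDegree
  · obtain ⟨W, c, hWF, hWS, hW, hc⟩ :=
      h.exists_relation hf0 _ V hV _ hmax ⟨k, hk, hk0, rfl⟩ (hsum ▸ hrel)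
    have hnext := h.next hf hWF hWS hW hc
    have hτ : (subst P Q F ^ (ramification d (subst P Q F) - 1) * τ).totalDegree =
        τ.totalDegree + (ramification d (subst P Q F) - 1) * (subst P Q F).totalDegree := by
      rw [totalDegree_mul_of_isDomain (pow_ne_zero _ hf0) h.ne_zero,
        totalDegree_pow_of_ne_zero hf0, add_comm]
    have hlow := hnext.lower_bound
    have hf' : 2 ≤ (subst P Q (F ^ ramification d (subst P Q F) -
        Polynomial.C (Polynomial.C c) * W)).totalDegree := by omega
    have hP' := hP.trans (hτ.ge.trans (Nat.le_add_right _
      ((ramification (Nat.gcd d (subst P Q F).totalDegree) (subst P Q (F ^ ramification d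
        (subst P Q F) - Polynomial.C (Polynomial.C c) * W)) - 1) * (subst P Q (F ^ ramification d
          (subst P Q F) - Polynomial.C (Polynomial.C c) * W)).totalDegree)))
    rcases (Nat.gcd_le_left (subst P Q F).totalDegree h.pos).lt_or_eq with hlt | heq
    · exact ihd _ hlt hnext hf' hP' rfl
    · have hn : ramification d (subst P Q F) = 1 := by
        rw [ramification, heq, Nat.div_self h.pos]
      refine ihe _ ?_ hnext hf' hP' heq rfl
      rw [hn, pow_one, one_mul] at hc
      rw [hn, pow_one, map_sub, map_mul, subst_C_C]
      rcases hc with h0 | hc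
      · rw [h0, totalDegree_zero]
        omega
      · exact hc
  · have hle : (subst P Q (V k) * subst P Q F ^ k).totalDegree ≤ 1 := by
      rw [mem_low, not_or, hG] at hrel
      omega
    have hge : 1 ≤ (subst P Q (V k) * subst P Q F ^ k).totalDegree := by
      have h₁ : subst P Q G ∈
          low (Fin 2) K ((subst P Q (V k) * subst P Q F ^ k).totalDegree + 1) := by
        rw [hsum]
        exact Submodule.sum_mem _ hmax
      rwa [mem_low_succ, hG] at h₁
    have hdeg := totalDegree_subst_mul_pow hf0 hk0
    obtain ⟨s, hs, hsim⟩ := h.exists_sim_of_subst_ne_zero (left_ne_zero_of_mul hk0) (hV k)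
    have hs1 := h.totalDegree_ne_one s hs
    rw [← hsim.2.2.1] at hs1
    have : k * (subst P Q F).totalDegree ≠ 1 := fun h1 => by
      have := Nat.eq_one_of_mul_eq_one_left h1
      omega
    rcases Nat.eq_zero_or_pos k with rfl | hkpos
    · omega
    · have := Nat.le_mul_of_pos_left (subst P Q F).totalDegree hkpos
      omega

/-- The first stage of the construction, where the current key polynomial is `Q`. -/
theorem init (hP : 2 ≤ P.totalDegree) (hPQ : IsUnit (bracket P Q)) :
    Stage P Q (Submonoid.powers P) Polynomial.X (bracket P Q) P.totalDegree := by
  have hP0 : P ≠ 0 := by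
    rintro rfl
    simp at hP
  have hT : (bracket P Q).totalDegree = 0 := (isUnit_iff_totalDegree_of_isReduced.1 hPQ).2
  have hpos : 0 < P.totalDegree := by omega
  refine ⟨Polynomial.monic_X, hPQ.ne_zero, hpos, ?_, ?_, ?_, ?_, ?_, ?_⟩
  · rw [Submonoid.powers_le, subst_X]
    refine ⟨hP0, dvd_rfl, ?_⟩
    rw [Nat.div_self hpos]
    simp
  · rintro _ ⟨a, rfl⟩
    have : P ∈ smallBracket (subst P Q Polynomial.X * P) P (bracket P Q).totalDegree :=
      ⟨hP0, by simp [bracket_self]⟩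
    refine Submonoid.powers_le.2 (mem_smallBracket_comm hP0 (Submonoid.pow_mem _ this a))
  · rintro _ ⟨a, rfl⟩ _ ⟨b, rfl⟩ hab
    simp only [totalDegree_pow_of_ne_zero hP0] at hab
    rw [Nat.eq_of_mul_eq_mul_right hpos hab]
    exact Sim.refl (pow_ne_zero _ hP0)
  · rintro _ ⟨a, rfl⟩ ha
    rw [totalDegree_pow_of_ne_zero hP0] at ha
    have := Nat.eq_one_of_mul_eq_one_left ha
    omega
  · intro V hV0 hV
    rw [Polynomial.degree_X, ← Nat.cast_one, ← Polynomial.natDegree_lt_iff_degree_lt hV0,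
      Nat.lt_one_iff] at hV
    obtain ⟨p, rfl⟩ := Polynomial.natDegree_eq_zero.1 hV
    have hp : p ≠ 0 := by
      rintro rfl
      simp at hV0
    refine ⟨P ^ p.natDegree, ⟨_, rfl⟩, .of_sub_mem_low (Polynomial.leadingCoeff_ne_zero.2 hp)
      (pow_ne_zero _ hP0) ?_⟩
    rw [subst_C, Polynomial.aeval_eq_sum_range, Finset.sum_range_succ, smul_eq_C_mul,
      Polynomial.coeff_natDegree, add_sub_cancel_right]
    refine Submodule.sum_mem _ fun i hi => Submodule.smul_mem _ _ (Or.inr ?_)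
    rw [totalDegree_pow_of_ne_zero hP0, totalDegree_pow_of_ne_zero hP0]
    exact Nat.mul_lt_mul_of_pos_right (Finset.mem_range.1 hi) hpos
  · intro D hD hlt
    obtain ⟨k, rfl⟩ := hD
    have hk : 0 ≤ k := by
      by_contra hk
      nlinarith
    obtain ⟨k, rfl⟩ := Int.eq_ofNat_of_zero_le hk
    refine ⟨Polynomial.C (Polynomial.X ^ k), ?_, ?_, ?_⟩
    · exact Polynomial.degree_C_le.trans_lt (by simp)
    · exact ⟨k, by simp⟩
    · simp [totalDegree_pow_of_ne_zero hP0, mul_comm]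

end Stage

end Stage

theorem add_le_lcm {m n : ℕ} (hm : 0 < m) (hn : 0 < n) (hmn : ¬m ∣ n) (hnm : ¬n ∣ m) :
    m + n ≤ m / Nat.gcd m n * n := by
  have h : m / Nat.gcd m n * n = Nat.lcm m n := by
    rw [Nat.lcm, Nat.div_mul_right_comm (Nat.gcd_dvd_left m n)]
  rw [h]
  have key : ∀ {a b : ℕ}, 0 < a → 0 < b → ¬b ∣ a → 2 * a ≤ Nat.lcm a b := by
    intro a b ha hb hba
    obtain ⟨k, hk⟩ := Nat.dvd_lcm_left a b
    have hpos := Nat.lcm_pos ha hb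
    have hk1 : k ≠ 1 := by
      rintro rfl
      rw [mul_one] at hk
      exact hba (hk ▸ Nat.dvd_lcm_right a b)
    have hk0 : k ≠ 0 := by
      rintro rfl
      omega
    have : a * 2 ≤ a * k := Nat.mul_le_mul_left a (by omega)
    omega
  have h₁ := key hm hn hnm
  have h₂ := key hn hm hmn
  rw [Nat.lcm_comm] at h₂
  omega

end JungVanDerKulk

/-- The Jung–van der Kulk theorem: if `(P, Q)` is a polynomial automorphism of `K²`
(with polynomial inverse `(P', Q')`), then of the two total degrees `deg P` and `deg Q`,
one divides the other. -/
theorem jung_van_der_kulk (K : Type*) [Field K] [IsAlgClosed K]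
    (P Q P' Q' : MvPolynomial (Fin 2) K)
    (h1 : MvPolynomial.aeval (fun i : Fin 2 => if i = 0 then P else Q) P' =
      (MvPolynomial.X 0 : MvPolynomial (Fin 2) K))
    (h2 : MvPolynomial.aeval (fun i : Fin 2 => if i = 0 then P else Q) Q' =
      (MvPolynomial.X 1 : MvPolynomial (Fin 2) K)) :
    P.totalDegree ∣ Q.totalDegree ∨ Q.totalDegree ∣ P.totalDegree := by
  by_contra! hdvd
  obtain ⟨hPQ, hQP⟩ := hdvd
  have hP0 : P.totalDegree ≠ 0 := fun h0 => hQP (h0 ▸ dvd_zero _)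
  have hQ0 : Q.totalDegree ≠ 0 := fun h0 => hPQ (h0 ▸ dvd_zero _)
  have hP1 : P.totalDegree ≠ 1 := fun h1 => hPQ (h1 ▸ one_dvd _)
  have hQ1 : Q.totalDegree ≠ 1 := fun h1 => hQP (h1 ▸ one_dvd _)
  have hunit : IsUnit (JungVanDerKulk.bracket P Q) := by
    simpa using JungVanDerKulk.isUnit_bracket _ P' Q' h1 h2
  have hstage := JungVanDerKulk.Stage.init (by omega) hunit
  have hsubst (p : MvPolynomial (Fin 2) K) : JungVanDerKulk.subst P Q
      (aeval (fun i : Fin 2 => if i = 0 then Polynomial.C Polynomial.X else Polynomial.X) p) =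
      aeval (fun i : Fin 2 => if i = 0 then P else Q) p := by
    induction p using MvPolynomial.induction_on with
    | C c => simp [algebraMap_eq, Polynomial.algebraMap_apply]
    | add p q hp hq => simp only [map_add, hp, hq]
    | mul_X p i hp =>
      rw [map_mul, map_mul, map_mul, hp, aeval_X, aeval_X]
      fin_cases i <;> simp
  refine hstage.totalDegree_subst_ne_one ?_ ?_ _
    ((congrArg totalDegree ((hsubst P').trans h1)).trans (totalDegree_X 0))
  · rw [JungVanDerKulk.subst_X]
    omega
  · rw [JungVanDerKulk.subst_X, JungVanDerKulk.ramification, Nat.sub_mul]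
    have := JungVanDerKulk.add_le_lcm (Nat.pos_of_ne_zero hP0) (Nat.pos_of_ne_zero hQ0) hPQ hQP
    omega
end
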